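/- Lemma (cylinder sets of the orbit code are lattice congruence classes): Let e ∈ ℰ, k = ⌊√e⌋ + 1, with vertex list V(e) = (v₁, …, v_k). For all sufficiently small λ > 0, for every j with 1 ≤ j ≤ 2k−1 and all z, z̃ ∈ X̃^e, the following three statements are equivalent: (i) the orbit codes σ(z) and σ(z̃) agree in the entries indexed by −1, 1, 2, …, j; (ii) z̃ − z ∈ 𝕃^e_j; (iii) Ψ^j(z̃) − Ψ^j(z) ∈ ℤ·(λ·p_j·𝐞), where 𝐞 is the coordinate unit vector in the direction of the non-integer coordinate of the j-th vertex. -/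

import Mathlib

open scoped Classical

noncomputable section

open Set

/-- The scaled round-off map `F_λ` on the plane: `F_λ(z) = λ·F(z/λ)`,
so `F_λ(z) = (λ⌊z₁⌋ − z₂, z₁)`. -/
def Fl (lam : ℝ) (z : ℝ × ℝ) : ℝ × ℝ := (lam * (⌊z.1⌋ : ℝ) - z.2, z.1)

/-- The inverse of `F_λ`. -/
def Flinv (lam : ℝ) (z : ℝ × ℝ) : ℝ × ℝ := (z.2, lam * (⌊z.2⌋ : ℝ) - z.1)

/-- Integer iterate `F_λ^k`, `k ∈ ℤ`. -/
def FlIter (lam : ℝ) (k : ℤ) (z : ℝ × ℝ) : ℝ × ℝ :=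
  if 0 ≤ k then (Fl lam)^[k.toNat] z else (Flinv lam)^[(-k).toNat] z

/-- Membership in the scaled lattice `(λℤ)²`. -/
def IsLatticePt (lam : ℝ) (z : ℝ × ℝ) : Prop := ∃ a b : ℤ, z = (lam * a, lam * b)

/-- The discrete vector field `𝐯(z) = F_λ⁴(z) − z`. -/
def vfield (lam : ℝ) (z : ℝ × ℝ) : ℝ × ℝ := (Fl lam)^[4] z - z

/-- The auxiliary (integrable) vector field `𝐰`. -/
def wfield (lam : ℝ) (z : ℝ × ℝ) : ℝ × ℝ :=
  (lam * (2 * (⌊z.2⌋ : ℝ) + 1), -(lam * (2 * (⌊z.1⌋ : ℝ) + 1)))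

/-- The constant value `𝐰_{m,n}` of `𝐰` on the box `B_{m,n}`. -/
def wmn (lam : ℝ) (m n : ℤ) : ℝ × ℝ :=
  (lam * (2 * (n : ℝ) + 1), -(lam * (2 * (m : ℝ) + 1)))

/-- The piecewise-affine function `P(x) = ⌊x⌋² + (2⌊x⌋+1)(x − ⌊x⌋)`. -/
def Pfun (x : ℝ) : ℝ := (⌊x⌋ : ℝ) ^ 2 + (2 * (⌊x⌋ : ℝ) + 1) * (x - (⌊x⌋ : ℝ))

/-- The Hamiltonian `𝒫(x,y) = P(x) + P(y)`. -/
def Ham (z : ℝ × ℝ) : ℝ := Pfun z.1 + Pfun z.2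

/-- The round Hamiltonian `𝒬(x,y) = x² + y²`. -/
def Qfun (z : ℝ × ℝ) : ℝ := z.1 ^ 2 + z.2 ^ 2

/-- The level set `Π(z)` of `𝒫` through `z`. -/
def levelSet (z : ℝ × ℝ) : Set (ℝ × ℝ) := {w | Ham w = Ham z}

/-- The grid `Δ` of horizontal and vertical integer lines. -/
def DeltaSet : Set (ℝ × ℝ) := {z | (∃ m : ℤ, z.1 = (m : ℝ)) ∨ (∃ n : ℤ, z.2 = (n : ℝ))}

/-- The box `B_{m,n}`. -/
def Bbox (m n : ℤ) : Set (ℝ × ℝ) := {z | ⌊z.1⌋ = m ∧ ⌊z.2⌋ = n}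

/-- The lattice `ℤ² ⊂ ℝ²`. -/
def intLattice : Set (ℝ × ℝ) := {z | ∃ a b : ℤ, z = ((a : ℝ), (b : ℝ))}

/-- `r(c)`: the number of representations of `c` as a sum of two integer squares. -/
def rfun (c : ℝ) : ℕ := Set.ncard {p : ℤ × ℤ | ((p.1 : ℝ)) ^ 2 + ((p.2 : ℝ)) ^ 2 = c}

/-- Euclidean distance from `z` to the symmetry line `y = x`. -/
def dG (z : ℝ × ℝ) : ℝ := |z.1 - z.2| / Real.sqrt 2

/-- The integer round-off `R`. -/
def Rfl (z : ℝ × ℝ) : ℤ × ℤ := (⌊z.1⌋, ⌊z.2⌋)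

/-- The rescaled round-off `R_λ(w) = λ·R(w/λ)`. -/
def Rlam (lam : ℝ) (w : ℝ × ℝ) : ℝ × ℝ :=
  (lam * (⌊w.1 / lam⌋ : ℝ), lam * (⌊w.2 / lam⌋ : ℝ))

/-- The return domain `X`. -/
def Xdom (lam : ℝ) : Set (ℝ × ℝ) :=
  {z | IsLatticePt lam z ∧ 0 ≤ z.1 ∧ 0 ≤ z.2 ∧
    dG z ≤ dG ((Fl lam)^[4] z) ∧ dG z < dG ((Flinv lam)^[4] z)}

/-- Forward transit time `τ` to `X`. -/
def tau (lam : ℝ) (z : ℝ × ℝ) : ℕ := sInf {k : ℕ | 1 ≤ k ∧ (Fl lam)^[k] z ∈ Xdom lam}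

/-- Backward transit time `τ₋` to `X`. -/
def tauMinus (lam : ℝ) (z : ℝ × ℝ) : ℕ := sInf {k : ℕ | (Flinv lam)^[k] z ∈ Xdom lam}

/-- The return orbit `O_τ(z)`. -/
def returnOrbit (lam : ℝ) (z : ℝ × ℝ) : Set (ℝ × ℝ) :=
  {w | ∃ k : ℤ, -(tauMinus lam z : ℤ) ≤ k ∧ k ≤ (tau lam z : ℤ) ∧ w = FlIter lam k z}

/-- The first-return map `Φ`. -/
def Phi (lam : ℝ) (z : ℝ × ℝ) : ℝ × ℝ := (Fl lam)^[tau lam z] z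

/-- The full orbit `O(z) = {F_λ^t(z) : t ∈ ℤ}`. -/
def fullOrbit (lam : ℝ) (z : ℝ × ℝ) : Set (ℝ × ℝ) := {w | ∃ t : ℤ, w = FlIter lam t z}

/-- The set `Λ` of transition points. -/
def TransSet (lam : ℝ) : Set (ℝ × ℝ) :=
  {z | IsLatticePt lam z ∧ Rfl ((Fl lam)^[4] z) ≠ Rfl z}

/-- The set `Σ = ⋃ Σ_{m,n}`. -/
def SigmaSet (lam : ℝ) : Set (ℝ × ℝ) :=
  {z | z ∈ TransSet lam ∧ ∃ m n : ℤ,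
    max |z.1 - (m : ℝ)| |z.2 - (n : ℝ)| ≤
      lam * (max |2 * (m : ℝ) + 1| |2 * (n : ℝ) + 1| + 2)}

/-- `ℰ`: the natural numbers which are sums of two integer squares. -/
def Eset : Set ℕ := {n | ∃ a b : ℤ, (n : ℤ) = a ^ 2 + b ^ 2}

/-- The successor of `e` in `ℰ`. -/
def nextE (e : ℕ) : ℕ := sInf {f | f ∈ Eset ∧ e < f}

/-- The critical interval `I^e = (e, e′)`. -/
def Icrit (e : ℕ) : Set ℝ := Set.Ioo (e : ℝ) (nextE e : ℝ)

/-- The set `X^e`. -/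
def Xe (lam : ℝ) (e : ℕ) : Set (ℝ × ℝ) :=
  {z | z ∈ Xdom lam ∧ ∀ w ∈ returnOrbit lam z, Ham w ∈ Icrit e}

/-- A point of `X^e` is regular if it is not a transition point and its return
orbit avoids `Σ`. -/
def IsRegularPt (lam : ℝ) (e : ℕ) (z : ℝ × ℝ) : Prop :=
  z ∈ Xe lam e ∧ z ∉ TransSet lam ∧ returnOrbit lam z ∩ SigmaSet lam = ∅

/-- `J` is a maximal subinterval `Ĩ^e(λ)` of `I^e` on which all points of `X^e`
are regular. -/
def IsMaxRegInterval (lam : ℝ) (e : ℕ) (J : Set ℝ) : Prop :=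
  J ⊆ Icrit e ∧ J.OrdConnected ∧
    (∀ z ∈ Xe lam e, Ham z ∈ J → IsRegularPt lam e z) ∧
    ∀ J' : Set ℝ, J ⊆ J' → J' ⊆ Icrit e → J'.OrdConnected →
      (∀ z ∈ Xe lam e, Ham z ∈ J' → IsRegularPt lam e z) → J' = J

/-- The regular domain `X̃^e` determined by the interval `J = Ĩ^e(λ)`. -/
def Xtilde (lam : ℝ) (e : ℕ) (J : Set ℝ) : Set (ℝ × ℝ) :=
  {z | z ∈ Xe lam e ∧ Ham z ∈ J}

/-- The type of a vertex: the floor of the absolute value of its non-integer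
coordinate. -/
def vtype (z : ℝ × ℝ) : ℕ :=
  if ∃ m : ℤ, z.1 = (m : ℝ) then (⌊|z.2|⌋).toNat else (⌊|z.1|⌋).toNat

/-- `v` (1-indexed, entries `v 1, …, v k` with `k = ⌊√e⌋+1`) is the vertex list
of the polygon class of `e`, and `o j` records whether the `j`-th vertex lies on
a horizontal lattice line (i.e. has integer `y`-coordinate): for every value
`a ∈ I^e`, the vertices of the level polygon `{𝒫 = a}` lying in the first octant,
enumerated clockwise (i.e. by increasing `x`-coordinate), have types
`v 1, …, v k`. -/
def IsVertexList (e : ℕ) (v : ℕ → ℕ) (o : ℕ → Bool) : Prop :=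
  ∀ a ∈ Icrit e, ∃ p : ℕ → ℝ × ℝ,
    (∀ j, 1 ≤ j → j ≤ Nat.sqrt e + 1 →
      Ham (p j) = a ∧ p j ∈ DeltaSet ∧ 0 ≤ (p j).2 ∧ (p j).2 ≤ (p j).1 ∧
        vtype (p j) = v j ∧ (o j = true ↔ ∃ n : ℤ, (p j).2 = (n : ℝ))) ∧
    (∀ i j, 1 ≤ i → i < j → j ≤ Nat.sqrt e + 1 → (p i).1 < (p j).1) ∧
    (∀ w : ℝ × ℝ, Ham w = a → w ∈ DeltaSet → 0 ≤ w.2 → w.2 ≤ w.1 →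
      ∃ j, 1 ≤ j ∧ j ≤ Nat.sqrt e + 1 ∧ w = p j)

/-- The extended vertex list: `v_j = v_{2k−j}` for `k < j ≤ 2k−1`. -/
def vext (e : ℕ) (v : ℕ → ℕ) (j : ℕ) : ℕ :=
  if j ≤ Nat.sqrt e + 1 then v j else v (2 * (Nat.sqrt e + 1) - j)

/-- The extended orientation list. -/
def oext (e : ℕ) (o : ℕ → Bool) (j : ℕ) : Bool :=
  if j ≤ Nat.sqrt e + 1 then o j else o (2 * (Nat.sqrt e + 1) - j)

/-- The recursively defined integers `q_j` (here `v` is the extended vertex list):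
`q₁ = (2v₁+1)²`, `q_j = q_{j−1}` if `v_j = v_{j−1}`, and
`q_j = lcm((2v_j+1)(2v_{j−1}+1), q_{j−1})` otherwise. -/
def qseq (v : ℕ → ℕ) : ℕ → ℕ
  | 0 => (2 * v 1 + 1) ^ 2
  | 1 => (2 * v 1 + 1) ^ 2
  | j + 2 =>
    if v (j + 2) = v (j + 1) then qseq v (j + 1)
    else Nat.lcm ((2 * v (j + 2) + 1) * (2 * v (j + 1) + 1)) (qseq v (j + 1))

/-- `p_j = q_j/(2v_j+1)`. -/
def pseq (v : ℕ → ℕ) (j : ℕ) : ℕ := qseq v j / (2 * v j + 1)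

/-- `q = q_{2k−1}`. -/
def qval (e : ℕ) (v : ℕ → ℕ) : ℕ := qseq (vext e v) (2 * (Nat.sqrt e + 1) - 1)

/-- The vector `L_j = (λ q_j/(2v₁+1))·(1,1)`. -/
def Lvec (lam : ℝ) (v1 : ℕ) (qj : ℕ) : ℝ × ℝ :=
  (lam * (qj : ℝ) / (2 * (v1 : ℝ) + 1), lam * (qj : ℝ) / (2 * (v1 : ℝ) + 1))

/-- The lattice `𝕃 = ℤ·L_j + ℤ·((L_j − 𝐰_{v₁,v₁})/2)` as an additive subgroup
of `ℝ²`. -/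
def latticeL (lam : ℝ) (v1 : ℕ) (qj : ℕ) : AddSubgroup (ℝ × ℝ) :=
  AddSubgroup.closure
    {Lvec lam v1 qj, (2⁻¹ : ℝ) • (Lvec lam v1 qj - wmn lam (v1 : ℤ) (v1 : ℤ))}

/-- Forward transit time of `F_λ⁴` to `Λ`. -/
def tTrans (lam : ℝ) (z : ℝ × ℝ) : ℕ :=
  sInf {i : ℕ | 1 ≤ i ∧ (Fl lam)^[4 * i] z ∈ TransSet lam}

/-- The strip map `Ψ(z) = F_λ^{4t(z)}(z)`. -/
def Psi (lam : ℝ) (z : ℝ × ℝ) : ℝ × ℝ := (Fl lam)^[4 * tTrans lam z] z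

/-- Backward transit time of `F_λ⁻⁴` to `Λ`. -/
def sTrans (lam : ℝ) (z : ℝ × ℝ) : ℕ :=
  sInf {i : ℕ | 1 ≤ i ∧ (Flinv lam)^[4 * i] z ∈ TransSet lam}

/-- The inverse strip map `Ψ⁻¹`. -/
def PsiInv (lam : ℝ) (z : ℝ × ℝ) : ℝ × ℝ := (Flinv lam)^[4 * sTrans lam z] z

/-- `Ψ^j` for `j ∈ {−1} ∪ ℕ`. -/
def PsiPow (lam : ℝ) (j : ℤ) (z : ℝ × ℝ) : ℝ × ℝ :=
  if j < 0 then PsiInv lam z else (Psi lam)^[j.toNat] z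

/-- The coordinate unit vector in the non-integer direction of a vertex lying
on a horizontal (`horiz = true`) resp. vertical lattice line. -/
def evec (horiz : Bool) : ℝ × ℝ := if horiz then (1, 0) else (0, 1)

/-- `s ∈ {0, …, 2v_j}` is the code entry at a vertex point `w` of type `vj`: if
the vertex lies on a horizontal line `y = n` then, writing
`w = λ(⌈v_j/λ⌉ + x_j, ⌈n/λ⌉ + y_j)` with `|y_j| < 2v_j+1`, `s ≡ y_j (mod 2v_j+1)`;
analogously in the vertical case. -/
def CodeAt (lam : ℝ) (vj : ℕ) (horiz : Bool) (w : ℝ × ℝ) (s : ℤ) : Prop :=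
  0 ≤ s ∧ s < 2 * (vj : ℤ) + 1 ∧
    (if horiz then
        ∃ n Y yj : ℤ, w.2 = lam * (Y : ℝ) ∧ Y = ⌈(n : ℝ) / lam⌉ + yj ∧
          |yj| < 2 * (vj : ℤ) + 1 ∧ s ≡ yj [ZMOD (2 * (vj : ℤ) + 1)]
      else
        ∃ m X xj : ℤ, w.1 = lam * (X : ℝ) ∧ X = ⌈(m : ℝ) / lam⌉ + xj ∧
          |xj| < 2 * (vj : ℤ) + 1 ∧ s ≡ xj [ZMOD (2 * (vj : ℤ) + 1)])

/-- `σ` is the orbit code `(σ₋₁, σ₁, …, σ_{2k−1})` of `z`. -/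
def IsOrbitCode (lam : ℝ) (e : ℕ) (v : ℕ → ℕ) (o : ℕ → Bool) (z : ℝ × ℝ)
    (σ : ℤ → ℤ) : Prop :=
  CodeAt lam (v 1) (!(o 1)) (PsiInv lam z) (σ (-1)) ∧
    ∀ j : ℕ, 1 ≤ j → j ≤ 2 * (Nat.sqrt e + 1) - 1 →
      CodeAt lam (vext e v j) (oext e o j) ((Psi lam)^[j] z) (σ (j : ℤ))

/-- The Euclidean norm on `ℝ²`. -/
def enorm2 (z : ℝ × ℝ) : ℝ := Real.sqrt (z.1 ^ 2 + z.2 ^ 2)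

/-- The rotation number `ν(λ) = arccos(λ/2)/(2π)`. -/
def nuRot (lam : ℝ) : ℝ := Real.arccos (lam / 2) / (2 * Real.pi)

/-- Distance from a real number to the nearest integer. -/
def distInt (x : ℝ) : ℝ := |x - (round x : ℝ)|

/-- The first-order recurrence time `t*(λ)`. -/
def tstar (lam : ℝ) : ℕ :=
  sInf {k : ℕ | 1 ≤ k ∧ distInt ((k : ℝ) * nuRot lam) < distInt (4 * nuRot lam)}

/-- The square `A(r,λ)` of lattice points. -/
def Aset (r lam : ℝ) : Set (ℝ × ℝ) := {z | IsLatticePt lam z ∧ max |z.1| |z.2| < r}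

end

theorem Fl4_steps (lam x y : ℝ) (m : ℤ) (hm : ⌊x⌋ = m) :
    ∃ a1 a2 a3 : ℤ, ((a1:ℝ) ≤ lam * m - y ∧ lam * m - y < a1 + 1) ∧
      ((a2:ℝ) ≤ lam * a1 - x ∧ lam * a1 - x < a2 + 1) ∧
      ((a3:ℝ) ≤ y + lam * (a2 - m) ∧ y + lam * (a2 - m) < a3 + 1) ∧
      (Fl lam)^[4] (x, y) = (x + lam * (a3 - a1), y + lam * (a2 - m)) := by
  refine ⟨⌊lam * m - y⌋, ⌊lam * ⌊lam * m - y⌋ - x⌋,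
    ⌊y + lam * (⌊lam * ⌊lam * m - y⌋ - x⌋ - m)⌋, ⟨Int.floor_le _, Int.lt_floor_add_one _⟩,
    ⟨Int.floor_le _, Int.lt_floor_add_one _⟩, ⟨Int.floor_le _, Int.lt_floor_add_one _⟩, ?_⟩
  have e : lam * (⌊lam * (⌊lam * m - y⌋:ℝ) - x⌋:ℝ) - (lam * m - y) =
    y + lam * (⌊lam * ⌊lam * m - y⌋ - x⌋ - m) := by ring
  simp only [Function.iterate_succ, Function.iterate_zero, Function.comp, id, Fl, hm]
  rw [e]
  (refine Prod.ext ?_ ?_ <;> dsimp only <;> ring)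

theorem Rfl_box {x y : ℝ} {m n : ℤ} (h1 : (m:ℝ) ≤ x) (h2 : x < m + 1) (h3 : (n:ℝ) ≤ y)
    (h4 : y < n + 1) : Rfl (x, y) = (m, n) := by
  simp only [Rfl, Prod.mk.injEq]
  exact ⟨Int.floor_eq_iff.2 ⟨h1, h2⟩, Int.floor_eq_iff.2 ⟨h3, h4⟩⟩

theorem box_Rfl {x y : ℝ} {m n : ℤ} (h : Rfl (x, y) = (m, n)) : (m:ℝ) ≤ x ∧ x < m + 1 ∧ (n:ℝ) ≤ y ∧
    y < n + 1 := by
  simp only [Rfl, Prod.mk.injEq] at h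
  have h1 := Int.floor_eq_iff.1 h.1
  have h2 := Int.floor_eq_iff.1 h.2
  exact ⟨h1.1, h1.2, h2.1, h2.2⟩

/-- Admissible boxes. -/
def Adm (m n : ℤ) : Prop := (0 ≤ m ∧ 0 ≤ n) ∨ (n < 0 ∧ 1 ≤ m ∧ -m ≤ n)

theorem nonLam {lam x y : ℝ} {m n : ℤ} (hl : 0 < lam) (hl1 : lam ≤ 1 / 1000)
    (hlm : |lam * m| ≤ 1 / 1000) (hln : |lam * n| ≤ 1 / 1000)
    (hb : Rfl (x, y) = (m, n)) (had : Adm m n) (hpos : 0 < x ∨ 0 < n)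
    (hR : Rfl ((Fl lam)^[4] (x, y)) = (m, n)) :
    (Fl lam)^[4] (x, y) = (x + lam * (2 * n + 1), y - lam * (2 * m + 1)) := by
  obtain ⟨h1, h2, h3, h4⟩ := box_Rfl hb
  have hfm : ⌊x⌋ = m := Int.floor_eq_iff.2 ⟨h1, h2⟩
  obtain ⟨a1, a2, a3, ⟨ha, ha'⟩, ⟨hb1, hb'⟩, ⟨hc, hc'⟩, he⟩ := Fl4_steps lam x y m hfm
  rw [he] at hR ⊢
  obtain ⟨g1, g2, g3, g4⟩ := box_Rfl hR
  have ha3 : a3 = n := by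
    have i1 : (a3:ℝ) < n + 1 := by linarith
    have i2 : (n:ℝ) < a3 + 1 := by linarith
    have i1 : a3 < n + 1 := by exact_mod_cast i1
    have i2 : n < a3 + 1 := by exact_mod_cast i2
    omega
  subst ha3
  rw [abs_le] at hlm hln
  rcases had with ⟨hm0, hn0⟩ | ⟨hn0, hm1, hmn⟩
  · have hm0' : (0:ℝ) ≤ m := by exact_mod_cast hm0
    have hn0' : (0:ℝ) ≤ a3 := by exact_mod_cast hn0
    have p1 : 0 ≤ lam * m := by positivity
    have p2 : 0 ≤ lam * a3 := by positivity
    have q1 : a1 = -a3 ∨ a1 = -a3 - 1 := by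
      have i1 : (a1:ℝ) < -a3 + 1 := by linarith
      have i2 : (-a3 - 1 : ℝ) < a1 + 1 := by linarith
      have i1 : a1 < -a3 + 1 := by exact_mod_cast i1
      have i2 : -a3 - 1 < a1 + 1 := by exact_mod_cast i2
      omega
    rcases q1 with q1 | q1
    · exfalso
      subst q1
      push_cast at *
      have q2 : a2 ≤ -m := by
        have : (a2:ℝ) < -m + 1 := by linarith
        have : a2 < -m + 1 := by exact_mod_cast this
        omega
      have q3 : a2 ≤ -m - 1 ∨ (a2 = -m ∧ 0 < m) := by
        by_cases hm00 : m = 0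
        · left
          subst hm00
          have : (a2:ℝ) < 0 := by
            rcases hpos with hp | hp
            · push_cast at *; linarith
            · have hp' : (0:ℝ) < a3 := by exact_mod_cast hp
              have : 0 < lam * a3 := by positivity
              push_cast at *; linarith
          have : a2 < 0 := by exact_mod_cast this
          omega
        · omega
      rcases q3 with q3 | ⟨q3, q4⟩
      · have : (a2:ℝ) ≤ -m - 1 := by exact_mod_cast q3
        nlinarith
      · have : (1:ℝ) ≤ m := by exact_mod_cast q4
        have h5 : (a2:ℝ) = -m := by exact_mod_cast q3
        rw [h5] at *
        nlinarith
    · subst q1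
      push_cast at *
      have q2 : a2 ≤ -m - 1 := by
        have : (a2:ℝ) < -m := by linarith
        have : a2 < -m := by exact_mod_cast this
        omega
      have q3 : a2 = -m - 1 := by
        by_contra hne
        have : a2 ≤ -m - 2 := by omega
        have : (a2:ℝ) ≤ -m - 2 := by exact_mod_cast this
        linarith
      subst q3
      push_cast
      (refine Prod.ext ?_ ?_ <;> dsimp only <;> ring)
  · have hm0' : (1:ℝ) ≤ m := by exact_mod_cast hm1
    have hn0' : (a3:ℝ) + 1 ≤ 0 := by exact_mod_cast hn0
    have hmn' : -(m:ℝ) ≤ a3 := by exact_mod_cast hmn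
    have p1 : lam ≤ lam * m := by nlinarith
    have p2 : lam * a3 + lam ≤ 0 := by nlinarith
    have q1 : a1 = -a3 ∨ a1 = -a3 - 1 := by
      have i1 : (a1:ℝ) < -a3 + 1 := by linarith
      have i2 : (-a3 - 1 : ℝ) < a1 + 1 := by linarith
      have i1 : a1 < -a3 + 1 := by exact_mod_cast i1
      have i2 : -a3 - 1 < a1 + 1 := by exact_mod_cast i2
      omega
    have q2 : a2 = -m ∨ a2 = -m - 1 := by
      have q1' : (a1:ℝ) ≤ -a3 ∧ (-a3 - 1:ℝ) ≤ a1 := by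
        constructor
        · have : a1 ≤ -a3 := by omega
          exact_mod_cast this
        · have : -a3 - 1 ≤ a1 := by omega
          exact_mod_cast this
      have r1 : lam * a1 ≤ lam * (-a3) := by nlinarith
      have r2 : lam * (-a3 - 1) ≤ lam * a1 := by nlinarith
      have i1 : (a2:ℝ) < -m + 1 := by linarith
      have i2 : (-m - 1 : ℝ) < a2 + 1 := by linarith
      have i1 : a2 < -m + 1 := by exact_mod_cast i1
      have i2 : -m - 1 < a2 + 1 := by exact_mod_cast i2
      omega
    rcases q1 with q1 | q1 <;> rcases q2 with q2 | q2 <;> subst q1 <;> subst q2 <;> push_cast at *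
    · exfalso; linarith
    · exfalso; linarith
    · exfalso; linarith
    · (refine Prod.ext ?_ ?_ <;> dsimp only <;> ring)

theorem sig_far {lam x y : ℝ} (hl : 0 < lam) (hL : (x, y) ∈ TransSet lam) (hS : (x, y) ∉ SigmaSet lam)
    (m n : ℤ) (K : ℝ) (hK : K ≤ |2 * (m:ℝ) + 1| ∨ K ≤ |2 * (n:ℝ) + 1|)
    (h : |y - n| ≤ lam * (K + 2)) : lam * (K + 2) < |x - m| := by
  by_contra hc
  apply hS
  refine ⟨hL, m, n, ?_⟩
  have : K ≤ max |2 * (m:ℝ) + 1| |2 * (n:ℝ) + 1| := by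
    rcases hK with h | h
    · exact le_trans h (le_max_left _ _)
    · exact le_trans h (le_max_right _ _)
  have h2 : lam * (K + 2) ≤ lam * (max |2 * (m:ℝ) + 1| |2 * (n:ℝ) + 1| + 2) := by
    apply mul_le_mul_of_nonneg_left _ hl.le; linarith
  apply max_le
  · simp only; linarith
  · simp only; linarith

theorem sig_far' {lam x y : ℝ} (hl : 0 < lam) (hL : (x, y) ∈ TransSet lam) (hS : (x, y) ∉ SigmaSet lam)
    (m n : ℤ) (K : ℝ) (hK : K ≤ |2 * (m:ℝ) + 1| ∨ K ≤ |2 * (n:ℝ) + 1|)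
    (h : |x - m| ≤ lam * (K + 2)) : lam * (K + 2) < |y - n| := by
  by_contra hc
  push Not at hc
  have := sig_far hl hL hS m n K hK hc
  linarith

theorem Pfun_eq {x : ℝ} {m : ℤ} (h1 : (m:ℝ) ≤ x) (h2 : x < m + 1) :
    Pfun x = (m:ℝ) ^ 2 + (2 * m + 1) * (x - m) := by
  have : ⌊x⌋ = m := Int.floor_eq_iff.2 ⟨h1, h2⟩
  simp [Pfun, this]

theorem Ham_eq {x y : ℝ} {m n : ℤ} (h : Rfl (x, y) = (m, n)) :
    Ham (x, y) = (m:ℝ) ^ 2 + (n:ℝ) ^ 2 + (2 * m + 1) * (x - m) + (2 * n + 1) * (y - n) := by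
  obtain ⟨h1, h2, h3, h4⟩ := box_Rfl h
  simp only [Ham, Pfun_eq h1 h2, Pfun_eq h3 h4]
  ring

theorem nextE_spec (e : ℕ) : nextE e ∈ Eset ∧ e < nextE e := by
  have : ({f | f ∈ Eset ∧ e < f} : Set ℕ).Nonempty := by
    refine ⟨(e + 1) ^ 2, ⟨(e:ℤ) + 1, 0, by push_cast; ring⟩, by nlinarith⟩
  exact Nat.sInf_mem this

theorem nextE_gap (e : ℕ) (a b : ℤ) : a ^ 2 + b ^ 2 ≤ (e:ℤ) ∨ (nextE e : ℤ) ≤ a ^ 2 + b ^ 2 := by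
  by_cases h : a ^ 2 + b ^ 2 ≤ (e:ℤ)
  · exact Or.inl h
  · right
    push Not at h
    have h0 : 0 ≤ a ^ 2 + b ^ 2 := by positivity
    obtain ⟨c, hc⟩ := Int.eq_ofNat_of_zero_le h0
    rw [hc] at h ⊢
    have : c ∈ {f | f ∈ Eset ∧ e < f} := ⟨⟨a, b, hc.symm⟩, by exact_mod_cast h⟩
    exact_mod_cast Nat.sInf_le this

theorem gap_lt {e : ℕ} {H : ℝ} (h : H ∈ Icrit e) (a b : ℤ) (h' : (a:ℝ) ^ 2 + (b:ℝ) ^ 2 ≤ H) :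
    a ^ 2 + b ^ 2 ≤ (e:ℤ) := by
  rcases nextE_gap e a b with g | g
  · exact g
  · exfalso
    have g' : ((nextE e : ℕ) : ℝ) ≤ (a:ℝ) ^ 2 + (b:ℝ) ^ 2 := by exact_mod_cast g
    have := h.2
    linarith

theorem gap_gt {e : ℕ} {H : ℝ} (h : H ∈ Icrit e) (a b : ℤ) (h' : H ≤ (a:ℝ) ^ 2 + (b:ℝ) ^ 2) :
    (e:ℤ) < a ^ 2 + b ^ 2 := by
  by_contra g
  push Not at g
  have g' : (a:ℝ) ^ 2 + (b:ℝ) ^ 2 ≤ (e:ℝ) := by exact_mod_cast g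
  have := h.1
  linarith

/-- What happens at an exit point. -/
def ExitB (lam : ℝ) (m n : ℤ) (x y : ℝ) : Prop :=
  y < n + lam * (2 * m + 1) ∧
  (∃ θ : ℤ, (Fl lam)^[4] (x, y) = (x + lam * (2 * n - 1 + θ), y - lam * (2 * m + 1)) ∧
    ((θ = 0 ∧ y ≤ n + lam * m) ∨ (θ = 1 ∧ n + lam * m < y))) ∧
  m + lam * (2 * m + 3) < x ∧ x < m + 1 - lam * (2 * m + 5)

def ExitR (lam : ℝ) (m n : ℤ) (x y : ℝ) : Prop :=
  m + 1 - lam * (2 * n + 1) ≤ x ∧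
  (∃ θ : ℤ, (Fl lam)^[4] (x, y) = (x + lam * (2 * n + 1), y - lam * (2 * m + 1 + θ)) ∧
    ((θ = 0 ∧ x ≤ m + 1 - lam * (n + 1)) ∨ (θ = 1 ∧ m + 1 - lam * (n + 1) < x))) ∧
  n + lam * (2 * m + 5) < y ∧ y < n + 1 - lam * (2 * m + 5)

def ExitL (lam : ℝ) (m n : ℤ) (x y : ℝ) : Prop :=
  x < m + lam * (-2 * n - 1) ∧
  (∃ θ : ℤ, (Fl lam)^[4] (x, y) = (x + lam * (2 * n + 1), y - lam * (2 * m + θ)) ∧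
    ((θ = 0 ∧ x ≤ m + lam * (-n - 1)) ∨ (θ = 1 ∧ m + lam * (-n - 1) < x))) ∧
  n + lam * (2 * m + 3) < y ∧ y < n + 1 - lam * (2 * m + 3)

set_option maxHeartbeats 2000000 in
theorem exit_pos {e : ℕ} {lam x y : ℝ} {m n : ℤ} (hl : 0 < lam) (hl1 : lam ≤ 1 / 1000)
    (hlm : |lam * m| ≤ 1 / 1000) (hln : |lam * n| ≤ 1 / 1000)
    (hb : Rfl (x, y) = (m, n)) (hn0 : 0 ≤ n) (hnm : n ≤ m)
    (hL : (x, y) ∈ TransSet lam) (hS : (x, y) ∉ SigmaSet lam) (hH : Ham (x, y) ∈ Icrit e) :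
    (ExitB lam m n x y ∧ Rfl ((Fl lam)^[4] (x, y)) = (m, n - 1) ∧ (e:ℤ) < (m + 1) ^ 2 + n ^ 2) ∨
    (ExitR lam m n x y ∧ Rfl ((Fl lam)^[4] (x, y)) = (m + 1, n) ∧ (m + 1) ^ 2 + n ^ 2 ≤ (e:ℤ)) := by
  obtain ⟨h1, h2, h3, h4⟩ := box_Rfl hb
  have hfm : ⌊x⌋ = m := Int.floor_eq_iff.2 ⟨h1, h2⟩
  have hham := Ham_eq hb
  have hm0' : (0:ℝ) ≤ m := by exact_mod_cast hn0.trans hnm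
  have hn0' : (0:ℝ) ≤ n := by exact_mod_cast hn0
  have hnm' : (n:ℝ) ≤ m := by exact_mod_cast hnm
  have p1 : 0 ≤ lam * m := by positivity
  have p2 : 0 ≤ lam * n := by positivity
  have p3 : lam * n ≤ lam * m := mul_le_mul_of_nonneg_left hnm' hl.le
  rw [abs_le] at hlm hln
  obtain ⟨a1, a2, a3, ⟨ha, ha'⟩, ⟨hb1, hb'⟩, ⟨hc, hc'⟩, he⟩ := Fl4_steps lam x y m hfm
  have q1 : (a1 = -n ∧ y ≤ n + lam * m) ∨ (a1 = -n - 1 ∧ n + lam * m < y) := by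
    have i1 : (a1:ℝ) < -n + 1 := by linarith
    have i2 : (-n - 1 : ℝ) < a1 + 1 := by linarith
    have i1 : a1 < -n + 1 := by exact_mod_cast i1
    have i2 : -n - 1 < a1 + 1 := by exact_mod_cast i2
    have : a1 = -n ∨ a1 = -n - 1 := by omega
    rcases this with h | h <;> subst h <;> push_cast at *
    · left; exact ⟨rfl, by linarith⟩
    · right; exact ⟨rfl, by linarith⟩
  by_cases hnb : y < n + lam * (2 * m + 2)
  · have f1 := sig_far hl hL hS m n (2 * m + 1) (Or.inl (le_abs_self _))
      (by rw [abs_le]; constructor <;> linarith)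
    rw [abs_of_nonneg (by linarith)] at f1
    have f2 := sig_far hl hL hS (m + 1) n (2 * m + 3) (Or.inl (le_trans (by push_cast; linarith) (le_abs_self _)))
      (by rw [abs_le]; constructor <;> linarith)
    rw [abs_of_neg (by push_cast; linarith)] at f2
    push_cast at f2
    have q2 : a2 = -m - 1 := by
      have w : (-m - 1:ℝ) - 1 < a2 ∧ (a2:ℝ) < -m := by
        rcases q1 with ⟨q1, q1'⟩ | ⟨q1, q1'⟩ <;> subst q1 <;> push_cast at * <;> constructor <;> linarith
      have i1 : (-m - 1) - 1 < a2 := by exact_mod_cast w.1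
      have i2 : a2 < -m := by exact_mod_cast w.2
      omega
    subst q2
    have q3 : a3 = n - 1 := by
      have w : (n - 1:ℝ) < a3 + 1 ∧ (a3:ℝ) < n + 1 := by
        push_cast at *; constructor <;> linarith
      have i1 : (n - 1) < a3 + 1 := by exact_mod_cast w.1
      have i2 : a3 < n + 1 := by exact_mod_cast w.2
      have : a3 = n - 1 ∨ a3 = n := by omega
      rcases this with h | h
      · exact h
      · exfalso
        subst h
        apply hL.2
        rw [he, hb]
        rcases q1 with ⟨q1, q1'⟩ | ⟨q1, q1'⟩ <;> subst q1 <;> push_cast at * <;> apply Rfl_box <;> push_cast <;> linarith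
    subst q3
    left
    refine ⟨⟨by push_cast at *; linarith, ⟨-n - a1, by rw [he]; push_cast; (refine Prod.ext ?_ ?_ <;> dsimp only <;> ring), ?_⟩, by linarith, by linarith⟩, ?_, ?_⟩
    · rcases q1 with ⟨q1, q1'⟩ | ⟨q1, q1'⟩ <;> subst q1
      · left; exact ⟨by ring, q1'⟩
      · right; exact ⟨by ring, q1'⟩
    · rw [he]
      rcases q1 with ⟨q1, q1'⟩ | ⟨q1, q1'⟩ <;> subst q1 <;> push_cast at * <;> apply Rfl_box <;> push_cast <;> linarith
    · apply gap_gt hH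
      rw [hham]
      push_cast
      have t1 : (2 * (n:ℝ) + 1) * (y - n) ≤ (2 * n + 1) * (lam * (2 * m + 2)) :=
        mul_le_mul_of_nonneg_left (by linarith) (by linarith)
      have t2 : (2 * (m:ℝ) + 1) * (lam * (2 * m + 5)) ≤ (2 * m + 1) * (m + 1 - x) :=
        mul_le_mul_of_nonneg_left (by linarith) (by linarith)
      have t3 : (2 * (n:ℝ) + 1) * (lam * (2 * m + 2)) ≤ (2 * m + 1) * (lam * (2 * m + 5)) :=
        mul_le_mul (by linarith) (by linarith) (by linarith) (by linarith)
      linarith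
  · push Not at hnb
    have q1'' : a1 = -n - 1 := by
      rcases q1 with ⟨q1, q1'⟩ | ⟨q1, q1'⟩
      · exfalso; linarith
      · exact q1
    subst q1''
    clear q1
    have q2 : (a2 = -m - 1 ∧ x ≤ m + 1 - lam * (n + 1)) ∨ (a2 = -m - 2 ∧ m + 1 - lam * (n + 1) < x) := by
      push_cast at *
      have i1 : (a2:ℝ) < -m := by linarith
      have i2 : (-m - 2:ℝ) < a2 + 1 := by linarith
      have i1 : a2 < -m := by exact_mod_cast i1
      have i2 : -m - 2 < a2 + 1 := by exact_mod_cast i2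
      have : a2 = -m - 1 ∨ a2 = -m - 2 := by omega
      rcases this with h | h <;> subst h <;> push_cast at *
      · left; exact ⟨rfl, by linarith⟩
      · right; exact ⟨rfl, by linarith⟩
    have q3 : a3 = n := by
      have w : (n:ℝ) < a3 + 1 ∧ (a3:ℝ) < n + 1 := by
        rcases q2 with ⟨q2, _⟩ | ⟨q2, _⟩ <;> subst q2 <;> push_cast at * <;> constructor <;> linarith
      have i1 : n < a3 + 1 := by exact_mod_cast w.1
      have i2 : a3 < n + 1 := by exact_mod_cast w.2
      omega
    subst q3
    have hnr : m + 1 - lam * (2 * a3 + 1) ≤ x := by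
      by_contra hcon
      push Not at hcon
      apply hL.2
      rw [he, hb]
      rcases q2 with ⟨q2, _⟩ | ⟨q2, _⟩ <;> subst q2 <;> push_cast at * <;> apply Rfl_box <;> push_cast <;> linarith
    have f1 := sig_far' hl hL hS (m + 1) a3 (2 * m + 3) (Or.inl (le_trans (by push_cast; linarith) (le_abs_self _)))
      (by push_cast; rw [abs_le]; constructor <;> linarith)
    rw [abs_of_nonneg (by linarith)] at f1
    have f2 := sig_far' hl hL hS (m + 1) (a3 + 1) (2 * m + 3) (Or.inl (le_trans (by push_cast; linarith) (le_abs_self _)))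
      (by push_cast; rw [abs_le]; constructor <;> linarith)
    rw [abs_of_neg (by push_cast; linarith)] at f2
    push_cast at f2
    right
    refine ⟨⟨by push_cast at *; linarith, ⟨-m - 1 - a2, by rw [he]; push_cast; (refine Prod.ext ?_ ?_ <;> dsimp only <;> ring), ?_⟩, by linarith, by linarith⟩, ?_, ?_⟩
    · rcases q2 with ⟨q1, q1'⟩ | ⟨q1, q1'⟩ <;> subst q1
      · left; exact ⟨by ring, q1'⟩
      · right; exact ⟨by ring, q1'⟩
    · rw [he]
      rcases q2 with ⟨q2, _⟩ | ⟨q2, _⟩ <;> subst q2 <;> push_cast at * <;> apply Rfl_box <;> push_cast <;> linarith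
    · apply gap_lt hH
      rw [hham]
      push_cast
      have t1 : (2 * (a3:ℝ) + 1) * (lam * (2 * m + 5)) ≤ (2 * a3 + 1) * (y - a3) :=
        mul_le_mul_of_nonneg_left (by linarith) (by linarith)
      have t2 : (2 * (m:ℝ) + 1) * (m + 1 - x) ≤ (2 * m + 1) * (lam * (2 * a3 + 1)) :=
        mul_le_mul_of_nonneg_left (by linarith) (by linarith)
      have t3 : (2 * (m:ℝ) + 1) * (lam * (2 * a3 + 1)) ≤ (2 * a3 + 1) * (lam * (2 * m + 5)) := by
        have : 0 ≤ lam * (2 * a3 + 1) := by linarith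
        nlinarith
      linarith

set_option maxHeartbeats 2000000 in
theorem exit_neg {e : ℕ} {lam x y : ℝ} {m n : ℤ} (hl : 0 < lam) (hl1 : lam ≤ 1 / 1000)
    (hlm : |lam * m| ≤ 1 / 1000) (hln : |lam * n| ≤ 1 / 1000)
    (hb : Rfl (x, y) = (m, n)) (hn0 : n < 0) (hm1 : 1 ≤ m) (hnm : -m ≤ n)
    (hL : (x, y) ∈ TransSet lam) (hS : (x, y) ∉ SigmaSet lam) (hH : Ham (x, y) ∈ Icrit e) :
    (ExitB lam m n x y ∧ Rfl ((Fl lam)^[4] (x, y)) = (m, n - 1) ∧ m ^ 2 + n ^ 2 ≤ (e:ℤ)) ∨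
    (ExitL lam m n x y ∧ Rfl ((Fl lam)^[4] (x, y)) = (m - 1, n) ∧ (e:ℤ) < m ^ 2 + n ^ 2) := by
  obtain ⟨h1, h2, h3, h4⟩ := box_Rfl hb
  have hfm : ⌊x⌋ = m := Int.floor_eq_iff.2 ⟨h1, h2⟩
  have hham := Ham_eq hb
  have hm0' : (1:ℝ) ≤ m := by exact_mod_cast hm1
  have hn0' : (n:ℝ) + 1 ≤ 0 := by exact_mod_cast hn0
  have hnm' : -(m:ℝ) ≤ n := by exact_mod_cast hnm
  have p1 : lam ≤ lam * m := by nlinarith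
  have p2 : lam * n + lam ≤ 0 := by nlinarith
  have p3 : - (lam * m) ≤ lam * n := by nlinarith
  rw [abs_le] at hlm hln
  obtain ⟨a1, a2, a3, ⟨ha, ha'⟩, ⟨hb1, hb'⟩, ⟨hc, hc'⟩, he⟩ := Fl4_steps lam x y m hfm
  have q1 : (a1 = -n ∧ y ≤ n + lam * m) ∨ (a1 = -n - 1 ∧ n + lam * m < y) := by
    have i1 : (a1:ℝ) < -n + 1 := by linarith
    have i2 : (-n - 1 : ℝ) < a1 + 1 := by linarith
    have i1 : a1 < -n + 1 := by exact_mod_cast i1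
    have i2 : -n - 1 < a1 + 1 := by exact_mod_cast i2
    have : a1 = -n ∨ a1 = -n - 1 := by omega
    rcases this with h | h <;> subst h <;> push_cast at *
    · left; exact ⟨rfl, by linarith⟩
    · right; exact ⟨rfl, by linarith⟩
  by_cases hnb : y < n + lam * (2 * m + 2)
  · have f1 := sig_far hl hL hS m n (2 * m + 1) (Or.inl (le_abs_self _))
      (by rw [abs_le]; constructor <;> linarith)
    rw [abs_of_nonneg (by linarith)] at f1
    have f2 := sig_far hl hL hS (m + 1) n (2 * m + 3) (Or.inl (le_trans (by push_cast; linarith) (le_abs_self _)))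
      (by rw [abs_le]; constructor <;> linarith)
    rw [abs_of_neg (by push_cast; linarith)] at f2
    push_cast at f2
    have q2 : a2 = -m - 1 := by
      have w : (-m - 1:ℝ) - 1 < a2 ∧ (a2:ℝ) < -m := by
        rcases q1 with ⟨q1, q1'⟩ | ⟨q1, q1'⟩ <;> subst q1 <;> push_cast at * <;> constructor <;> linarith
      have i1 : (-m - 1) - 1 < a2 := by exact_mod_cast w.1
      have i2 : a2 < -m := by exact_mod_cast w.2
      omega
    subst q2
    have q3 : a3 = n - 1 := by
      have w : (n - 1:ℝ) < a3 + 1 ∧ (a3:ℝ) < n + 1 := by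
        push_cast at *; constructor <;> linarith
      have i1 : (n - 1) < a3 + 1 := by exact_mod_cast w.1
      have i2 : a3 < n + 1 := by exact_mod_cast w.2
      have : a3 = n - 1 ∨ a3 = n := by omega
      rcases this with h | h
      · exact h
      · exfalso
        subst h
        apply hL.2
        rw [he, hb]
        rcases q1 with ⟨q1, q1'⟩ | ⟨q1, q1'⟩ <;> subst q1 <;> push_cast at * <;> apply Rfl_box <;> push_cast <;> linarith
    subst q3
    left
    refine ⟨⟨by push_cast at *; linarith, ⟨-n - a1, by rw [he]; push_cast; (refine Prod.ext ?_ ?_ <;> dsimp only <;> ring), ?_⟩, by linarith, by linarith⟩, ?_, ?_⟩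
    · rcases q1 with ⟨q1, q1'⟩ | ⟨q1, q1'⟩ <;> subst q1
      · left; exact ⟨by ring, q1'⟩
      · right; exact ⟨by ring, q1'⟩
    · rw [he]
      rcases q1 with ⟨q1, q1'⟩ | ⟨q1, q1'⟩ <;> subst q1 <;> push_cast at * <;> apply Rfl_box <;> push_cast <;> linarith
    · apply gap_lt hH
      rw [hham]
      push_cast
      have t1 : (-(2 * (n:ℝ) + 1)) * (y - n) ≤ (-(2 * (n:ℝ) + 1)) * (lam * (2 * m + 2)) :=
        mul_le_mul_of_nonneg_left (by linarith) (by linarith)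
      have t2 : (2 * (m:ℝ) + 1) * (lam * (2 * m + 3)) ≤ (2 * m + 1) * (x - m) :=
        mul_le_mul_of_nonneg_left (by linarith) (by linarith)
      have t3 : (-(2 * (n:ℝ) + 1)) * (lam * (2 * m + 2)) ≤ (2 * m + 1) * (lam * (2 * m + 3)) := by
        exact mul_le_mul (by linarith) (by linarith) (by linarith) (by linarith)
      linarith
  · push Not at hnb
    have q1'' : a1 = -n - 1 := by
      rcases q1 with ⟨q1, q1'⟩ | ⟨q1, q1'⟩
      · exfalso; linarith
      · exact q1
    subst q1''
    clear q1
    have q2 : (a2 = -m ∧ x ≤ m + lam * (-n - 1)) ∨ (a2 = -m - 1 ∧ m + lam * (-n - 1) < x) := by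
      push_cast at *
      have i1 : (a2:ℝ) < -m + 1 := by linarith
      have i2 : (-m - 1:ℝ) < a2 + 1 := by linarith
      have i1 : a2 < -m + 1 := by exact_mod_cast i1
      have i2 : -m - 1 < a2 + 1 := by exact_mod_cast i2
      have : a2 = -m ∨ a2 = -m - 1 := by omega
      rcases this with h | h <;> subst h <;> push_cast at *
      · left; exact ⟨rfl, by linarith⟩
      · right; exact ⟨rfl, by linarith⟩
    have q3 : a3 = n := by
      have w : (n:ℝ) < a3 + 1 ∧ (a3:ℝ) < n + 1 := by
        rcases q2 with ⟨q2, _⟩ | ⟨q2, _⟩ <;> subst q2 <;> push_cast at * <;> constructor <;> linarith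
      have i1 : n < a3 + 1 := by exact_mod_cast w.1
      have i2 : a3 < n + 1 := by exact_mod_cast w.2
      omega
    subst q3
    have hnr : x < m + lam * (-2 * a3 - 1) := by
      by_contra hcon
      push Not at hcon
      apply hL.2
      rw [he, hb]
      rcases q2 with ⟨q2, _⟩ | ⟨q2, _⟩ <;> subst q2 <;> push_cast at * <;> apply Rfl_box <;> push_cast <;> linarith
    have f1 := sig_far' hl hL hS m a3 (2 * m + 1) (Or.inl (le_abs_self _))
      (by rw [abs_le]; constructor <;> linarith)
    rw [abs_of_nonneg (by linarith)] at f1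
    have f2 := sig_far' hl hL hS m (a3 + 1) (2 * m + 1) (Or.inl (le_abs_self _))
      (by rw [abs_le]; constructor <;> linarith)
    rw [abs_of_neg (by push_cast; linarith)] at f2
    push_cast at f2
    right
    refine ⟨⟨by push_cast at *; linarith, ⟨-m - a2, by rw [he]; push_cast; (refine Prod.ext ?_ ?_ <;> dsimp only <;> ring), ?_⟩, by linarith, by linarith⟩, ?_, ?_⟩
    · rcases q2 with ⟨q1, q1'⟩ | ⟨q1, q1'⟩ <;> subst q1
      · left; exact ⟨by ring, q1'⟩
      · right; exact ⟨by ring, q1'⟩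
    · rw [he]
      rcases q2 with ⟨q2, _⟩ | ⟨q2, _⟩ <;> subst q2 <;> push_cast at * <;> apply Rfl_box <;> push_cast <;> linarith
    · apply gap_gt hH
      rw [hham]
      have t1 : (-(2 * (a3:ℝ) + 1)) * (lam * (2 * m + 3)) ≤ (-(2 * (a3:ℝ) + 1)) * (y - a3) :=
        mul_le_mul_of_nonneg_left (by linarith) (by linarith)
      have t2 : (2 * (m:ℝ) + 1) * (x - m) ≤ (2 * m + 1) * (lam * (-2 * a3 - 1)) :=
        mul_le_mul_of_nonneg_left (by linarith) (by linarith)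
      have t3 : (2 * (m:ℝ) + 1) * (lam * (-2 * a3 - 1)) ≤ (-(2 * (a3:ℝ) + 1)) * (lam * (2 * m + 3)) := by
        have : 0 ≤ lam * (-2 * a3 - 1) := by nlinarith
        nlinarith
      linarith

theorem lat_Fl {lam : ℝ} {z : ℝ × ℝ} (h : IsLatticePt lam z) : IsLatticePt lam (Fl lam z) := by
  obtain ⟨a, b, rfl⟩ := h
  exact ⟨⌊lam * a⌋ - b, a, by simp [Fl]; ring⟩

theorem lat_iter {lam : ℝ} {z : ℝ × ℝ} (h : IsLatticePt lam z) (k : ℕ) :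
    IsLatticePt lam ((Fl lam)^[k] z) := by
  induction k with
  | zero => exact h
  | succ k ih => rw [Function.iterate_succ_apply']; exact lat_Fl ih

theorem lat_swap {lam : ℝ} {z : ℝ × ℝ} (h : IsLatticePt lam z) : IsLatticePt lam z.swap := by
  obtain ⟨a, b, rfl⟩ := h
  exact ⟨b, a, rfl⟩

theorem Flinv_Fl (lam : ℝ) (z : ℝ × ℝ) : Flinv lam (Fl lam z) = z := by
  simp [Fl, Flinv]

theorem Fl_Flinv (lam : ℝ) (z : ℝ × ℝ) : Fl lam (Flinv lam z) = z := by
  simp [Fl, Flinv]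

theorem Flinv_eq (lam : ℝ) (z : ℝ × ℝ) : Flinv lam z = (Fl lam z.swap).swap := by
  simp [Fl, Flinv]

theorem Flinv_iter (lam : ℝ) (k : ℕ) (z : ℝ × ℝ) :
    (Flinv lam)^[k] z = ((Fl lam)^[k] z.swap).swap := by
  induction k generalizing z with
  | zero => simp
  | succ k ih =>
    rw [Function.iterate_succ_apply', ih, Flinv_eq, Function.iterate_succ_apply']
    simp

theorem Flinv_iter_Fl (lam : ℝ) (k : ℕ) (z : ℝ × ℝ) :
    (Flinv lam)^[k] ((Fl lam)^[k] z) = z :=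
  Function.LeftInverse.iterate (Flinv_Fl lam) k z

theorem Flinv4_eq {lam : ℝ} {z w : ℝ × ℝ} (h : (Fl lam)^[4] w = z) : (Flinv lam)^[4] z = w := by
  rw [← h]; exact Flinv_iter_Fl lam 4 w

theorem Fl4_succ (lam : ℝ) (z : ℝ × ℝ) (t : ℕ) :
    (Fl lam)^[4 * (t + 1)] z = (Fl lam)^[4] ((Fl lam)^[4 * t] z) := by
  rw [← Function.iterate_add_apply]; congr 1; ring

theorem Fl4_add (lam : ℝ) (z : ℝ × ℝ) (s t : ℕ) :
    (Fl lam)^[4 * (s + t)] z = (Fl lam)^[4 * t] ((Fl lam)^[4 * s] z) := by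
  rw [← Function.iterate_add_apply]; congr 1; ring

theorem line {lam x y : ℝ} {m n : ℤ} (hl : 0 < lam) (hl1 : lam ≤ 1 / 1000)
    (hlm : |lam * m| ≤ 1 / 1000) (hln : |lam * n| ≤ 1 / 1000) (hlat : IsLatticePt lam (x, y))
    (hb : Rfl (x, y) = (m, n)) (had : Adm m n) (hx : 0 < x) (t : ℕ)
    (ht : ∀ t' < t, (Fl lam)^[4 * t'] (x, y) ∉ TransSet lam) :
    (Fl lam)^[4 * t] (x, y) = (x + t * (lam * (2 * n + 1)), y - t * (lam * (2 * m + 1))) ∧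
    Rfl ((Fl lam)^[4 * t] (x, y)) = (m, n) := by
  induction t with
  | zero => simpa using hb
  | succ t ih =>
    obtain ⟨i1, i2⟩ := ih (fun t' h => ht t' (by omega))
    have hnl := ht t (by omega)
    have hr : Rfl ((Fl lam)^[4 * (t + 1)] (x, y)) = (m, n) := by
      by_contra hc
      apply hnl
      refine ⟨lat_iter hlat _, ?_⟩
      rw [← Fl4_succ, i2]
      exact hc
    refine ⟨?_, hr⟩
    rw [Fl4_succ] at hr ⊢
    rw [i1] at hr i2 ⊢
    have hp : 0 < x + t * (lam * (2 * n + 1)) := by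
      obtain ⟨h1, -, -, -⟩ := box_Rfl i2
      rcases had with ⟨h, h'⟩ | ⟨_, h, _⟩
      · have : (0:ℝ) ≤ n := by exact_mod_cast h'
        have : 0 ≤ t * (lam * (2 * n + 1)) := by positivity
        linarith
      · have : (1:ℝ) ≤ m := by exact_mod_cast h
        linarith
    rw [nonLam hl hl1 hlm hln i2 had (Or.inl hp) hr]
    push_cast
    (refine Prod.ext ?_ ?_ <;> dsimp only <;> ring)

theorem travel {lam x y : ℝ} {m n : ℤ} (hl : 0 < lam) (hl1 : lam ≤ 1 / 1000)
    (hlm : |lam * m| ≤ 1 / 1000) (hln : |lam * n| ≤ 1 / 1000) (hlat : IsLatticePt lam (x, y))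
    (hb : Rfl (x, y) = (m, n)) (had : Adm m n) (hx : 0 < x) :
    ∃ t : ℕ, (∀ t' ≤ t, (Fl lam)^[4 * t'] (x, y) =
        (x + t' * (lam * (2 * n + 1)), y - t' * (lam * (2 * m + 1))) ∧
        Rfl ((Fl lam)^[4 * t'] (x, y)) = (m, n)) ∧
      (∀ t' < t, (Fl lam)^[4 * t'] (x, y) ∉ TransSet lam) ∧
      (Fl lam)^[4 * t] (x, y) ∈ TransSet lam := by
  classical
  have hex : ∃ t, (Fl lam)^[4 * t] (x, y) ∈ TransSet lam := by
    by_contra hc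
    push Not at hc
    have hm : (0:ℝ) ≤ m := by
      rcases had with ⟨h, h'⟩ | ⟨_, h, _⟩
      · exact_mod_cast h
      · have : (1:ℝ) ≤ m := by exact_mod_cast h
        linarith
    have hp : 0 < lam * (2 * m + 1) := by positivity
    obtain ⟨t, ht⟩ := Archimedean.arch (y - n + 1) hp
    rw [nsmul_eq_mul] at ht
    obtain ⟨i1, i2⟩ := line hl hl1 hlm hln hlat hb had hx t (fun t' _ => hc t')
    rw [i1] at i2
    obtain ⟨-, -, h3, -⟩ := box_Rfl i2
    linarith
  refine ⟨Nat.find hex, fun t' ht' => line hl hl1 hlm hln hlat hb had hx t' (fun s hs => ?_),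
    fun t' ht' => Nat.find_min hex ht', Nat.find_spec hex⟩
  exact Nat.find_min hex (lt_of_lt_of_le hs ht')

theorem tTrans_eq {lam : ℝ} {z : ℝ × ℝ} {t : ℕ} (h1 : 1 ≤ t)
    (h2 : (Fl lam)^[4 * t] z ∈ TransSet lam)
    (h3 : ∀ s, 1 ≤ s → s < t → (Fl lam)^[4 * s] z ∉ TransSet lam) : tTrans lam z = t := by
  apply le_antisymm
  · exact Nat.sInf_le ⟨h1, h2⟩
  · refine le_csInf ⟨t, h1, h2⟩ ?_
    rintro b ⟨hb1, hb2⟩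
    by_contra hc
    exact h3 b hb1 (by omega) hb2

theorem Psi_eq {lam : ℝ} {z : ℝ × ℝ} {t : ℕ} (h1 : 1 ≤ t)
    (h2 : (Fl lam)^[4 * t] z ∈ TransSet lam)
    (h3 : ∀ s, 1 ≤ s → s < t → (Fl lam)^[4 * s] z ∉ TransSet lam) :
    Psi lam z = (Fl lam)^[4 * t] z := by
  rw [Psi, tTrans_eq h1 h2 h3]

theorem orbit_mem {lam : ℝ} {z : ℝ × ℝ} {k : ℕ} (h : k ≤ tau lam z) :
    (Fl lam)^[k] z ∈ returnOrbit lam z := by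
  refine ⟨k, ?_, by exact_mod_cast h, ?_⟩
  · have : (0:ℤ) ≤ tauMinus lam z := by positivity
    linarith [(Int.natCast_nonneg k : (0:ℤ) ≤ k)]
  · simp [FlIter]

def nextB (e : ℕ) (b : ℤ × ℤ) : ℤ × ℤ :=
  if 0 ≤ b.2 then (if (e:ℤ) < (b.1 + 1) ^ 2 + b.2 ^ 2 then (b.1, b.2 - 1) else (b.1 + 1, b.2))
  else (if b.1 ^ 2 + b.2 ^ 2 ≤ (e:ℤ) then (b.1, b.2 - 1) else (b.1 - 1, b.2))

def bseq (e : ℕ) : ℕ → ℤ × ℤ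
  | 0 => ((Nat.sqrt (e / 2) : ℤ), (Nat.sqrt (e / 2) : ℤ))
  | j + 1 => nextB e (bseq e j)

theorem sqrt_lt (e : ℕ) : (e:ℤ) < ((Nat.sqrt e : ℤ) + 1) ^ 2 := by
  have := Nat.lt_succ_sqrt' e
  rw [Nat.succ_eq_add_one] at this
  exact_mod_cast this

theorem sqrt_le (e : ℕ) : ((Nat.sqrt e : ℤ)) ^ 2 ≤ (e:ℤ) := by
  exact_mod_cast Nat.sqrt_le' e

theorem bseq_first (e j : ℕ) (hj : j ≤ Nat.sqrt e) :
    0 ≤ (bseq e j).2 ∧ (bseq e j).1 - (bseq e j).2 = j ∧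
    (bseq e j).1 ^ 2 + (bseq e j).2 ^ 2 ≤ (e:ℤ) ∧
    (e:ℤ) < ((bseq e j).1 + 1) ^ 2 + ((bseq e j).2 + 1) ^ 2 := by
  induction j with
  | zero =>
    have h1 := sqrt_le (e / 2)
    have h2 := sqrt_lt (e / 2)
    simp only [bseq]
    refine ⟨by positivity, by simp, ?_, ?_⟩
    · have : (2:ℤ) * ((e / 2 : ℕ) : ℤ) ≤ e := by omega
      linarith
    · have : (e:ℤ) < 2 * ((e / 2 : ℕ) : ℤ) + 2 := by omega
      have h3 : (((e / 2 : ℕ) : ℤ)) + 1 ≤ ((Nat.sqrt (e/2) : ℤ) + 1) ^ 2 := by linarith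
      linarith
  | succ j ih =>
    obtain ⟨h1, h2, h3, h4⟩ := ih (by omega)
    have hs := sqrt_le e
    simp only [bseq, nextB]
    generalize bseq e j = b at *
    obtain ⟨m, n⟩ := b
    simp only at *
    rw [if_pos h1]
    split_ifs with h
    · simp only
      have hn : n ≠ 0 := by
        rintro rfl
        have h5 : m = j := by linarith
        subst h5
        have : ((Nat.sqrt e : ℤ)) < (j:ℤ) + 1 := by nlinarith
        omega
      refine ⟨by omega, by push_cast; linarith, by nlinarith [lt_of_le_of_ne h1 (Ne.symm hn)], by ring_nf at *; linarith⟩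
    · simp only
      refine ⟨h1, by push_cast; linarith, by linarith, by nlinarith⟩

theorem bseq_mid (e : ℕ) : bseq e (Nat.sqrt e) = ((Nat.sqrt e : ℤ), 0) := by
  obtain ⟨h1, h2, h3, h4⟩ := bseq_first e _ le_rfl
  have hs := sqrt_lt e
  generalize bseq e (Nat.sqrt e) = b at *
  obtain ⟨m, n⟩ := b
  simp only at *
  have : m < (Nat.sqrt e : ℤ) + 1 := by
    by_contra hc
    push Not at hc
    nlinarith
  have : n = 0 := by omega
  subst this
  simp; omega

def mirror (b : ℤ × ℤ) : ℤ × ℤ := (b.1, -b.2 - 1)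

theorem bseq_mirror (e i : ℕ) (hi : i ≤ Nat.sqrt e) :
    bseq e (Nat.sqrt e + 1 + i) = mirror (bseq e (Nat.sqrt e - i)) := by
  induction i with
  | zero =>
    simp only [add_zero, Nat.sub_zero, bseq, bseq_mid, mirror, nextB]
    rw [if_pos le_rfl, if_pos (by have := sqrt_lt e; linarith)]
    simp
  | succ i ih =>
    have ih := ih (by omega)
    rw [← add_assoc, bseq, ih]
    obtain ⟨h1, h2, h3, h4⟩ := bseq_first e (Nat.sqrt e - (i + 1)) (by omega)
    obtain ⟨g1, -⟩ := bseq_first e (Nat.sqrt e - i) (by omega)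
    have h5 : Nat.sqrt e - i = Nat.sqrt e - (i + 1) + 1 := by omega
    rw [h5] at g1 ⊢
    rw [bseq] at g1 ⊢
    generalize bseq e (Nat.sqrt e - (i + 1)) = b at *
    obtain ⟨m, n⟩ := b
    simp only at h1 h2 h3 h4
    by_cases h : (e:ℤ) < (m + 1) ^ 2 + n ^ 2
    · have hx : nextB e (m, n) = (m, n - 1) := by simp [nextB, h1, h]
      rw [hx] at g1 ⊢
      simp only at g1
      have e1 : mirror (m, n - 1) = (m, -n) := by simp [mirror]
      rw [e1]
      simp only [nextB]
      rw [if_neg (by omega), if_pos (by ring_nf; linarith)]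
      rfl
    · have hx : nextB e (m, n) = (m + 1, n) := by simp [nextB, h1, h]
      rw [hx] at g1 ⊢
      have e1 : mirror (m + 1, n) = (m + 1, -n - 1) := by simp [mirror]
      rw [e1]
      simp only [nextB]
      rw [if_neg (by omega), if_neg (by ring_nf at *; linarith)]
      simp [mirror]

/-- position facts for boxes -/
theorem bseq_pos (e j : ℕ) (h1 : 1 ≤ j) (h2 : j ≤ 2 * Nat.sqrt e) :
    1 ≤ (bseq e j).1 ∧ -(bseq e j).1 ≤ (bseq e j).2 ∧ (bseq e j).2 < (bseq e j).1 := by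
  rcases le_or_gt j (Nat.sqrt e) with h | h
  · obtain ⟨g1, g2, -, -⟩ := bseq_first e j h
    omega
  · obtain ⟨i, rfl⟩ : ∃ i, j = Nat.sqrt e + 1 + i := ⟨j - (Nat.sqrt e + 1), by omega⟩
    rw [bseq_mirror e i (by omega)]
    obtain ⟨g1, g2, -, -⟩ := bseq_first e (Nat.sqrt e - i) (by omega)
    simp only [mirror]
    omega

theorem bseq_bd (e j : ℕ) (h2 : j ≤ 2 * Nat.sqrt e + 1) :
    0 ≤ (bseq e j).1 ∧ (bseq e j).1 ≤ e ∧ |(bseq e j).2| ≤ e + 1 := by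
  have key : ∀ j ≤ Nat.sqrt e, 0 ≤ (bseq e j).1 ∧ (bseq e j).1 ≤ e ∧ 0 ≤ (bseq e j).2 ∧ (bseq e j).2 ≤ e := by
    intro j h
    obtain ⟨g1, g2, g3, -⟩ := bseq_first e j h
    have g4 : 0 ≤ (bseq e j).1 := by omega
    refine ⟨g4, by nlinarith, g1, by nlinarith⟩
  rcases le_or_gt j (Nat.sqrt e) with h | h
  · obtain ⟨g1, g2, g3, g4⟩ := key j h
    refine ⟨g1, g2, ?_⟩
    rw [abs_le]; constructor <;> linarith
  · obtain ⟨i, rfl⟩ : ∃ i, j = Nat.sqrt e + 1 + i := ⟨j - (Nat.sqrt e + 1), by omega⟩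
    rw [bseq_mirror e i (by omega)]
    obtain ⟨g1, g2, g3, g4⟩ := key (Nat.sqrt e - i) (by omega)
    simp only [mirror]
    refine ⟨g1, g2, ?_⟩
    rw [abs_le]; constructor <;> linarith

theorem not_int_of_between {x : ℝ} {m : ℤ} (h1 : (m:ℝ) < x) (h2 : x < m + 1) :
    ¬ ∃ n : ℤ, x = n := by
  rintro ⟨n, rfl⟩
  have h1 : m < n := by exact_mod_cast h1
  have h2 : n < m + 1 := by exact_mod_cast h2
  omega

theorem strict_id {k : ℕ} (f : ℕ → ℕ) (h1 : ∀ j, 1 ≤ j → j ≤ k → 1 ≤ f j ∧ f j ≤ k)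
    (h2 : ∀ j, 1 ≤ j → j + 1 ≤ k → f j < f (j + 1)) : ∀ j, 1 ≤ j → j ≤ k → f j = j := by
  have lo : ∀ j, 1 ≤ j → j ≤ k → j ≤ f j := by
    intro j hj
    induction j, hj using Nat.le_induction with
    | base => intro h; exact (h1 1 le_rfl h).1
    | succ j hj ih => intro h; have := ih (by omega); have := h2 j hj h; omega
  have hi : ∀ d, d + 1 ≤ k → f (k - d) ≤ k - d := by
    intro d
    induction d with
    | zero => intro h; exact (h1 k (by omega) le_rfl).2
    | succ d ih =>
      intro h
      have h3 := ih (by omega)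
      have h4 := h2 (k - (d + 1)) (by omega) (by omega)
      have h5 : k - (d + 1) + 1 = k - d := by omega
      rw [h5] at h4
      omega
  intro j hj hk
  have h3 := lo j hj hk
  have h4 := hi (k - j) (by omega)
  have h5 : k - (k - j) = j := by omega
  rw [h5] at h4
  omega

/-- exit vertex of level `e + 1/2` from box `b` -/
noncomputable def cpt (e : ℕ) (b : ℤ × ℤ) : ℝ × ℝ :=
  if (e:ℤ) < (b.1 + 1) ^ 2 + b.2 ^ 2 then
    (b.1 + ((e:ℝ) + 1/2 - b.1 ^ 2 - b.2 ^ 2) / (2 * b.1 + 1), b.2)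
  else (b.1 + 1, b.2 + ((e:ℝ) + 1/2 - (b.1 + 1) ^ 2 - b.2 ^ 2) / (2 * b.2 + 1))

theorem cpt_spec (e : ℕ) (m n : ℤ) (hn : 0 ≤ n) (hnm : n ≤ m) (h3 : m ^ 2 + n ^ 2 ≤ (e:ℤ))
    (h4 : (e:ℤ) < (m + 1) ^ 2 + (n + 1) ^ 2) :
    Ham (cpt e (m, n)) = e + 1/2 ∧ cpt e (m, n) ∈ DeltaSet ∧ 0 ≤ (cpt e (m, n)).2 ∧
    (cpt e (m, n)).2 ≤ (cpt e (m, n)).1 ∧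
    (((e:ℤ) < (m + 1) ^ 2 + n ^ 2 ∧ vtype (cpt e (m, n)) = m ∧ (∃ n' : ℤ, (cpt e (m, n)).2 = n') ∧
      m < (cpt e (m, n)).1 ∧ (cpt e (m, n)).1 < m + 1) ∨
     ((m + 1) ^ 2 + n ^ 2 ≤ (e:ℤ) ∧ vtype (cpt e (m, n)) = n ∧ (¬ ∃ n' : ℤ, (cpt e (m, n)).2 = n') ∧
      (cpt e (m, n)).1 = m + 1)) := by
  have hn' : (0:ℝ) ≤ n := by exact_mod_cast hn
  have hnm' : (n:ℝ) ≤ m := by exact_mod_cast hnm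
  have h3' : (m:ℝ) ^ 2 + (n:ℝ) ^ 2 ≤ e := by exact_mod_cast h3
  by_cases h : (e:ℤ) < (m + 1) ^ 2 + n ^ 2
  · have h' : (e:ℝ) + 1 ≤ (m + 1) ^ 2 + n ^ 2 := by exact_mod_cast h
    have hc : cpt e (m, n) = (m + ((e:ℝ) + 1/2 - m ^ 2 - n ^ 2) / (2 * m + 1), (n:ℝ)) := by
      simp only [cpt]; rw [if_pos h]
    rw [hc]
    set x : ℝ := m + ((e:ℝ) + 1/2 - m ^ 2 - n ^ 2) / (2 * m + 1) with hx
    have hp : (0:ℝ) < 2 * m + 1 := by linarith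
    have hx1 : (2 * (m:ℝ) + 1) * (x - m) = (e:ℝ) + 1/2 - m ^ 2 - n ^ 2 := by
      rw [hx]; field_simp; ring
    have b1 : (m:ℝ) < x := by by_contra hcc; push Not at hcc; nlinarith
    have b2 : x < m + 1 := by by_contra hcc; push Not at hcc; nlinarith
    have hni := not_int_of_between b1 b2
    refine ⟨?_, Or.inr ⟨n, rfl⟩, hn', by simp only; linarith, Or.inl ⟨h, ?_, ⟨n, rfl⟩, b1, b2⟩⟩
    · rw [Ham_eq (Rfl_box b1.le b2 le_rfl (by linarith)), hx1]; ring
    · have hf : ⌊|x|⌋ = m := by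
        rw [abs_of_pos (by linarith)]; exact Int.floor_eq_iff.2 ⟨b1.le, b2⟩
      simp only [vtype]
      rw [if_neg hni, hf]
      omega
  · have hh := h
    push Not at h
    have h' : ((m:ℝ) + 1) ^ 2 + n ^ 2 ≤ e := by exact_mod_cast h
    have h4' : (e:ℝ) + 1 ≤ (m + 1) ^ 2 + (n + 1) ^ 2 := by exact_mod_cast h4
    have hc : cpt e (m, n) = ((m:ℝ) + 1, n + ((e:ℝ) + 1/2 - (m + 1) ^ 2 - n ^ 2) / (2 * n + 1)) := by
      simp only [cpt]; rw [if_neg hh]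
    rw [hc]
    set y : ℝ := n + ((e:ℝ) + 1/2 - (m + 1) ^ 2 - n ^ 2) / (2 * n + 1) with hx
    have hp : (0:ℝ) < 2 * n + 1 := by linarith
    have hx1 : (2 * (n:ℝ) + 1) * (y - n) = (e:ℝ) + 1/2 - (m + 1) ^ 2 - n ^ 2 := by
      rw [hx]; field_simp; ring
    have b1 : (n:ℝ) < y := by by_contra hcc; push Not at hcc; nlinarith
    have b2 : y < n + 1 := by by_contra hcc; push Not at hcc; nlinarith
    have hni := not_int_of_between b1 b2
    refine ⟨?_, Or.inl ⟨m + 1, by push_cast; rfl⟩, by simp only; linarith, by simp only; linarith,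
      Or.inr ⟨h, ?_, hni, rfl⟩⟩
    · rw [Ham_eq (m := m + 1) (Rfl_box (by push_cast; linarith) (by push_cast; linarith) b1.le b2)]
      push_cast
      rw [hx1]; ring
    · have hf : ⌊|y|⌋ = n := by
        rw [abs_of_pos (by linarith)]; exact Int.floor_eq_iff.2 ⟨b1.le, b2⟩
      simp only [vtype]
      rw [if_pos ⟨m + 1, by push_cast; rfl⟩, hf]
      omega

theorem half_mem (e : ℕ) : (e:ℝ) + 1/2 ∈ Icrit e := by
  have : (e:ℝ) + 1 ≤ nextE e := by exact_mod_cast (nextE_spec e).2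
  constructor
  · simp
  · linarith

theorem VL1 {e : ℕ} {v : ℕ → ℕ} {o : ℕ → Bool} (hv : IsVertexList e v o) (j : ℕ) (h1 : 1 ≤ j)
    (h2 : j ≤ Nat.sqrt e + 1) :
    (o j = true ∧ (v j : ℤ) = (bseq e (j - 1)).1 ∧ bseq e j = ((bseq e (j-1)).1, (bseq e (j-1)).2 - 1)) ∨
    (o j = false ∧ (v j : ℤ) = (bseq e (j - 1)).2 ∧ bseq e j = ((bseq e (j-1)).1 + 1, (bseq e (j-1)).2)) := by
  obtain ⟨p, hp1, hp2, hp3⟩ := hv _ (half_mem e)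
  have hsp : ∀ j, j ≤ Nat.sqrt e → _ := fun j hj =>
    cpt_spec e (bseq e j).1 (bseq e j).2 (bseq_first e j hj).1
      (by have := (bseq_first e j hj).2.1; omega) (bseq_first e j hj).2.2.1 (bseq_first e j hj).2.2.2
  have hex : ∀ j : ℕ, ∃ i, 1 ≤ j → j ≤ Nat.sqrt e + 1 → (1 ≤ i ∧ i ≤ Nat.sqrt e + 1) ∧
      cpt e (bseq e (j-1)) = p i := by
    intro j
    by_cases hj : 1 ≤ j ∧ j ≤ Nat.sqrt e + 1
    · obtain ⟨a1, a2, a3, a4, -⟩ := hsp (j-1) (by omega)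
      obtain ⟨i, i1, i2, i3⟩ := hp3 _ a1 a2 a3 a4
      exact ⟨i, fun _ _ => ⟨⟨i1, i2⟩, i3⟩⟩
    · exact ⟨0, fun a b => absurd ⟨a, b⟩ hj⟩
  choose f hf using hex
  have hinc : ∀ j, j + 1 ≤ Nat.sqrt e → (cpt e (bseq e j)).1 < (cpt e (bseq e (j+1))).1 := by
    intro j hj
    obtain ⟨a1, -, -, -, a5⟩ := hsp j (by omega)
    obtain ⟨b1, -, -, -, b5⟩ := hsp (j+1) (by omega)
    obtain ⟨c1, c2, c3, c4⟩ := bseq_first e j (by omega)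
    have d1 := (bseq_first e (j+1) (by omega)).1
    rw [bseq] at b1 b5 d1 ⊢
    generalize hb : bseq e j = b at *
    obtain ⟨m, n⟩ := b
    simp only at *
    rcases a5 with ⟨q1, -, -, q2, q3⟩ | ⟨q1, -, -, q2⟩
    · have hx : nextB e (m, n) = (m, n - 1) := by simp [nextB, c1, q1]
      rw [hx] at b1 b5 d1 ⊢
      simp only at b1 b5 d1
      rcases b5 with ⟨r1, -, -, r2, r3⟩ | ⟨r1, -, -, r2⟩
      · simp only [cpt]
        rw [if_pos q1, if_pos r1]
        push_cast
        have hm : (0:ℝ) < 2 * m + 1 := by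
          have : (0:ℤ) < 2 * m + 1 := by omega
          exact_mod_cast this
        have hn : (1:ℝ) ≤ n := by exact_mod_cast (by omega : (1:ℤ) ≤ n)
        have : ((e:ℝ) + 1/2 - m ^ 2 - n ^ 2) / (2 * m + 1) < ((e:ℝ) + 1/2 - m ^ 2 - (n - 1) ^ 2) / (2 * m + 1) := by
          apply div_lt_div_of_pos_right _ hm
          nlinarith
        linarith
      · rw [r2]; exact q3
    · have hx : nextB e (m, n) = (m + 1, n) := by
        simp only [nextB]; rw [if_pos c1, if_neg (by omega)]
      rw [hx] at b1 b5 ⊢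
      simp only at b1 b5
      rcases b5 with ⟨r1, -, -, r2, r3⟩ | ⟨r1, -, -, r2⟩
      · rw [q2]; push_cast at r2; exact r2
      · rw [q2, r2]; push_cast; linarith
  have hid := strict_id (k := Nat.sqrt e + 1) f (fun j h1 h2 => (hf j h1 h2).1) (by
    intro j h1 h2
    have e1 := (hf j h1 (by omega))
    have e2 := (hf (j+1) (by omega) h2)
    have h3 := hinc (j-1) (by omega)
    have h4 : j - 1 + 1 = j := by omega
    rw [h4] at h3
    rw [e1.2] at h3
    have h5 := e2.2
    simp only [Nat.add_sub_cancel] at h5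
    rw [h5] at h3
    by_contra hc
    push Not at hc
    rcases hc.lt_or_eq with h | h
    · have := hp2 _ _ e2.1.1 h e1.1.2
      linarith
    · rw [h] at h3; exact lt_irrefl _ h3)
  have hcp := (hf j h1 h2).2
  rw [hid j h1 h2] at hcp
  obtain ⟨-, -, -, -, u5, u6⟩ := hp1 j h1 h2
  obtain ⟨-, -, -, -, a5⟩ := hsp (j-1) (by omega)
  obtain ⟨c1, c2, c3, c4⟩ := bseq_first e (j-1) (by omega)
  have hj : bseq e j = nextB e (bseq e (j-1)) := by
    obtain ⟨i, rfl⟩ : ∃ i, j = i + 1 := ⟨j - 1, by omega⟩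
    rfl
  rw [hj]
  rw [← hcp] at u5 u6
  generalize hb : bseq e (j-1) = b at *
  obtain ⟨m, n⟩ := b
  simp only at *
  rcases a5 with ⟨q1, q2, q3, -⟩ | ⟨q1, q2, q3, -⟩
  · left
    refine ⟨u6.2 q3, by rw [← u5]; exact q2, by simp [nextB, c1, q1]⟩
  · right
    refine ⟨?_, by rw [← u5]; exact q2, by simp only [nextB]; rw [if_pos c1, if_neg (by omega)]⟩
    by_contra hc
    rw [Bool.not_eq_false] at hc
    exact q3 (u6.1 hc)

def VLprop (b b' : ℤ × ℤ) (V : ℕ) (O : Bool) : Prop :=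
  (O = true ∧ (V:ℤ) = b.1 ∧ b' = (b.1, b.2 - 1)) ∨
  (O = false ∧ ((0 ≤ b.2 ∧ (V:ℤ) = b.2 ∧ b' = (b.1 + 1, b.2)) ∨
    (b.2 < 0 ∧ (V:ℤ) = -b.2 - 1 ∧ b' = (b.1 - 1, b.2))))

theorem VL {e : ℕ} {v : ℕ → ℕ} {o : ℕ → Bool} (hv : IsVertexList e v o) (j : ℕ) (h1 : 1 ≤ j)
    (h2 : j ≤ 2 * Nat.sqrt e + 1) :
    VLprop (bseq e (j-1)) (bseq e j) (vext e v j) (oext e o j) := by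
  by_cases h : j ≤ Nat.sqrt e + 1
  · have h3 := VL1 hv j h1 h
    simp only [vext, oext, if_pos h]
    have h4 := (bseq_first e (j-1) (by omega)).1
    rcases h3 with h3 | ⟨a, b, c⟩
    · exact Or.inl h3
    · exact Or.inr ⟨a, Or.inl ⟨h4, b, c⟩⟩
  · simp only [vext, oext, if_neg h]
    obtain ⟨i, rfl⟩ : ∃ i, j = Nat.sqrt e + 1 + i + 1 := ⟨j - (Nat.sqrt e + 1) - 1, by omega⟩
    have h3 := VL1 hv (Nat.sqrt e - i) (by omega) (by omega)
    have h4 := (bseq_first e (Nat.sqrt e - i - 1) (by omega)).1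
    have e1 : 2 * (Nat.sqrt e + 1) - (Nat.sqrt e + 1 + i + 1) = Nat.sqrt e - i := by omega
    have e2 : Nat.sqrt e + 1 + i + 1 - 1 = Nat.sqrt e + 1 + i := by omega
    rw [e1, e2, bseq_mirror e i (by omega), add_assoc (Nat.sqrt e + 1) i 1, bseq_mirror e (i+1) (by omega)]
    have e3 : Nat.sqrt e - (i + 1) = Nat.sqrt e - i - 1 := by omega
    rw [e3]
    rcases h3 with ⟨a, b, c⟩ | ⟨a, b, c⟩
    · left
      refine ⟨a, ?_, ?_⟩
      · rw [b, c]; rfl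
      · rw [c]; simp [mirror]
    · right
      refine ⟨a, Or.inr ?_⟩
      rw [b, c]
      simp only [mirror]
      refine ⟨by omega, by ring, ?_⟩
      ext <;> simp

theorem VO_iff {e : ℕ} {v : ℕ → ℕ} {o : ℕ → Bool} (hv : IsVertexList e v o) (j : ℕ) (h1 : 1 ≤ j)
    (h2 : j + 1 ≤ 2 * Nat.sqrt e + 1) :
    vext e v (j + 1) = vext e v j ↔ oext e o (j + 1) = oext e o j := by
  have a := VL hv j h1 (by omega)
  have b := VL hv (j+1) (by omega) h2
  have c := bseq_pos e j h1 (by omega)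
  simp only [Nat.add_sub_cancel] at b
  generalize bseq e (j-1) = b0 at *
  generalize bseq e j = b1 at *
  generalize bseq e (j+1) = b2 at *
  obtain ⟨m0, n0⟩ := b0
  obtain ⟨m1, n1⟩ := b1
  obtain ⟨m2, n2⟩ := b2
  simp only [VLprop, Prod.mk.injEq] at *
  rcases a with ⟨a1, a2⟩ | ⟨a1, a2⟩ <;> rcases b with ⟨b1, b2⟩ | ⟨b1, b2⟩ <;> rw [a1, b1] <;> simp <;> omega

theorem v1_eq {e : ℕ} {v : ℕ → ℕ} {o : ℕ → Bool} (hv : IsVertexList e v o) :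
    (v 1 : ℤ) = (Nat.sqrt (e / 2) : ℤ) := by
  rcases VL1 hv 1 le_rfl (by omega) with ⟨-, h, -⟩ | ⟨-, h, -⟩ <;> simpa [bseq] using h

theorem stepS {lam x y M : ℝ} (hl : 0 < lam) (hM : lam * (2 * M + 10) ≤ 1 / 100) (hM1 : 1 ≤ M)
    (hx0 : 0 ≤ x) (hxM : x ≤ M) (hy0 : 1 / 4 ≤ y) (hyM : y ≤ M) :
    ∃ dx dy : ℝ, (Fl lam)^[4] (x, y) = (x + dx, y + dy) ∧ lam ≤ dx ∧ dx ≤ lam * (2 * M + 1) ∧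
      -(lam * (2 * M + 2)) ≤ dy ∧ dy ≤ -lam ∧ (x < 1 / 2 → dy = -lam) ∧
      dx ≤ lam * (2 * ⌊y⌋ + 1) ∧ -(lam * (2 * ⌊x⌋ + 2)) ≤ dy := by
  have hfm : ⌊x⌋ = ⌊x⌋ := rfl
  obtain ⟨a1, a2, a3, ⟨ha, ha'⟩, ⟨hb1, hb'⟩, ⟨hc, hc'⟩, he⟩ := Fl4_steps lam x y ⌊x⌋ hfm
  have f1 := Int.floor_le x
  have f2 := Int.lt_floor_add_one x
  have f3 : 0 ≤ ⌊x⌋ := Int.floor_nonneg.2 hx0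
  generalize ⌊x⌋ = m at *
  have f3' : (0:ℝ) ≤ m := by exact_mod_cast f3
  have p1 : lam * m ≤ lam * M := mul_le_mul_of_nonneg_left (by linarith) hl.le
  have p2 : lam * 1 ≤ lam * M := mul_le_mul_of_nonneg_left hM1 hl.le
  have p3 : 0 ≤ lam * m := by positivity
  have q1 : a1 ≤ -1 := by
    have : (a1:ℝ) < 0 := by linarith
    have : a1 < 0 := by exact_mod_cast this
    omega
  have q1' : (a1:ℝ) ≤ -1 := by exact_mod_cast q1
  have r1 : lam * a1 ≤ lam * (-1) := mul_le_mul_of_nonneg_left q1' hl.le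
  have r2 : lam * (-M - 1) ≤ lam * a1 := mul_le_mul_of_nonneg_left (by linarith) hl.le
  have q2 : a2 ≤ -m - 1 := by
    have : (a2:ℝ) < -m := by linarith
    have : a2 < -m := by exact_mod_cast this
    omega
  have q2' : (a2:ℝ) ≤ -m - 1 := by exact_mod_cast q2
  have r3 : lam * (a2 - m) ≤ lam * (-1) := mul_le_mul_of_nonneg_left (by linarith) hl.le
  have r4 : lam * (-2 * M - 2) ≤ lam * (a2 - m) := mul_le_mul_of_nonneg_left (by linarith) hl.le
  have q3 : 0 ≤ a3 := by
    have : (-1:ℝ) < a3 := by linarith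
    have : -1 < a3 := by exact_mod_cast this
    omega
  have q3' : (0:ℝ) ≤ a3 := by exact_mod_cast q3
  refine ⟨lam * (a3 - a1), lam * (a2 - m), he, ?_, ?_, ?_, ?_, ?_, ?_, ?_⟩
  · have := mul_le_mul_of_nonneg_left (a := lam) (by linarith : (1:ℝ) ≤ a3 - a1) hl.le
    linarith
  · apply mul_le_mul_of_nonneg_left _ hl.le
    linarith
  · linarith
  · linarith
  · intro hx
    have hm : m = 0 := by
      have : (m:ℝ) < 1 := by linarith
      have : m < 1 := by exact_mod_cast this
      omega
    subst hm
    have : a2 = -1 := by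
      have : (-2:ℝ) < a2 := by linarith
      have : -2 < a2 := by exact_mod_cast this
      omega
    subst this
    push_cast; ring
  · have g2 := Int.lt_floor_add_one y
    generalize ⌊y⌋ = n at *
    have i1 : (a3:ℝ) < n + 1 := by linarith
    have i1 : a3 < n + 1 := by exact_mod_cast i1
    have i1 : a3 ≤ n := by omega
    have i1 : (a3:ℝ) ≤ n := by exact_mod_cast i1
    have i2 : (-n - 2:ℝ) < a1 := by linarith
    have i2 : -n - 2 < a1 := by exact_mod_cast i2
    have i2 : -n - 1 ≤ a1 := by omega
    have i2 : (-n - 1:ℝ) ≤ a1 := by exact_mod_cast i2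
    apply mul_le_mul_of_nonneg_left _ hl.le
    linarith
  · have i2 : (-m - 3:ℝ) < a2 := by linarith
    have i2 : -m - 3 < a2 := by exact_mod_cast i2
    have i2 : -m - 2 ≤ a2 := by omega
    have i2 : (-m - 2:ℝ) ≤ a2 := by exact_mod_cast i2
    rw [← mul_neg]
    apply mul_le_mul_of_nonneg_left _ hl.le
    linarith

theorem stepN {lam x y M M' : ℝ} (hl : 0 < lam) (hM : lam * (2 * M' + 10) ≤ 1 / 100) (hM1 : 1 ≤ M)
    (hMM : M ≤ M') (hlat : IsLatticePt lam (x, y))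
    (hx0 : x < 0) (hxM : -M ≤ x) (hy0 : 48 / 100 ≤ y) (hyM : y ≤ M') :
    ∃ dx dy : ℝ, (Fl lam)^[4] (x, y) = (x + dx, y + dy) ∧ lam ≤ dx ∧ dx ≤ 1 / 100 ∧
      0 ≤ dy ∧ dy ≤ lam * (2 * M + 2) ∧ (y < 3 / 4 → dx ≤ dy) := by
  have hfm : ⌊x⌋ = ⌊x⌋ := rfl
  obtain ⟨a1, a2, a3, ⟨ha, ha'⟩, ⟨hb1, hb'⟩, ⟨hc, hc'⟩, he⟩ := Fl4_steps lam x y ⌊x⌋ hfm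
  have f1 := Int.floor_le x
  have f2 := Int.lt_floor_add_one x
  generalize ⌊x⌋ = m at *
  have f3 : m ≤ -1 := by
    have : (m:ℝ) < 0 := by linarith
    have : m < 0 := by exact_mod_cast this
    omega
  have f3' : (m:ℝ) ≤ -1 := by exact_mod_cast f3
  have p1 : lam * (-M - 1) ≤ lam * m := mul_le_mul_of_nonneg_left (by linarith) hl.le
  have p2 : lam * 1 ≤ lam * M := mul_le_mul_of_nonneg_left hM1 hl.le
  have p4 : lam * M ≤ lam * M' := mul_le_mul_of_nonneg_left hMM hl.le
  have p3 : lam * m ≤ lam * (-1) := mul_le_mul_of_nonneg_left f3' hl.le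
  have q1 : a1 ≤ -1 := by
    have : (a1:ℝ) < 0 := by linarith
    have : a1 < 0 := by exact_mod_cast this
    omega
  have q1' : (a1:ℝ) ≤ -1 := by exact_mod_cast q1
  have r1 : lam * a1 ≤ lam * (-1) := mul_le_mul_of_nonneg_left q1' hl.le
  have r2 : lam * (-M' - 2) ≤ lam * a1 := mul_le_mul_of_nonneg_left (by linarith) hl.le
  have q2 : a2 ≤ -m - 1 := by
    have : (a2:ℝ) < -m := by linarith
    have : a2 < -m := by exact_mod_cast this
    omega
  have q2b : -m - 2 ≤ a2 := by
    have : (-m-3:ℝ) < a2 := by linarith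
    have : -m-3 < a2 := by exact_mod_cast this
    omega
  have q2' : (a2:ℝ) ≤ -m - 1 := by exact_mod_cast q2
  have q2b' : (-m - 2:ℝ) ≤ a2 := by exact_mod_cast q2b
  have r3 : lam * (a2 - m) ≤ lam * (2 * M + 2) := mul_le_mul_of_nonneg_left (by linarith) hl.le
  have r4 : 0 ≤ lam * (a2 - m) := mul_nonneg hl.le (by linarith)
  have q3 : 0 ≤ a3 := by
    have : (-1:ℝ) < a3 := by linarith
    have : -1 < a3 := by exact_mod_cast this
    omega
  have q3' : (0:ℝ) ≤ a3 := by exact_mod_cast q3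
  refine ⟨lam * (a3 - a1), lam * (a2 - m), he, ?_, ?_, ?_, ?_, ?_⟩
  · have := mul_le_mul_of_nonneg_left (a := lam) (by linarith : (1:ℝ) ≤ a3 - a1) hl.le
    linarith
  · have := mul_le_mul_of_nonneg_left (a := lam) (by linarith : (a3 - a1 :ℝ) ≤ 2 * M' + 10) hl.le
    linarith
  · linarith
  · linarith
  · intro hy
    have h1 : a1 = -1 := by
      have : (-2:ℝ) < a1 := by linarith
      have : -2 < a1 := by exact_mod_cast this
      omega
    have h3 : a3 = 0 := by
      have : (a3:ℝ) < 1 := by linarith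
      have : a3 < 1 := by exact_mod_cast this
      omega
    subst h1 h3
    have h2 : 1 ≤ a2 - m := by
      by_cases hm : m ≤ -2
      · omega
      · have : m = -1 := by omega
        subst this
        obtain ⟨a, b, hab⟩ := hlat
        rw [Prod.mk.injEq] at hab
        have ha0 : (a:ℝ) < 0 := by
          by_contra hcc
          push Not at hcc
          have : 0 ≤ lam * a := by positivity
          linarith [hab.1]
        have : a < 0 := by exact_mod_cast ha0
        have : a ≤ -1 := by omega
        have : (a:ℝ) ≤ -1 := by exact_mod_cast this
        have := mul_le_mul_of_nonneg_left (a := lam) this hl.le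
        push_cast at *
        have : (-1:ℝ) < a2 := by linarith
        have : -1 < a2 := by exact_mod_cast this
        omega
    have h2' : (1:ℝ) ≤ a2 - m := by exact_mod_cast h2
    apply mul_le_mul_of_nonneg_left _ hl.le
    push_cast; linarith

def InvT (lam M M' : ℝ) (p : ℝ × ℝ) : Prop :=
  IsLatticePt lam p ∧ -M ≤ p.1 ∧
  ((p.1 < 0 ∧ 48 / 100 ≤ p.2 ∧ (3 / 4 ≤ p.2 ∨ 96 / 100 ≤ p.2 - p.1) ∧
      p.2 ≤ M + (2 * M + 2) * (p.1 + M)) ∨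
   (0 ≤ p.1 ∧ (1 / 2 ≤ p.1 ∨ 3 / 4 ≤ p.1 + p.2) ∧ p.2 ≤ M'))

theorem InvT_step {lam M M' : ℝ} {p : ℝ × ℝ} (hl : 0 < lam) (hM : lam * (2 * M' + 10) ≤ 1 / 100)
    (hM1 : 1 ≤ M) (hMM : M + (2 * M + 2) * (M + 1) ≤ M') (h : InvT lam M M' p) (hs : p.1 < p.2) :
    InvT lam M M' ((Fl lam)^[4] p) ∧ p.1 + lam ≤ ((Fl lam)^[4] p).1 ∧
    ((Fl lam)^[4] p).1 ≤ p.1 + 1 / 100 ∧ p.2 - 1 / 100 ≤ ((Fl lam)^[4] p).2 ∧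
    (0 ≤ p.1 → p.1 - p.2 < ((Fl lam)^[4] p).1 - ((Fl lam)^[4] p).2) := by
  obtain ⟨x, y⟩ := p
  obtain ⟨hlat, hxM, h⟩ := h
  have hlat' := lat_iter hlat 4
  simp only at *
  have hMM' : M ≤ M' := by nlinarith
  have hM'1 : 1 ≤ M' := by linarith
  rcases h with ⟨h1, h2, h3, h4⟩ | ⟨h1, h2, h3⟩
  · have hyM : y ≤ M' := by nlinarith
    obtain ⟨dx, dy, e1, d1, d2, d3, d4, d5⟩ := stepN hl hM hM1 hMM' hlat h1 hxM h2 hyM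
    unfold InvT
    rw [e1] at hlat' ⊢
    simp only
    refine ⟨⟨hlat', by linarith, ?_⟩, by linarith, by linarith, by linarith, fun h => by linarith⟩
    have hb : y + dy ≤ M + (2 * M + 2) * (x + dx + M) := by nlinarith
    rcases lt_or_ge (x + dx) 0 with h | h
    · left
      refine ⟨h, by linarith, ?_, hb⟩
      rcases lt_or_ge y (3/4) with h' | h'
      · right
        have := d5 h'
        rcases h3 with h3 | h3
        · linarith
        · linarith
      · left; linarith
    · right
      refine ⟨h, Or.inr ?_, ?_⟩
      · rcases lt_or_ge y (3/4) with h' | h'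
        · have := d5 h'
          rcases h3 with h3 | h3
          · linarith
          · linarith
        · linarith
      · nlinarith
  · have hy : 1 / 4 ≤ y := by rcases h2 with h2 | h2 <;> linarith
    obtain ⟨dx, dy, e1, d1, d2, d3, d4, d5, -, -⟩ := stepS hl hM hM'1 h1 (by linarith) hy h3
    unfold InvT
    rw [e1] at hlat' ⊢
    simp only
    refine ⟨⟨hlat', by linarith, Or.inr ⟨by linarith, ?_, by linarith⟩⟩, by linarith, by linarith, by linarith, fun h => by linarith⟩
    rcases lt_or_ge x (1/2) with h | h
    · right
      have := d5 h
      rcases h2 with h2 | h2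
      · linarith
      · linarith
    · left; linarith

theorem dG_le {z w : ℝ × ℝ} : dG z ≤ dG w ↔ |z.1 - z.2| ≤ |w.1 - w.2| := by
  unfold dG
  have : 0 < Real.sqrt 2 := by positivity
  rw [div_le_div_iff_of_pos_right this]

theorem dG_lt {z w : ℝ × ℝ} : dG z < dG w ↔ |z.1 - z.2| < |w.1 - w.2| := by
  unfold dG
  have : 0 < Real.sqrt 2 := by positivity
  rw [div_lt_div_iff_of_pos_right this]

theorem orbit_hits {lam M M' : ℝ} {u : ℝ × ℝ} (hl : 0 < lam) (hM2 : lam * (2 * (M' + 1) + 10) ≤ 1 / 100)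
    (hM1 : 1 ≤ M) (hMM : M + (2 * M + 2) * (M + 1) ≤ M') (h : InvT lam M M' u) (hu : u.1 ≤ -(4/10)) :
    ∃ i : ℕ, (Fl lam)^[4 * i] u ∈ Xdom lam := by
  classical
  have hMM' : M ≤ M' := by nlinarith
  have hM'1 : 1 ≤ M' := by linarith
  have hM : lam * (2 * M' + 10) ≤ 1 / 100 := by nlinarith
  have step : ∀ i : ℕ, (∀ i' < i, ((Fl lam)^[4 * i'] u).1 < ((Fl lam)^[4 * i'] u).2) →
      InvT lam M M' ((Fl lam)^[4 * i] u) ∧ u.1 + i * lam ≤ ((Fl lam)^[4 * i] u).1 := by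
    intro i
    induction i with
    | zero => intro _; simpa using h
    | succ i ih =>
      intro hi
      obtain ⟨i1, i2⟩ := ih (fun i' h => hi i' (by omega))
      obtain ⟨g1, g2, -⟩ := InvT_step hl hM hM1 hMM i1 (hi i (by omega))
      rw [Fl4_succ]
      refine ⟨g1, ?_⟩
      push_cast
      linarith
  have hex : ∃ i : ℕ, ((Fl lam)^[4 * i] u).2 ≤ ((Fl lam)^[4 * i] u).1 := by
    by_contra hc
    push Not at hc
    obtain ⟨t, ht⟩ := Archimedean.arch (M' - u.1 + 1) hl
    rw [nsmul_eq_mul] at ht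
    obtain ⟨⟨-, -, g1⟩, g2⟩ := step t (fun i' _ => hc i')
    have g3 := hc t
    rcases g1 with g1 | g1
    · linarith [g1.1]
    · linarith [g1.2.2]
  obtain ⟨i0, hi0, hmin⟩ : ∃ i : ℕ, ((Fl lam)^[4 * i] u).2 ≤ ((Fl lam)^[4 * i] u).1 ∧
      ∀ i' < i, ((Fl lam)^[4 * i'] u).1 < ((Fl lam)^[4 * i'] u).2 :=
    ⟨Nat.find hex, Nat.find_spec hex, fun i' h => not_le.1 (Nat.find_min hex h)⟩
  have hu2 : u.1 < u.2 := by
    rcases h.2.2 with g | g <;> linarith [g.1, g.2.1]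
  have hi1 : i0 ≠ 0 := by
    rintro rfl
    simp at hi0; linarith
  obtain ⟨i1, rfl⟩ := Nat.exists_eq_succ_of_ne_zero hi1
  rw [Nat.succ_eq_add_one] at *
  obtain ⟨I1, -⟩ := step i1 (fun i' h => hmin i' (by omega))
  obtain ⟨I2, c1, c2, c3, c4⟩ := InvT_step hl hM hM1 hMM I1 (hmin i1 (by omega))
  have hlt1 := hmin i1 (by omega)
  rw [← Fl4_succ] at c1 c2 c3 c4 I2
  -- basic bounds
  have hx1 : 48 / 100 - 1 / 100 - 1 / 100 - 1 / 10 ≤ ((Fl lam)^[4 * i1] u).1 := by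
    rcases I1.2.2 with g | g
    · linarith [g.2.1]
    · rcases g.2.1 with g' | g' <;> linarith
  have hy1 : 3 / 8 ≤ ((Fl lam)^[4 * i1] u).2 := by
    rcases I1.2.2 with g | g
    · linarith [g.2.1]
    · rcases g.2.1 with g' | g' <;> linarith
  have hi2 : i1 ≠ 0 := by
    rintro rfl
    simp at hx1; linarith
  obtain ⟨i2, rfl⟩ := Nat.exists_eq_succ_of_ne_zero hi2
  rw [Nat.succ_eq_add_one] at *
  obtain ⟨J1, -⟩ := step i2 (fun i' h => hmin i' (by omega))
  obtain ⟨-, d1, d2, d3, d4⟩ := InvT_step hl hM hM1 hMM J1 (hmin i2 (by omega))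
  have hlt2 := hmin i2 (by omega)
  rw [← Fl4_succ] at d1 d2 d3 d4
  have d5 := d4 (by linarith)
  have c5 := c4 (by linarith)
  -- names
  have eA : (Fl lam)^[4] ((Fl lam)^[4 * i2] u) = (Fl lam)^[4 * (i2 + 1)] u := (Fl4_succ _ _ _).symm
  have eB : (Fl lam)^[4] ((Fl lam)^[4 * (i2 + 1)] u) = (Fl lam)^[4 * (i2 + 1 + 1)] u := (Fl4_succ _ _ _).symm
  have eC : (Fl lam)^[4] ((Fl lam)^[4 * (i2 + 1 + 1)] u) = (Fl lam)^[4 * (i2 + 1 + 1 + 1)] u := (Fl4_succ _ _ _).symm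
  have fA := Flinv4_eq eA
  have fB := Flinv4_eq eB
  generalize hA : (Fl lam)^[4 * i2] u = A at *
  generalize hB : (Fl lam)^[4 * (i2 + 1)] u = B at *
  generalize hC : (Fl lam)^[4 * (i2 + 1 + 1)] u = C at *
  by_cases hcase : |B.1 - B.2| ≤ |C.1 - C.2|
  · refine ⟨i2 + 1, ?_⟩
    rw [hB]
    refine ⟨I1.1, by linarith, by linarith, ?_, ?_⟩
    · rw [eB, dG_le]; exact hcase
    · rw [fA, dG_lt, abs_of_neg (by linarith), abs_of_neg (by linarith)]; linarith
  · push Not at hcase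
    refine ⟨i2 + 1 + 1, ?_⟩
    rw [hC]
    refine ⟨I2.1, by linarith, by linarith, ?_, ?_⟩
    · have hyC : C.2 ≤ M' := by
        rcases I2.2.2 with g | g
        · linarith [g.1]
        · exact g.2.2
      have hBM : B.2 ≤ M' := by
        rcases I1.2.2 with g | g
        · linarith [g.1]
        · exact g.2.2
      obtain ⟨x, y⟩ := C
      simp only at *
      obtain ⟨dx, dy, q1, q2, q3, q4, q5, q6, -, -⟩ := stepS (lam := lam) (x := x) (y := y) (M := M' + 1) hl hM2 (by linarith) (by linarith) (by linarith) (by linarith) (by linarith)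
      rw [dG_le, q1, abs_of_nonneg (by linarith), abs_of_nonneg (by simp only; linarith)]
      simp only
      linarith
    · rw [fB, dG_lt]; exact hcase

theorem Pfun_sq {x : ℝ} (hx : 0 ≤ x) : x ^ 2 ≤ Pfun x := by
  have f1 := Int.floor_le x
  have f2 := Int.lt_floor_add_one x
  unfold Pfun
  nlinarith

theorem nextE_le (e : ℕ) : nextE e ≤ (e + 1) ^ 2 := by
  apply Nat.sInf_le
  refine ⟨⟨(e:ℤ) + 1, 0, by push_cast; ring⟩, by nlinarith⟩

theorem Ham_bd {e : ℕ} {z : ℝ × ℝ} (h0 : 0 ≤ z.1) (h1 : 0 ≤ z.2) (h : Ham z ∈ Icrit e) :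
    z.1 < e + 1 ∧ z.2 < e + 1 := by
  have a1 := Pfun_sq h0
  have a2 := Pfun_sq h1
  have a3 := h.2
  have a4 : (nextE e : ℝ) ≤ (e + 1) ^ 2 := by exact_mod_cast nextE_le e
  have a5 : (0:ℝ) ≤ e := by positivity
  unfold Ham at a3
  constructor
  · nlinarith
  · nlinarith

theorem X_close {e : ℕ} {lam : ℝ} {z : ℝ × ℝ} (he : 1 ≤ e) (hl : 0 < lam)
    (hlam : lam * ((e:ℝ) + 10) ^ 2 ≤ 1 / 1000)
    (hz : z ∈ Xdom lam) (hH : Ham z ∈ Icrit e) :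
    |z.1 - z.2| ≤ 1 / 100 ∧ 49 / 100 ≤ z.1 ∧ 49 / 100 ≤ z.2 ∧
    z.1 - z.2 < lam * (⌊z.1⌋ + ⌊z.2⌋ + 3 / 2) ∧
    (z.1 + z.2 > 1 ∨ 1 ≤ z.1 ∨ 1 ≤ z.2) := by
  obtain ⟨hlat, h0, h1, h2, h3⟩ := hz
  obtain ⟨b1, b2⟩ := Ham_bd h0 h1 hH
  rw [dG_le] at h2
  rw [dG_lt, Flinv_iter] at h3
  obtain ⟨x, y⟩ := z
  simp only [Prod.swap_prod_mk, Prod.fst_swap, Prod.snd_swap] at *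
  have he' : (1:ℝ) ≤ e := by exact_mod_cast he
  have hM : lam * (2 * ((e:ℝ) + 1) + 10) ≤ 1 / 100 := by nlinarith
  have hsum : x + y > 1 ∨ 1 ≤ x ∨ 1 ≤ y := by
    by_contra hc
    push Not at hc
    obtain ⟨c1, c2, c3⟩ := hc
    have := Ham_eq (Rfl_box (x := x) (y := y) (m := 0) (n := 0) (by push_cast; linarith) (by push_cast; linarith) (by push_cast; linarith : ((0:ℤ):ℝ) ≤ y) (by push_cast; linarith))
    push_cast at this
    have := hH.1
    linarith
  have hmn0 : 0 ≤ lam * (⌊x⌋ + ⌊y⌋ + 3 / 2) := by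
    have i1 : (0:ℝ) ≤ ⌊x⌋ := by exact_mod_cast Int.floor_nonneg.2 h0
    have i2 : (0:ℝ) ≤ ⌊y⌋ := by exact_mod_cast Int.floor_nonneg.2 h1
    positivity
  rcases le_or_gt x y with h | h
  · have hy : 1 / 2 ≤ y := by rcases hsum with g | g | g <;> linarith
    obtain ⟨dx, dy, q1, q2, q3, q4, q5, q6, q7, q8⟩ := stepS (M := (e:ℝ) + 1) hl hM (by linarith) h0 b1.le (by linarith : 1/4 ≤ y) b2.le
    rw [q1] at h2
    simp only at h2
    rw [abs_of_nonpos (by linarith : x - y ≤ 0)] at h2 ⊢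
    have hs : y - x ≤ 1 / 100 := by
      rcases le_or_gt 0 (x + dx - (y + dy)) with g | g
      · rw [abs_of_nonneg g] at h2; linarith
      · rw [abs_of_neg g] at h2; linarith
    refine ⟨by linarith, by linarith, by linarith, ?_, hsum⟩
    rcases h.eq_or_lt with h' | h'
    · subst h'
      have : 0 < lam * (⌊x⌋ + ⌊x⌋ + 3 / 2) := by
        have i1 : (0:ℝ) ≤ ⌊x⌋ := by exact_mod_cast Int.floor_nonneg.2 h0
        positivity
      linarith
    · linarith
  · have hx : 1 / 2 ≤ x := by rcases hsum with g | g | g <;> linarith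
    obtain ⟨dx, dy, q1, q2, q3, q4, q5, q6, q7, q8⟩ := stepS (M := (e:ℝ) + 1) hl hM (by linarith) h1 b2.le (by linarith : 1/4 ≤ x) b1.le
    rw [q1] at h3
    simp only at h3
    rw [abs_of_nonneg (by linarith : 0 ≤ x - y)] at h3 ⊢
    have hs : 2 * (x - y) < dx - dy := by
      rcases le_or_gt 0 (x + dy - (y + dx)) with g | g
      · rw [abs_of_nonneg g] at h3; linarith
      · rw [abs_of_neg g] at h3; linarith
    have : x - y ≤ 1 / 100 := by linarith
    refine ⟨by linarith, by linarith, by linarith, by linarith, hsum⟩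

theorem tau_ex {e : ℕ} {lam : ℝ} {z : ℝ × ℝ} (he : 1 ≤ e) (hl : 0 < lam)
    (hlam : lam * ((e:ℝ) + 10) ^ 2 ≤ 1 / 1000)
    (hz : z ∈ Xdom lam) (hH : Ham z ∈ Icrit e) :
    1 ≤ tau lam z ∧ (Fl lam)^[tau lam z] z ∈ Xdom lam := by
  obtain ⟨c1, c2, c3, -, c5⟩ := X_close he hl hlam hz hH
  obtain ⟨b1, b2⟩ := Ham_bd hz.2.1 hz.2.2.1 hH
  have he' : (1:ℝ) ≤ e := by exact_mod_cast he
  rw [abs_le] at c1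
  have f1 := Int.floor_le z.1
  have f2 : (0:ℝ) ≤ ⌊z.1⌋ := by exact_mod_cast Int.floor_nonneg.2 hz.2.1
  have hfl : lam * (⌊z.1⌋:ℝ) ≤ 1 / 1000 := by
    have : lam * (⌊z.1⌋:ℝ) ≤ lam * ((e:ℝ) + 10) ^ 2 := by
      apply mul_le_mul_of_nonneg_left _ hl.le
      nlinarith
    linarith
  have hfl0 : 0 ≤ lam * (⌊z.1⌋:ℝ) := by positivity
  have hinv : InvT lam ((e:ℝ) + 1) ((e:ℝ) + 1 + (2 * ((e:ℝ) + 1) + 2) * ((e:ℝ) + 1 + 1)) (Fl lam z) := by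
    refine ⟨lat_Fl hz.1, ?_, Or.inl ⟨?_, ?_, ?_, ?_⟩⟩ <;> simp only [Fl]
    · linarith
    · linarith
    · linarith
    · rcases c5 with c5 | c5 | c5
      · rcases lt_or_ge z.1 (3/4) with h | h
        · right; linarith
        · left; linarith
      · left; linarith
      · left; linarith
    · nlinarith
  obtain ⟨i, hi⟩ := orbit_hits hl (by nlinarith) (by linarith) le_rfl hinv (by simp only [Fl]; linarith)
  have hne : {k : ℕ | 1 ≤ k ∧ (Fl lam)^[k] z ∈ Xdom lam}.Nonempty := by
    refine ⟨4 * i + 1, by omega, ?_⟩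
    rw [Function.iterate_add_apply]
    exact hi
  exact Nat.sInf_mem hne

/-- Facts about one step `F⁴` of the tracked orbit. -/
def StepOK (lam : ℝ) (z z' : ℝ × ℝ) : Prop :=
  (lam * (⌊z.1⌋:ℝ) < z.2 ∨ (lam * (2 * (⌊z.1⌋:ℝ) + 1) ≤ (z.1 + z.2) - (z'.1 + z'.2) ∧
    0 ≤ z'.1 + z'.2 ∧ ⌊z.1⌋ - 1 ≤ ⌊z'.1⌋ ∧ ⌊z'.1⌋ ≤ ⌊z.1⌋ ∧ 1 ≤ ⌊z.1⌋)) ∧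
  (z'.2 < 0 ∨ z.1 - z.2 ≤ z'.1 - z'.2) ∧ 0 < z.1 ∧ lam * (lam * (⌊z.1⌋:ℝ) - z.2) < z.1

theorem noX_r {lam : ℝ} {z : ℝ × ℝ} (hl : 0 < lam) (h : StepOK lam z ((Fl lam)^[4] z)) (r : ℕ)
    (h1 : 1 ≤ r) (h2 : r < 4) : (Fl lam)^[r] z ∉ Xdom lam := by
  obtain ⟨hA, -, hx, hB⟩ := h
  rintro ⟨-, p1, p2, p3, -⟩
  have ha : (⌊lam * (⌊z.1⌋:ℝ) - z.2⌋ : ℝ) ≤ lam * (⌊z.1⌋:ℝ) - z.2 := Int.floor_le _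
  have hneg : lam * (⌊lam * (⌊z.1⌋:ℝ) - z.2⌋ : ℝ) - z.1 < 0 := by nlinarith
  interval_cases r
  · rw [dG_le, ← Function.iterate_add_apply, Nat.add_comm 4 1, Function.iterate_add_apply] at p3
    simp only [Function.iterate_one] at p1 p2 p3
    generalize (Fl lam)^[4] z = z' at *
    simp only [Fl] at p1 p2 p3
    rcases hA with hA | ⟨c1, c2, c3, c4, c5⟩
    · linarith
    · have c3' : (⌊z.1⌋:ℝ) - 1 ≤ ⌊z'.1⌋ := by exact_mod_cast c3
      have c4' : (⌊z'.1⌋:ℝ) ≤ ⌊z.1⌋ := by exact_mod_cast c4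
      have c5' : (1:ℝ) ≤ ⌊z.1⌋ := by exact_mod_cast c5
      have e1 : lam * (⌊z'.1⌋:ℝ) ≤ lam * ⌊z.1⌋ := by nlinarith
      have e2 : lam * (⌊z.1⌋:ℝ) - lam ≤ lam * ⌊z'.1⌋ := by nlinarith
      have e3 : lam ≤ lam * (⌊z.1⌋:ℝ) := by nlinarith
      have g : |lam * (⌊z'.1⌋:ℝ) - z'.2 - z'.1| < |lam * (⌊z.1⌋:ℝ) - z.2 - z.1| := by
        rw [abs_lt]
        have := neg_le_abs (lam * (⌊z.1⌋:ℝ) - z.2 - z.1)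
        constructor <;> linarith
      linarith
  · simp only [Function.iterate_succ, Function.iterate_zero, Function.comp, id, Fl] at p1
    linarith
  · simp only [Function.iterate_succ, Function.iterate_zero, Function.comp, id, Fl] at p2
    linarith

theorem noX {lam : ℝ} {z : ℝ × ℝ} (hl : 0 < lam) (hz : z ∈ Xdom lam) {T : ℕ}
    (hst : ∀ i < T, StepOK lam ((Fl lam)^[4 * i] z) ((Fl lam)^[4 * (i + 1)] z))
    (hs : ∀ i, 1 ≤ i → i ≤ T → ((Fl lam)^[4 * i] z).2 ≤ ((Fl lam)^[4 * i] z).1)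
    (k : ℕ) (h1 : 1 ≤ k) (h2 : k < 4 * T) : (Fl lam)^[k] z ∉ Xdom lam := by
  obtain ⟨i, r, hr, rfl⟩ : ∃ i r, r < 4 ∧ k = 4 * i + r := ⟨k / 4, k % 4, by omega, by omega⟩
  rcases Nat.eq_zero_or_pos r with h | h
  · subst h
    rw [add_zero] at *
    obtain ⟨i, rfl⟩ : ∃ i', i = i' + 1 := ⟨i - 1, by omega⟩
    have hst := hst i (by omega)
    rintro ⟨-, p1, p2, p3, p4⟩
    rw [dG_lt] at p4
    rw [Fl4_succ, Flinv_iter_Fl, ← Fl4_succ] at p4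
    rcases Nat.eq_zero_or_pos i with hi | hi
    · subst hi
      have := hz.2.2.2.1
      rw [dG_le] at this
      simp only [mul_zero, Function.iterate_zero, id, zero_add, mul_one] at p4
      linarith
    · have a1 := hs i hi (by omega)
      have a2 := hs (i+1) (by omega) (by omega)
      rw [abs_of_nonneg (by linarith), abs_of_nonneg (by linarith)] at p4
      rcases hst.2.1 with h | h <;> linarith
  · have := hst i (by omega)
    rw [Fl4_succ] at this
    have := noX_r hl this r h hr
    rw [← Function.iterate_add_apply, Nat.add_comm] at this
    exact this

theorem tau_ge {e : ℕ} {lam : ℝ} {z : ℝ × ℝ} (he : 1 ≤ e) (hl : 0 < lam)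
    (hlam : lam * ((e:ℝ) + 10) ^ 2 ≤ 1 / 1000)
    (hz : z ∈ Xdom lam) (hH : Ham z ∈ Icrit e) {T : ℕ}
    (hst : ∀ i < T, StepOK lam ((Fl lam)^[4 * i] z) ((Fl lam)^[4 * (i + 1)] z))
    (hs : ∀ i, 1 ≤ i → i ≤ T → ((Fl lam)^[4 * i] z).2 ≤ ((Fl lam)^[4 * i] z).1) :
    4 * T ≤ tau lam z := by
  obtain ⟨t1, t2⟩ := tau_ex he hl hlam hz hH
  by_contra hc
  push Not at hc
  exact noX hl hz hst hs _ t1 hc t2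

/-- admissible boxes of the tracked orbit -/
def AdmT (m n : ℤ) : Prop := (0 ≤ n ∧ n ≤ m) ∨ (n < 0 ∧ 1 ≤ m ∧ -m ≤ n)

theorem AdmT.adm {m n : ℤ} (h : AdmT m n) : Adm m n := by
  unfold Adm; unfold AdmT at h; omega

theorem stepOK_in {lam x y : ℝ} {m n : ℤ} (hl : 0 < lam) (hl1 : lam ≤ 1 / 1000)
    (hlm : |lam * m| ≤ 1 / 1000) (hln : |lam * n| ≤ 1 / 1000)
    (hb : Rfl (x, y) = (m, n)) (had : AdmT m n) (hx : 0 < x) (z' : ℝ × ℝ)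
    (hz' : z' = (x + lam * (2 * n + 1), y - lam * (2 * m + 1)))
    (hb' : Rfl z' = (m, n)) : StepOK lam (x, y) z' ∧ (0 ≤ n → x - y < z'.1 - z'.2) := by
  obtain ⟨h1, h2, h3, h4⟩ := box_Rfl hb
  subst hz'
  obtain ⟨g1, g2, g3, g4⟩ := box_Rfl hb'
  have f1 : ⌊x⌋ = m := Int.floor_eq_iff.2 ⟨h1, h2⟩
  have f2 : ⌊x + lam * (2 * n + 1)⌋ = m := Int.floor_eq_iff.2 ⟨g1, g2⟩
  have hm0 : 0 ≤ m := by unfold AdmT at had; omega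
  have hm0' : (0:ℝ) ≤ m := by exact_mod_cast hm0
  have hlm0 : 0 ≤ lam * m := by positivity
  rw [abs_le] at hlm hln
  unfold StepOK
  simp only [f1, f2]
  rcases had with ⟨a1, a2⟩ | ⟨a1, a2, a3⟩
  · have a1' : (0:ℝ) ≤ n := by exact_mod_cast a1
    have hln0 : 0 ≤ lam * n := by positivity
    have hy : lam * m < y := by
      rcases a1.eq_or_lt with h | h
      · subst h
        push_cast at *
        linarith
      · have : (1:ℝ) ≤ n := by exact_mod_cast h
        linarith
    refine ⟨⟨Or.inl hy, Or.inr (by linarith), hx, by nlinarith⟩, fun _ => by linarith⟩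
  · have a1' : (n:ℝ) ≤ -1 := by exact_mod_cast (by omega : n ≤ -1)
    have a2' : (1:ℝ) ≤ m := by exact_mod_cast a2
    have a3' : -(m:ℝ) ≤ n := by exact_mod_cast a3
    refine ⟨⟨Or.inr ⟨by nlinarith, by linarith, by omega, le_rfl, a2⟩, Or.inl (by linarith), hx, by nlinarith⟩, fun h => by omega⟩

theorem adm_bseq {e l : ℕ} (hl : l ≤ 2 * Nat.sqrt e) : AdmT (bseq e l).1 (bseq e l).2 := by
  unfold AdmT
  rcases Nat.eq_zero_or_pos l with h | h
  · subst h
    have := bseq_first e 0 (by omega)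
    push_cast at this
    omega
  · have := bseq_pos e l h hl
    omega

theorem bnds {e : ℕ} {lam : ℝ} (hl : 0 < lam)
    (hlam : lam * ((e:ℝ) + 10) ^ 2 ≤ 1 / 1000) {l : ℕ} (h : l ≤ 2 * Nat.sqrt e + 1) :
    lam ≤ 1 / 1000 ∧ |lam * (bseq e l).1| ≤ 1 / 1000 ∧ |lam * (bseq e l).2| ≤ 1 / 1000 := by
  obtain ⟨a1, a2, a3⟩ := bseq_bd e l h
  generalize bseq e l = b at *
  obtain ⟨m, n⟩ := b
  simp only at *
  rw [abs_le] at a3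
  have e0 : (0:ℝ) ≤ e := by positivity
  have a1 : (0:ℝ) ≤ m := by exact_mod_cast a1
  have a2 : (m:ℝ) ≤ e := by exact_mod_cast a2
  have a3' : (n:ℝ) ≤ e + 1 := by exact_mod_cast a3.2
  have a4' : -((e:ℝ) + 1) ≤ n := by exact_mod_cast a3.1
  have hle : lam * ((e:ℝ) + 10) ≤ 1 / 1000 := by nlinarith
  refine ⟨by nlinarith, ?_, ?_⟩
  · rw [abs_le]; constructor <;> nlinarith
  · rw [abs_le]; constructor <;> nlinarith

theorem uniq_box {m n s t d E : ℤ} (n0 : 0 ≤ n) (t0 : 0 ≤ t) (hd : 0 ≤ d) (hm : m = n + d) (hs : s = t + d)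
    (u1 : m ^ 2 + n ^ 2 ≤ E) (u2 : E < (m + 1) ^ 2 + (n + 1) ^ 2) (q3 : s ^ 2 + t ^ 2 ≤ E)
    (q4 : E < (s + 1) ^ 2 + (t + 1) ^ 2) : n = t := by
  subst hm hs
  apply le_antisymm
  · by_contra hc; push Not at hc; nlinarith
  · by_contra hc; push Not at hc; nlinarith

set_option maxHeartbeats 2000000 in
theorem start_box {e : ℕ} {lam : ℝ} {z : ℝ × ℝ} (he : 1 ≤ e) (hl : 0 < lam)
    (hlam : lam * ((e:ℝ) + 10) ^ 2 ≤ 1 / 1000)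
    (hz : z ∈ Xdom lam) (hH : Ham z ∈ Icrit e) (hL : z ∉ TransSet lam) :
    Rfl z = bseq e 0 ∨ (Rfl z = bseq e 1 ∧
      z.1 - z.2 < lam * (2 * ((bseq e 1).1:ℝ) + 1 / 2)) := by
  obtain ⟨c1, c2, c3, c4, c5⟩ := X_close he hl hlam hz hH
  obtain ⟨b1, b2⟩ := Ham_bd hz.2.1 hz.2.2.1 hH
  have hd := hz.2.2.2.1
  rw [dG_le] at hd
  have hR : Rfl ((Fl lam)^[4] z) = Rfl z := by
    by_contra hc
    exact hL ⟨hz.1, hc⟩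
  obtain ⟨x, y⟩ := z
  simp only at *
  obtain ⟨m, n, hmn⟩ : ∃ m n, Rfl (x, y) = (m, n) := ⟨_, _, rfl⟩
  obtain ⟨h1, h2, h3, h4⟩ := box_Rfl hmn
  have f1 : ⌊x⌋ = m := Int.floor_eq_iff.2 ⟨h1, h2⟩
  have f2 : ⌊y⌋ = n := Int.floor_eq_iff.2 ⟨h3, h4⟩
  rw [f1, f2] at c4
  have m0 : 0 ≤ m := by rw [← f1]; exact Int.floor_nonneg.2 (by linarith)
  have n0 : 0 ≤ n := by rw [← f2]; exact Int.floor_nonneg.2 (by linarith)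
  have m0' : (0:ℝ) ≤ m := by exact_mod_cast m0
  have n0' : (0:ℝ) ≤ n := by exact_mod_cast n0
  have e0 : (0:ℝ) ≤ e := by positivity
  have hle : lam * ((e:ℝ) + 10) ≤ 1 / 1000 := by nlinarith
  have hll : lam ≤ 1 / 1000 := by nlinarith
  have hHe := Ham_eq hmn
  have u1 : m ^ 2 + n ^ 2 ≤ (e:ℤ) := by
    apply gap_lt hH
    rw [hHe]
    have := mul_nonneg (by linarith : (0:ℝ) ≤ 2 * m + 1) (by linarith : 0 ≤ x - m)
    have := mul_nonneg (by linarith : (0:ℝ) ≤ 2 * n + 1) (by linarith : 0 ≤ y - n)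
    linarith
  have u2 : (e:ℤ) < (m + 1) ^ 2 + (n + 1) ^ 2 := by
    apply gap_gt hH
    rw [hHe]
    have := mul_nonneg (by linarith : (0:ℝ) ≤ 2 * m + 1) (by linarith : 0 ≤ m + 1 - x)
    have := mul_nonneg (by linarith : (0:ℝ) ≤ 2 * n + 1) (by linarith : 0 ≤ n + 1 - y)
    push_cast
    linarith
  rw [hmn] at hR ⊢
  have k1 : lam * m ≤ 1 / 1000 := by nlinarith
  have k2 : lam * n ≤ 1 / 1000 := by nlinarith
  have k3 : 0 ≤ lam * m := by positivity
  have k4 : 0 ≤ lam * n := by positivity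
  have hstep := nonLam hl hll (by rwa [abs_of_nonneg k3]) (by rwa [abs_of_nonneg k4]) hmn (Or.inl ⟨m0, n0⟩) (Or.inl (by linarith)) hR
  rw [hstep] at hd hR
  obtain ⟨g1, g2, g3, g4⟩ := box_Rfl hR
  simp only at hd
  rw [abs_le] at c1
  rcases lt_trichotomy m n with h | h | h
  · exfalso
    have : (m:ℝ) + 1 ≤ n := by exact_mod_cast h
    rw [abs_of_neg (by linarith), abs_of_neg (by linarith)] at hd
    linarith
  · left
    subst h
    have q := bseq_first e 0 (by omega)
    simp only [bseq] at q ⊢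
    generalize (Nat.sqrt (e/2) : ℤ) = s at *
    obtain ⟨q1, -, q3, q4⟩ := q
    have : m = s := uniq_box (d := 0) m0 q1 le_rfl (by omega) (by omega) u1 u2 q3 q4
    rw [this]
  · right
    have hm : m = n + 1 := by
      have : (m:ℝ) < n + 2 := by linarith
      have : m < n + 2 := by exact_mod_cast this
      omega
    have q := bseq_first e 1 (by rw [Nat.le_sqrt]; omega)
    generalize bseq e 1 = b at *
    obtain ⟨s, t⟩ := b
    obtain ⟨q1, q2, q3, q4⟩ := q
    push_cast at q2
    simp only at *
    have : n = t := uniq_box (d := 1) n0 q1 (by norm_num) hm (by omega) u1 u2 q3 q4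
    refine ⟨by ext <;> simp <;> omega, ?_⟩
    have hs : (s:ℝ) = m := by exact_mod_cast (by omega : s = m)
    have hn : (m:ℝ) = n + 1 := by exact_mod_cast hm
    rw [hs]
    have hn' : (n:ℝ) = m - 1 := by linarith
    rw [hn'] at c4
    linarith

/-- exit from box `b` to box `b'` -/
def ExitX (lam : ℝ) (b b' : ℤ × ℤ) (x y : ℝ) : Prop :=
  (ExitB lam b.1 b.2 x y ∧ b' = (b.1, b.2 - 1)) ∨
  (0 ≤ b.2 ∧ ExitR lam b.1 b.2 x y ∧ b' = (b.1 + 1, b.2)) ∨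
  (b.2 < 0 ∧ ExitL lam b.1 b.2 x y ∧ b' = (b.1 - 1, b.2))

theorem exit_any {e : ℕ} {lam x y : ℝ} {l : ℕ} (hl : 0 < lam)
    (hlam : lam * ((e:ℝ) + 10) ^ 2 ≤ 1 / 1000) (hle : l ≤ 2 * Nat.sqrt e)
    (hb : Rfl (x, y) = bseq e l)
    (hL : (x, y) ∈ TransSet lam) (hS : (x, y) ∉ SigmaSet lam) (hH : Ham (x, y) ∈ Icrit e) :
    ExitX lam (bseq e l) (bseq e (l + 1)) x y ∧ Rfl ((Fl lam)^[4] (x, y)) = bseq e (l + 1) := by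
  obtain ⟨k1, k2, k3⟩ := bnds hl hlam (show l ≤ 2 * Nat.sqrt e + 1 by omega)
  have had := adm_bseq hle
  have hnx : bseq e (l + 1) = nextB e (bseq e l) := rfl
  rw [hnx]
  generalize bseq e l = b at *
  obtain ⟨m, n⟩ := b
  unfold ExitX nextB
  simp only at *
  rcases had with ⟨a1, a2⟩ | ⟨a1, a2, a3⟩
  · rcases exit_pos hl k1 k2 k3 hb a1 a2 hL hS hH with ⟨c1, c2, c3⟩ | ⟨c1, c2, c3⟩
    · rw [if_pos a1, if_pos c3]
      exact ⟨Or.inl ⟨c1, rfl⟩, c2⟩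
    · rw [if_pos a1, if_neg (by omega)]
      exact ⟨Or.inr (Or.inl ⟨a1, c1, rfl⟩), c2⟩
  · rcases exit_neg hl k1 k2 k3 hb a1 a2 a3 hL hS hH with ⟨c1, c2, c3⟩ | ⟨c1, c2, c3⟩
    · rw [if_neg (by omega), if_pos c3]
      exact ⟨Or.inl ⟨c1, rfl⟩, c2⟩
    · rw [if_neg (by omega), if_neg (by omega)]
      exact ⟨Or.inr (Or.inr ⟨a1, c1, rfl⟩), c2⟩

set_option maxHeartbeats 1000000 in
theorem stepOK_exit {lam x y : ℝ} {m n m' n' : ℤ} (hl : 0 < lam) (hl1 : lam ≤ 1 / 1000)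
    (hlm : |lam * m| ≤ 1 / 1000) (hln : |lam * n| ≤ 1 / 1000)
    (hb : Rfl (x, y) = (m, n)) (had : AdmT m n) (had' : AdmT m' n') (hm' : 1 ≤ m') (hx : 0 < x)
    (hE : ExitX lam (m, n) (m', n') x y) (hR : Rfl ((Fl lam)^[4] (x, y)) = (m', n')) :
    StepOK lam (x, y) ((Fl lam)^[4] (x, y)) := by
  obtain ⟨h1, h2, h3, h4⟩ := box_Rfl hb
  have f1 : ⌊x⌋ = m := Int.floor_eq_iff.2 ⟨h1, h2⟩
  have hm0 : 0 ≤ m := by unfold AdmT at had; omega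
  have hm0' : (0:ℝ) ≤ m := by exact_mod_cast hm0
  have hlm0 : 0 ≤ lam * m := by positivity
  rw [abs_le] at hlm hln
  have hsum : (0:ℝ) ≤ m' + n' := by
    have : 0 ≤ m' + n' := by unfold AdmT at had'; omega
    exact_mod_cast this
  unfold ExitX at hE
  simp only [Prod.mk.injEq] at hE
  rcases hE with ⟨⟨e1, ⟨θ, e2, e3⟩, e4, e5⟩, rfl, rfl⟩ | ⟨hn, ⟨e1, ⟨θ, e2, e3⟩, e4, e5⟩, rfl, rfl⟩ | ⟨hn, ⟨e1, ⟨θ, e2, e3⟩, e4, e5⟩, rfl, rfl⟩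
  · have hθ : (0:ℝ) ≤ θ ∧ (θ:ℝ) ≤ 1 := by rcases e3 with ⟨rfl, -⟩ | ⟨rfl, -⟩ <;> norm_num
    have hlθ : 0 ≤ lam * θ ∧ lam * θ ≤ lam := by constructor <;> nlinarith
    rw [e2] at hR ⊢
    obtain ⟨g1, g2, g3, g4⟩ := box_Rfl hR
    have f2 : ⌊x + lam * (2 * n - 1 + θ)⌋ = m' := Int.floor_eq_iff.2 ⟨g1, g2⟩
    unfold StepOK
    simp only [f1, f2]
    have hm1 : (1:ℝ) ≤ m' := by exact_mod_cast hm'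
    push_cast at *
    rcases lt_or_ge n 1 with h | h
    · have hn : (n:ℝ) ≤ 0 := by exact_mod_cast (by omega : n ≤ 0)
      have hln' : lam * n ≤ 0 := by nlinarith
      refine ⟨Or.inr ⟨by linarith, by linarith, by omega, le_rfl, hm'⟩, Or.inl (by linarith), hx, by nlinarith⟩
    · have hn : (1:ℝ) ≤ n := by exact_mod_cast h
      have hln' : lam ≤ lam * n := by nlinarith
      refine ⟨Or.inl (by linarith), Or.inr (by linarith), hx, by nlinarith⟩
  · have hθ : (0:ℝ) ≤ θ ∧ (θ:ℝ) ≤ 1 := by rcases e3 with ⟨rfl, -⟩ | ⟨rfl, -⟩ <;> norm_num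
    have hlθ : 0 ≤ lam * θ ∧ lam * θ ≤ lam := by constructor <;> nlinarith
    rw [e2]
    have hn' : (0:ℝ) ≤ n' := by exact_mod_cast hn
    have : 0 ≤ lam * n' := by positivity
    unfold StepOK
    simp only [f1]
    refine ⟨Or.inl (by linarith), Or.inr (by linarith), hx, by nlinarith⟩
  · have hθ : (0:ℝ) ≤ θ ∧ (θ:ℝ) ≤ 1 := by rcases e3 with ⟨rfl, -⟩ | ⟨rfl, -⟩ <;> norm_num
    have hlθ : 0 ≤ lam * θ ∧ lam * θ ≤ lam := by constructor <;> nlinarith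
    rw [e2] at hR ⊢
    obtain ⟨g1, g2, g3, g4⟩ := box_Rfl hR
    have f2 : ⌊x + lam * (2 * n' + 1)⌋ = m - 1 := Int.floor_eq_iff.2 ⟨g1, g2⟩
    unfold StepOK
    simp only [f1, f2]
    have hm1 : (2:ℝ) ≤ m := by exact_mod_cast (by omega : 2 ≤ m)
    have hn' : (n':ℝ) ≤ -1 := by exact_mod_cast (by omega : n' ≤ -1)
    have hln' : lam * n' ≤ -lam := by nlinarith
    push_cast at *
    refine ⟨Or.inr ⟨by linarith, by linarith, by omega, by omega, by omega⟩, Or.inl (by linarith), hx, by nlinarith⟩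

/-- The state of the tracked orbit at its `j`-th vertex, at time `4T`. -/
def Trk (e : ℕ) (lam : ℝ) (z : ℝ × ℝ) (l0 j T : ℕ) : Prop :=
  1 ≤ T ∧ (∀ i < T, StepOK lam ((Fl lam)^[4 * i] z) ((Fl lam)^[4 * (i + 1)] z)) ∧
  (∀ i, 1 ≤ i → i ≤ T → ((Fl lam)^[4 * i] z).2 ≤ ((Fl lam)^[4 * i] z).1) ∧
  (Fl lam)^[4 * T] z ∈ TransSet lam ∧ Rfl ((Fl lam)^[4 * T] z) = bseq e (j - 1 + l0) ∧
  (Psi lam)^[j] z = (Fl lam)^[4 * T] z ∧ 4 * T ≤ tau lam z ∧ 0 < ((Fl lam)^[4 * T] z).1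

theorem trk_reg {e : ℕ} {lam : ℝ} {z : ℝ × ℝ} {l0 j T : ℕ} (hz : IsRegularPt lam e z)
    (h : Trk e lam z l0 j T) : (Psi lam)^[j] z ∈ TransSet lam ∧ (Psi lam)^[j] z ∉ SigmaSet lam ∧
    Ham ((Psi lam)^[j] z) ∈ Icrit e := by
  obtain ⟨h1, h2, h3, h4, h5, h6, h7, h8⟩ := h
  rw [h6]
  refine ⟨h4, fun hc => ?_, hz.1.2 _ (orbit_mem h7)⟩
  have : (Fl lam)^[4 * T] z ∈ returnOrbit lam z ∩ SigmaSet lam := ⟨orbit_mem h7, hc⟩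
  rw [hz.2.2] at this
  exact this

theorem trk_one {e : ℕ} {lam : ℝ} {z : ℝ × ℝ} {l0 : ℕ} (he : 1 ≤ e) (hl : 0 < lam)
    (hlam : lam * ((e:ℝ) + 10) ^ 2 ≤ 1 / 1000)
    (hz : IsRegularPt lam e z) (hl0 : l0 ≤ 1) (hb : Rfl z = bseq e l0) :
    ∃ T, Trk e lam z l0 1 T ∧
      (Psi lam) z = (z.1 + T * (lam * (2 * (bseq e l0).2 + 1)), z.2 - T * (lam * (2 * (bseq e l0).1 + 1))) := by
  obtain ⟨⟨hX, hO⟩, hNL, hSg⟩ := hz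
  have hH : Ham z ∈ Icrit e := by
    have := hO _ (orbit_mem (z := z) (k := 0) (by omega))
    simpa using this
  have hle : l0 ≤ 2 * Nat.sqrt e := by
    have : 1 ≤ Nat.sqrt e := by rw [Nat.le_sqrt]; omega
    omega
  obtain ⟨k1, k2, k3⟩ := bnds hl hlam (show l0 ≤ 2 * Nat.sqrt e + 1 by omega)
  have had := adm_bseq hle
  obtain ⟨c1, c2, c3, c4, c5⟩ := X_close he hl hlam hX hH
  have hd := hX.2.2.2.1
  rw [dG_le] at hd
  have hlat := hX.1
  have hn0 : 0 ≤ (bseq e l0).2 := (bseq_first e l0 (by omega)).1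
  have htg := fun T h1 h2 => tau_ge (T := T) he hl hlam hX hH h1 h2
  unfold Trk
  simp only [Nat.sub_self, Nat.zero_add, Function.iterate_one]
  generalize bseq e l0 = b at *
  obtain ⟨m, n⟩ := b
  obtain ⟨x, y⟩ := z
  simp only at *
  obtain ⟨T, t1, t2, t3⟩ := travel hl k1 k2 k3 hlat hb had.adm (by linarith)
  have hT : 1 ≤ T := by
    by_contra hc
    obtain rfl : T = 0 := by omega
    exact hNL (by simpa using t3)
  have m0 : 0 ≤ m := by unfold AdmT at had; omega
  have m0' : (0:ℝ) ≤ m := by exact_mod_cast m0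
  have n0' : (0:ℝ) ≤ n := by exact_mod_cast hn0
  have hw : 0 < lam * (2 * n + 1) := by positivity
  have hst : ∀ i < T, StepOK lam ((Fl lam)^[4 * i] (x, y)) ((Fl lam)^[4 * (i + 1)] (x, y)) ∧ 
      (((Fl lam)^[4 * i] (x, y)).1 - ((Fl lam)^[4 * i] (x, y)).2 < ((Fl lam)^[4 * (i+1)] (x, y)).1 - ((Fl lam)^[4 * (i+1)] (x, y)).2) := by
    intro i hi
    obtain ⟨i1, i2⟩ := t1 i (by omega)
    obtain ⟨i3, i4⟩ := t1 (i + 1) (by omega)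
    rw [i1] at i2 ⊢
    have hp : 0 ≤ i * (lam * (2 * n + 1)) := by positivity
    have := stepOK_in hl k1 k2 k3 i2 had (by linarith) _ (by rw [i3]; push_cast; (refine Prod.ext ?_ ?_ <;> dsimp only <;> ring)) i4
    exact ⟨this.1, this.2 hn0⟩
  have hs : ∀ i, 1 ≤ i → i ≤ T → ((Fl lam)^[4 * i] (x, y)).2 ≤ ((Fl lam)^[4 * i] (x, y)).1 := by
    intro i hi
    induction i, hi using Nat.le_induction with
    | base =>
      intro _
      have := (hst 0 (by omega)).2
      simp only [mul_zero, Function.iterate_zero, id, zero_add, mul_one] at this ⊢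
      by_contra hc
      push Not at hc
      rw [abs_of_neg (by linarith), abs_of_neg (by linarith)] at hd
      linarith
    | succ i hi ih =>
      intro h
      have := ih (by omega)
      have := (hst i (by omega)).2
      linarith
  have hΨ : Psi lam (x, y) = (Fl lam)^[4 * T] (x, y) := Psi_eq hT t3 (fun s _ h => t2 s h)
  refine ⟨T, ⟨hT, fun i hi => (hst i hi).1, hs, t3, (t1 T le_rfl).2, hΨ, htg T (fun i hi => (hst i hi).1) hs, ?_⟩, ?_⟩
  · rw [(t1 T le_rfl).1]
    have hp : 0 ≤ T * (lam * (2 * n + 1)) := by positivity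
    dsimp only
    linarith
  · rw [hΨ, (t1 T le_rfl).1]

set_option maxHeartbeats 1000000 in
theorem trk_succ {e : ℕ} {lam : ℝ} {z : ℝ × ℝ} {l0 j T : ℕ} (he : 1 ≤ e) (hl : 0 < lam)
    (hlam : lam * ((e:ℝ) + 10) ^ 2 ≤ 1 / 1000) (hj : 1 ≤ j) (hj2 : j + l0 ≤ 2 * Nat.sqrt e)
    (hz : IsRegularPt lam e z) (h : Trk e lam z l0 j T) :
    ∃ t, Trk e lam z l0 (j + 1) (T + 1 + t) ∧
      Rfl ((Fl lam)^[4] ((Psi lam)^[j] z)) = bseq e (j + l0) ∧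
      (Psi lam)^[j + 1] z = (((Fl lam)^[4] ((Psi lam)^[j] z)).1 + t * (lam * (2 * (bseq e (j + l0)).2 + 1)),
        ((Fl lam)^[4] ((Psi lam)^[j] z)).2 - t * (lam * (2 * (bseq e (j + l0)).1 + 1))) := by
  have hr := trk_reg hz h
  have hH : Ham z ∈ Icrit e := by
    have := hz.1.2 _ (orbit_mem (z := z) (k := 0) (by omega))
    simpa using this
  obtain ⟨h1, h2, h3, h4, h5, h6, h7, h8⟩ := h
  have hlat := lat_iter (lat_iter hz.1.1.1 (4 * T)) 4
  have htg := fun T h1 h2 => tau_ge (T := T) he hl hlam hz.1.1 hH h1 h2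
  unfold Trk
  rw [Nat.add_sub_cancel, Function.iterate_succ_apply']
  rw [h6] at hr ⊢
  have hjl : j - 1 + l0 + 1 = j + l0 := by omega
  obtain ⟨k1, k2, k3⟩ := bnds hl hlam (show j - 1 + l0 ≤ 2 * Nat.sqrt e + 1 by omega)
  obtain ⟨-, k2', k3'⟩ := bnds hl hlam (show j + l0 ≤ 2 * Nat.sqrt e + 1 by omega)
  have had := adm_bseq (show j - 1 + l0 ≤ 2 * Nat.sqrt e by omega)
  have had' := adm_bseq (show j + l0 ≤ 2 * Nat.sqrt e by omega)
  have hpos' := bseq_pos e (j + l0) (by omega) hj2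
  have hex := exit_any (x := ((Fl lam)^[4 * T] z).1) (y := ((Fl lam)^[4 * T] z).2) hl hlam (show j - 1 + l0 ≤ 2 * Nat.sqrt e by omega) h5 hr.1 hr.2.1 hr.2.2
  rw [hjl] at hex
  have hq4 : ∀ s, (Fl lam)^[4 * s] ((Fl lam)^[4] ((Fl lam)^[4 * T] z)) = (Fl lam)^[4 * (T + 1 + s)] z := by
    intro s
    rw [Fl4_add, Fl4_succ]
  generalize bseq e (j - 1 + l0) = b at *
  generalize bseq e (j + l0) = b' at *
  generalize hq : (Fl lam)^[4 * T] z = q at *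
  obtain ⟨m, n⟩ := b
  obtain ⟨m', n'⟩ := b'
  obtain ⟨x, y⟩ := q
  simp only at *
  obtain ⟨hE, hR⟩ := hex
  have hok := stepOK_exit hl k1 k2 k3 h5 had had' hpos'.1 h8 hE hR
  generalize hq' : (Fl lam)^[4] (x, y) = q' at *
  obtain ⟨x', y'⟩ := q'
  have hbx := box_Rfl hR
  have hm1 : (1:ℝ) ≤ m' := by exact_mod_cast hpos'.1
  obtain ⟨t, t1, t2, t3⟩ := travel hl k1 k2' k3' hlat hR had'.adm (by linarith)
  have hi : ∀ i, i < T + 1 + t → StepOK lam ((Fl lam)^[4 * i] z) ((Fl lam)^[4 * (i + 1)] z) := by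
    intro i hi
    rcases lt_trichotomy i T with c | c | c
    · exact h2 i c
    · subst c
      rw [hq, Fl4_succ, hq, hq']
      exact hok
    · obtain ⟨s, rfl⟩ : ∃ s, i = T + 1 + s := ⟨i - (T + 1), by omega⟩
      obtain ⟨i1, i2⟩ := t1 s (by omega)
      obtain ⟨i3, i4⟩ := t1 (s + 1) (by omega)
      rw [i1] at i2
      rw [show T + 1 + s + 1 = T + 1 + (s + 1) by omega, ← hq4, ← hq4, i1]
      exact (stepOK_in hl k1 k2' k3' i2 had' (by have := (box_Rfl i2).1; linarith) _ (by rw [i3]; push_cast; (refine Prod.ext ?_ ?_ <;> dsimp only <;> ring)) i4).1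
  have hs : ∀ i, 1 ≤ i → i ≤ T + 1 + t → ((Fl lam)^[4 * i] z).2 ≤ ((Fl lam)^[4 * i] z).1 := by
    intro i hi1 hi2
    rcases le_or_gt i T with c | c
    · exact h3 i hi1 c
    · obtain ⟨s, rfl⟩ : ∃ s, i = T + 1 + s := ⟨i - (T + 1), by omega⟩
      obtain ⟨i1, i2⟩ := t1 s (by omega)
      rw [i1] at i2
      rw [← hq4, i1]
      obtain ⟨g1, g2, g3, g4⟩ := box_Rfl i2
      have : (n':ℝ) + 1 ≤ m' := by exact_mod_cast (by omega : n' + 1 ≤ m')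
      dsimp only
      linarith
  have hΨ : Psi lam (x, y) = (Fl lam)^[4 * (T + 1 + t)] z := by
    have e1 : ∀ s, (Fl lam)^[4 * (s + 1)] (x, y) = (Fl lam)^[4 * s] (x', y') := by
      intro s
      rw [Nat.add_comm, Fl4_add, mul_one, hq']
    rw [← hq4, ← e1]
    apply Psi_eq (by omega)
    · rw [e1]; exact t3
    · intro s hs1 hs2
      obtain ⟨s, rfl⟩ : ∃ s', s = s' + 1 := ⟨s - 1, by omega⟩
      rw [e1]
      exact t2 s (by omega)
  refine ⟨t, ⟨by omega, hi, hs, by rw [← hq4]; exact t3, by rw [← hq4]; exact (t1 t le_rfl).2, hΨ, htg _ hi hs, ?_⟩, hR, ?_⟩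
  · rw [← hq4]
    have := (t1 t le_rfl).2
    rw [(t1 t le_rfl).1] at this ⊢
    have := (box_Rfl this).1
    dsimp only
    linarith
  · rw [hΨ, ← hq4, (t1 t le_rfl).1]

theorem trk_all {e : ℕ} {lam : ℝ} {z : ℝ × ℝ} {l0 : ℕ} (he : 1 ≤ e) (hl : 0 < lam)
    (hlam : lam * ((e:ℝ) + 10) ^ 2 ≤ 1 / 1000)
    (hz : IsRegularPt lam e z) (hl0 : l0 ≤ 1) (hb : Rfl z = bseq e l0) (j : ℕ) (hj : 1 ≤ j)
    (hj2 : j + l0 ≤ 2 * Nat.sqrt e + 1) : ∃ T, Trk e lam z l0 j T := by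
  induction j, hj using Nat.le_induction with
  | base =>
    obtain ⟨T, h, -⟩ := trk_one he hl hlam hz hl0 hb
    exact ⟨T, h⟩
  | succ j hj ih =>
    obtain ⟨T, h⟩ := ih (by omega)
    obtain ⟨t, h', -⟩ := trk_succ he hl hlam hj (by omega) hz h
    exact ⟨_, h'⟩

theorem trk_exit {e : ℕ} {lam : ℝ} {z : ℝ × ℝ} {l0 j T : ℕ} (hl : 0 < lam)
    (hlam : lam * ((e:ℝ) + 10) ^ 2 ≤ 1 / 1000)
    (hz : IsRegularPt lam e z) (hj : 1 ≤ j) (hj2 : j + l0 ≤ 2 * Nat.sqrt e + 1)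
    (h : Trk e lam z l0 j T) :
    ExitX lam (bseq e (j - 1 + l0)) (bseq e (j + l0)) ((Psi lam)^[j] z).1 ((Psi lam)^[j] z).2 ∧
    Rfl ((Psi lam)^[j] z) = bseq e (j - 1 + l0) ∧
    Rfl ((Fl lam)^[4] ((Psi lam)^[j] z)) = bseq e (j + l0) := by
  obtain ⟨r1, r2, r3⟩ := trk_reg hz h
  have hR : Rfl ((Psi lam)^[j] z) = bseq e (j - 1 + l0) := by rw [h.2.2.2.2.2.1]; exact h.2.2.2.2.1
  generalize (Psi lam)^[j] z = w at *
  obtain ⟨x, y⟩ := w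
  obtain ⟨a, b⟩ := exit_any hl hlam (show j - 1 + l0 ≤ 2 * Nat.sqrt e by omega) hR r1 r2 r3
  have : j - 1 + l0 + 1 = j + l0 := by omega
  rw [this] at a b
  exact ⟨a, hR, b⟩

/-- the coordinate of a vertex point transversal to the lattice line -/
def crd (O : Bool) (w : ℝ × ℝ) : ℝ := if O then w.2 else w.1

theorem code_near {lam : ℝ} (hl : 0 < lam) {V : ℕ} {O : Bool} {w : ℝ × ℝ} {s : ℤ}
    (h : CodeAt lam V O w s) : 0 ≤ s ∧ s < 2 * (V:ℤ) + 1 ∧ ∃ c Y : ℤ, crd O w = lam * Y ∧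
      |crd O w - c| < lam * (2 * V + 1) ∧ s ≡ Y - ⌈(c:ℝ) / lam⌉ [ZMOD (2 * (V : ℤ) + 1)] := by
  obtain ⟨h1, h2, h3⟩ := h
  refine ⟨h1, h2, ?_⟩
  have key : ∃ n Y yj : ℤ, crd O w = lam * (Y : ℝ) ∧ Y = ⌈(n : ℝ) / lam⌉ + yj ∧
          |yj| < 2 * (V : ℤ) + 1 ∧ s ≡ yj [ZMOD (2 * (V : ℤ) + 1)] := by
    cases O <;> simpa [crd] using h3
  obtain ⟨n, Y, yj, a1, a2, a3, a4⟩ := key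
  refine ⟨n, Y, a1, ?_, ?_⟩
  · rw [a1, a2]
    have c1 := Int.le_ceil ((n:ℝ) / lam)
    have c2 := Int.ceil_lt_add_one ((n:ℝ) / lam)
    have e1 : (n:ℝ) / lam * lam = n := by field_simp
    have d1 : (n:ℝ) ≤ lam * ⌈(n:ℝ) / lam⌉ := by nlinarith
    have d2 : lam * ⌈(n:ℝ) / lam⌉ < n + lam := by nlinarith
    have a3' : |(yj:ℝ)| ≤ 2 * V := by
      have : |yj| ≤ 2 * (V:ℤ) := by omega
      exact_mod_cast this
    rw [abs_le] at a3'
    push_cast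
    rw [abs_lt]
    constructor <;> nlinarith
  · rw [a2]; simpa using a4

theorem code_iff {lam : ℝ} (hl : 0 < lam) {V : ℕ} {O : Bool} {w wt : ℝ × ℝ} {s st : ℤ}
    (h : CodeAt lam V O w s) (ht : CodeAt lam V O wt st) {c A At : ℤ}
    (hA : crd O w = lam * A) (hAt : crd O wt = lam * At) (hV : lam * (4 * V + 2) ≤ 1)
    (hc : |crd O w - c| ≤ lam * (2 * V + 1)) (hct : |crd O wt - c| ≤ lam * (2 * V + 1)) :
    s = st ↔ A ≡ At [ZMOD (2 * (V : ℤ) + 1)] := by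
  obtain ⟨h1, h2, c1, Y, a1, a2, a3⟩ := code_near hl h
  obtain ⟨h1t, h2t, c1t, Yt, a1t, a2t, a3t⟩ := code_near hl ht
  have e1 : Y = A := by
    have : (Y:ℝ) = A := mul_left_cancel₀ hl.ne' (a1.symm.trans hA)
    exact_mod_cast this
  have e2 : Yt = At := by
    have : (Yt:ℝ) = At := mul_left_cancel₀ hl.ne' (a1t.symm.trans hAt)
    exact_mod_cast this
  have pin : ∀ (c1 : ℤ) (r : ℝ), |r - c1| < lam * (2 * V + 1) → |r - c| ≤ lam * (2 * V + 1) → c1 = c := by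
    intro c1 r g1 g2
    rw [abs_lt] at g1
    rw [abs_le] at g2
    have k1 : (c1:ℝ) < c + 1 := by linarith
    have k2 : (c:ℝ) < c1 + 1 := by linarith
    have k1 : c1 < c + 1 := by exact_mod_cast k1
    have k2 : c < c1 + 1 := by exact_mod_cast k2
    omega
  have p1 := pin _ _ a2 hc
  have p2 := pin _ _ a2t hct
  subst p1 p2 e1 e2
  constructor
  · rintro rfl
    have := a3.symm.trans a3t
    have := Int.ModEq.add_right ⌈(c1t:ℝ) / lam⌉ this
    simpa using this
  · intro hh
    have h3 : s ≡ st [ZMOD (2 * (V : ℤ) + 1)] := a3.trans ((Int.ModEq.sub_right _ hh).trans a3t.symm)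
    unfold Int.ModEq at h3
    rwa [Int.emod_eq_of_lt h1 h2, Int.emod_eq_of_lt h1t h2t] at h3

theorem int_gap {n c : ℤ} {y d : ℝ} (h1 : n + d < y) (h2 : y < n + 1 - d) (h3 : |y - c| < d) : False := by
  rw [abs_lt] at h3
  have k1 : (n:ℝ) < c := by linarith
  have k2 : (c:ℝ) < n + 1 := by linarith
  have k1 : n < c := by exact_mod_cast k1
  have k2 : c < n + 1 := by exact_mod_cast k2
  omega

theorem odd_step {lam : ℝ} (hl : 0 < lam) {b0 b b' : ℤ × ℤ} {V V' : ℕ} {O O' : Bool} {w : ℝ × ℝ} {s : ℤ}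
    (had : AdmT b.1 b.2)
    (h0 : VLprop b0 b V O) (h1 : VLprop b b' V' O') (hE : ExitX lam b b' w.1 w.2)
    (hc : CodeAt lam V O w s) : O = O' := by
  obtain ⟨-, -, c, Y, -, hn, -⟩ := code_near hl hc
  obtain ⟨m, n⟩ := b
  obtain ⟨m0, n0⟩ := b0
  obtain ⟨m', n'⟩ := b'
  unfold VLprop at h0 h1
  unfold ExitX at hE
  unfold AdmT at had
  simp only [Prod.mk.injEq] at *
  by_contra hO
  have hVm : (V:ℤ) ≤ m := by omega
  have hVm' : (V:ℝ) ≤ m := by exact_mod_cast hVm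
  have hle : lam * (2 * V + 1) ≤ lam * (2 * m + 3) := by
    apply mul_le_mul_of_nonneg_left _ hl.le; linarith
  cases O <;> cases O' <;> simp only [crd, not_true_eq_false, Bool.false_eq_true, if_false, if_true] at *
  · rcases hE with ⟨⟨-, -, e4, e5⟩, -⟩ | ⟨-, -, e⟩ | ⟨-, -, e⟩
    · exact int_gap e4 (by linarith) (lt_of_lt_of_le hn hle)
    · simp at h1; omega
    · simp at h1; omega
  · rcases hE with ⟨-, e⟩ | ⟨-, ⟨-, -, e4, e5⟩, -⟩ | ⟨-, ⟨-, -, e4, e5⟩, -⟩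
    · simp at h1; omega
    · exact int_gap (d := lam * (2 * m + 3)) (by linarith) (by linarith) (lt_of_lt_of_le hn hle)
    · exact int_gap e4 e5 (lt_of_lt_of_le hn hle)

theorem Ham_exitB {lam x y X' Y' : ℝ} {m n : ℤ} {t : ℕ} (hl : 0 < lam) (hm : 0 ≤ m)
    (hb : Rfl (x, y) = (m, n)) (hE : ExitB lam m n x y)
    (hX : X' = ((Fl lam)^[4] (x, y)).1 + t * (lam * (2 * ((n - 1 : ℤ):ℝ) + 1)))
    (hY : Y' = ((Fl lam)^[4] (x, y)).2 - t * (lam * (2 * m + 1)))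
    (hb' : Rfl (X', Y') = (m, n - 1)) : Ham (X', Y') ≤ Ham (x, y) + lam := by
  rw [Ham_eq hb, Ham_eq hb']
  obtain ⟨e1, ⟨θ, e2, e3⟩, -⟩ := hE
  rw [e2] at hX hY
  simp only at hX hY
  rw [hX, hY]
  obtain ⟨h1, h2, h3, h4⟩ := box_Rfl hb
  push_cast
  rcases e3 with ⟨rfl, e3⟩ | ⟨rfl, e3⟩ <;> push_cast <;> nlinarith

theorem odd_const {e : ℕ} {lam : ℝ} {z : ℝ × ℝ} {v : ℕ → ℕ} {o : ℕ → Bool} {σ : ℤ → ℤ}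
    (hv : IsVertexList e v o) (he : 1 ≤ e) (hl : 0 < lam)
    (hlam : lam * ((e:ℝ) + 10) ^ 2 ≤ 1 / 1000)
    (hz : IsRegularPt lam e z) (hb : Rfl z = bseq e 1) (hs : IsOrbitCode lam e v o z σ) :
    ∀ j, j + 1 ≤ 2 * Nat.sqrt e + 1 → oext e o (j + 1) = oext e o 1 := by
  intro j
  induction j with
  | zero => intro _; rfl
  | succ j ih =>
    intro hj
    rw [← ih (by omega)]
    obtain ⟨T, h⟩ := trk_all he hl hlam hz le_rfl hb (j + 1) (by omega) (by omega)
    obtain ⟨a, -, -⟩ := trk_exit hl hlam hz (by omega) (by omega) h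
    have h0 := VL hv (j + 1) (by omega) (by omega)
    have h1 := VL hv (j + 1 + 1) (by omega) (by omega)
    have hc := hs.2 (j + 1) (by omega) (by omega)
    have := odd_step hl (adm_bseq (show j + 1 ≤ 2 * Nat.sqrt e by omega)) h0 h1 a hc
    exact this.symm

theorem odd_shape {e : ℕ} {v : ℕ → ℕ} {o : ℕ → Bool} (hv : IsVertexList e v o)
    (h : ∀ j, j + 1 ≤ 2 * Nat.sqrt e + 1 → oext e o (j + 1) = oext e o 1) :
    ∀ l, l ≤ 2 * Nat.sqrt e + 1 → bseq e l = ((Nat.sqrt e : ℤ), (Nat.sqrt e : ℤ) - l) := by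
  have hO : ∀ j, j + 1 ≤ 2 * Nat.sqrt e + 1 → oext e o (j + 1) = true := by
    intro j hj
    rw [h j hj, ← h (Nat.sqrt e) (by omega)]
    have h1 := VL hv (Nat.sqrt e + 1) (by omega) (by omega)
    have h2 : bseq e (Nat.sqrt e + 1) = nextB e (bseq e (Nat.sqrt e)) := rfl
    have hs := sqrt_lt e
    rw [h2, Nat.add_sub_cancel, bseq_mid] at h1
    unfold nextB VLprop at h1
    simp at h1
    rcases h1 with h1 | ⟨-, -, h1⟩
    · exact h1.1
    · linarith
  have hl : ∀ l, l ≤ 2 * Nat.sqrt e + 1 → bseq e l = ((bseq e 0).1, (bseq e 0).1 - l) := by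
    intro l
    induction l with
    | zero => intro _; simp [bseq]
    | succ l ih =>
      intro hl
      have h1 := VL hv (l + 1) (by omega) hl
      rw [hO l hl, Nat.add_sub_cancel, ih (by omega)] at h1
      unfold VLprop at h1
      simp at h1
      rw [h1.2]
      refine Prod.ext ?_ ?_ <;> simp only <;> push_cast <;> ring
  have hm := hl (Nat.sqrt e) (by omega)
  rw [bseq_mid] at hm
  simp only [Prod.mk.injEq] at hm
  intro l h'
  rw [hl l h', ← hm.1]

theorem not_odd {e : ℕ} {lam : ℝ} {z : ℝ × ℝ} {v : ℕ → ℕ} {o : ℕ → Bool} {σ : ℤ → ℤ}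
    (hv : IsVertexList e v o) (he : 1 ≤ e) (hl : 0 < lam)
    (hlam : lam * ((e:ℝ) + 10) ^ 2 ≤ 1 / 1000)
    (hz : IsRegularPt lam e z) (hb : Rfl z = bseq e 1)
    (hd : z.1 - z.2 < lam * (2 * ((bseq e 1).1:ℝ) + 1 / 2)) (hs : IsOrbitCode lam e v o z σ) : False := by
  have hsh := odd_shape hv (odd_const hv he hl hlam hz hb hs)
  -- the Hamiltonian chain
  have chain : ∀ j, 1 ≤ j → j ≤ 2 * Nat.sqrt e → ∃ T, Trk e lam z 1 j T ∧
      Ham ((Psi lam)^[j] z) ≤ Ham z + ((j:ℝ) - 1) * lam := by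
    intro j hj
    induction j, hj using Nat.le_induction with
    | base =>
      intro hh
      obtain ⟨T, h, h'⟩ := trk_one he hl hlam hz le_rfl hb
      refine ⟨T, h, ?_⟩
      obtain ⟨-, k, -⟩ := trk_exit hl hlam hz le_rfl (by omega) h
      simp only [Function.iterate_one] at k ⊢
      rw [h'] at k ⊢
      simp only [Nat.sub_self, zero_add] at k
      have hb' : Rfl (z.1, z.2) = bseq e 1 := hb
      have e1 := Ham_eq (m := (bseq e 1).1) (n := (bseq e 1).2) k
      have e2 := Ham_eq (m := (bseq e 1).1) (n := (bseq e 1).2) hb'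
      rw [Prod.mk.eta] at e2
      rw [e1, e2]
      apply le_of_eq
      push_cast
      ring
    | succ j hj ih =>
      intro hh
      obtain ⟨T, h, h'⟩ := ih (by omega)
      obtain ⟨t, g1, g2, g3⟩ := trk_succ he hl hlam hj (by omega) hz h
      refine ⟨_, g1, ?_⟩
      obtain ⟨k1, k2, k3⟩ := trk_exit hl hlam hz hj (by omega) h
      obtain ⟨-, k4, -⟩ := trk_exit hl hlam hz (by omega) (by omega) g1
      have i1 : j - 1 + 1 = j := by omega
      rw [i1] at k1 k2
      rw [Nat.add_sub_cancel] at k4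
      rw [hsh j (by omega)] at k1 k2
      rw [hsh (j + 1) (by omega)] at k1 k4 g3
      have hE : ExitB lam (Nat.sqrt e : ℤ) ((Nat.sqrt e : ℤ) - j) ((Psi lam)^[j] z).1 ((Psi lam)^[j] z).2 := by
        unfold ExitX at k1
        simp only [Prod.mk.injEq] at k1
        rcases k1 with ⟨k, -⟩ | ⟨-, -, k, -⟩ | ⟨-, -, k, -⟩
        · exact k
        · omega
        · omega
      rw [g3] at k4 ⊢
      have i2 : (((j + 1 : ℕ) : ℤ)) = (j:ℤ) + 1 := by push_cast; ring
      rw [i2, ← sub_sub] at k4 ⊢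
      have := Ham_exitB hl (by positivity) (t := t) k2 hE rfl rfl k4
      push_cast at this ⊢
      simp only [Prod.mk.eta] at this
      linarith
  have hv1 : 1 ≤ Nat.sqrt e := by
    by_contra hc
    have : Nat.sqrt e = 0 := by omega
    have := Nat.sqrt_eq_zero.1 this
    omega
  have hv2 : Nat.sqrt e ≤ 2 := by
    have h0 := (bseq_first e 0 (by omega)).2.2.1
    rw [hsh 0 (by omega)] at h0
    have h1 := sqrt_lt e
    simp only [Nat.cast_zero, sub_zero] at h0
    have : (Nat.sqrt e : ℤ) ≤ 2 := by nlinarith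
    exact_mod_cast this
  obtain ⟨T, g1, g2⟩ := chain (2 * Nat.sqrt e) (by omega) le_rfl
  obtain ⟨k1, k2, k3⟩ := trk_exit hl hlam hz (by omega) (by omega) g1
  have hlq : IsLatticePt lam ((Psi lam)^[2 * Nat.sqrt e] z) := (trk_reg hz g1).1.1
  have hlz : IsLatticePt lam z := hz.1.1.1
  have i1 : 2 * Nat.sqrt e - 1 + 1 = 2 * Nat.sqrt e := by omega
  rw [i1] at k1 k2
  rw [hsh (2 * Nat.sqrt e) (by omega)] at k1 k2
  rw [hsh (2 * Nat.sqrt e + 1) (by omega)] at k1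
  rw [hsh 1 (by omega)] at hb hd
  have hE : ExitB lam (Nat.sqrt e : ℤ) ((Nat.sqrt e : ℤ) - (2 * Nat.sqrt e : ℕ)) ((Psi lam)^[2 * Nat.sqrt e] z).1 ((Psi lam)^[2 * Nat.sqrt e] z).2 := by
    unfold ExitX at k1
    simp only [Prod.mk.injEq] at k1
    rcases k1 with ⟨k, -⟩ | ⟨-, -, k, -⟩ | ⟨-, -, k, -⟩
    · exact k
    · omega
    · omega
  generalize (Psi lam)^[2 * Nat.sqrt e] z = q at *
  generalize Nat.sqrt e = s at *
  clear chain hsh k1 k3 g1 hs hz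
  obtain ⟨a, b, rfl⟩ := hlz
  obtain ⟨a', b', rfl⟩ := hlq
  rw [Ham_eq hb, Ham_eq k2] at g2
  obtain ⟨e1, -, e3, -⟩ := hE
  obtain ⟨h1, h2, h3, h4⟩ := box_Rfl hb
  obtain ⟨f1, f2, f3, f4⟩ := box_Rfl k2
  simp only at *
  interval_cases s
  · push_cast at *
    norm_num at *
    nlinarith
  · push_cast at *
    norm_num at *
    have j1 : a - b ≤ 4 := by
      have : lam * ((a:ℝ) - b) < lam * (9/2) := by linarith
      have := lt_of_mul_lt_mul_left this hl.le
      have : (a:ℝ) - b < 5 := by linarith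
      have : a - b < 5 := by exact_mod_cast this
      omega
    have j2 : a' - a ≤ 3 := by
      have : lam * ((a':ℝ) - a) < lam * 4 := by nlinarith
      have := lt_of_mul_lt_mul_left this hl.le
      have : a' - a < 4 := by exact_mod_cast this
      omega
    have j1' : (a:ℝ) - b ≤ 4 := by exact_mod_cast j1
    have j2' : (a':ℝ) - a ≤ 3 := by exact_mod_cast j2
    nlinarith

theorem int_pin {a c : ℤ} {r : ℝ} (h1 : (a:ℝ) ≤ r) (h2 : r < a + 1) (h3 : (c:ℝ) ≤ r) (h4 : r < c + 1) :
    a = c := by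
  have k1 : (a:ℝ) < c + 1 := by linarith
  have k2 : (c:ℝ) < a + 1 := by linarith
  have k1 : a < c + 1 := by exact_mod_cast k1
  have k2 : c < a + 1 := by exact_mod_cast k2
  omega

theorem int_le {a c : ℤ} {r : ℝ} (h1 : (a:ℝ) ≤ r) (h4 : r < c + 1) : a ≤ c := by
  have k1 : (a:ℝ) < c + 1 := by linarith
  have k1 : a < c + 1 := by exact_mod_cast k1
  omega

theorem int_ge {a c : ℤ} {r : ℝ} (h1 : r < a + 1) (h4 : (c:ℝ) ≤ r) : c ≤ a := by
  have k1 : (c:ℝ) < a + 1 := by linarith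
  have k1 : c < a + 1 := by exact_mod_cast k1
  omega

set_option maxHeartbeats 2000000 in
theorem back_B {lam x y a b : ℝ} {v : ℤ} (hl : 0 < lam) (hl1 : lam ≤ 1 / 1000)
    (hlv : lam * v ≤ 1 / 1000) (hv : 1 ≤ v) (hq : Rfl (x, y) = (v, v)) (hL : (x, y) ∈ TransSet lam)
    (hab : Rfl (a, b) = (v, v)) (hE : ExitB lam v v a b) (hsum : x + y = a + b)
    (hlat : IsLatticePt lam ((Fl lam)^[4] (a, b)))
    (hS : (Fl lam)^[4] (a, b) ∉ SigmaSet lam) :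
    ((Fl lam)^[4] (x, y)).2 = y - lam * (2 * v + 1) ∧ y - lam * (2 * v + 1) < v := by
  obtain ⟨h1, h2, h3, h4⟩ := box_Rfl hq
  obtain ⟨g1, g2, g3, g4⟩ := box_Rfl hab
  obtain ⟨e1, ⟨θ, e2, e3⟩, e4, e5⟩ := hE
  have hv' : (1:ℝ) ≤ v := by exact_mod_cast hv
  have hlv0 : lam ≤ lam * v := by nlinarith
  have hfm : ⌊x⌋ = v := Int.floor_eq_iff.2 ⟨h1, h2⟩
  obtain ⟨a1, a2, a3, ⟨ha, ha'⟩, ⟨hb1, hb'⟩, ⟨hc, hc'⟩, he⟩ := Fl4_steps lam x y v hfm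
  have hRn := hL.2
  rw [he, hq] at hRn
  rw [he]
  have ka1 : a1 ≤ -v := int_le ha (by push_cast; linarith)
  have ka2 : -v - 1 ≤ a1 := int_ge ha' (by push_cast; linarith)
  have ka1r : (a1:ℝ) ≤ -v := by exact_mod_cast ka1
  have ka2r : -(v:ℝ) - 1 ≤ a1 := by exact_mod_cast ka2
  by_cases hx : x ≤ v + 1 - lam * (v + 1)
  · have e : a2 = -v - 1 := by
      apply int_pin hb1 hb'
      · push_cast; nlinarith
      · push_cast; nlinarith
    subst e
    push_cast at *
    refine ⟨by ring, ?_⟩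
    by_contra hcon
    push Not at hcon
    have e : a3 = v := by apply int_pin hc hc' <;> linarith
    have e' : a1 = -v - 1 := by apply int_pin ha ha' <;> push_cast <;> linarith
    subst e e'
    push_cast at *
    apply hRn
    apply Rfl_box <;> linarith
  · exfalso
    push Not at hx
    have hth : θ = 1 := by
      rcases e3 with ⟨-, e3⟩ | ⟨e3, -⟩
      · nlinarith
      · exact e3
    subst hth
    apply hS
    have hv4 : (4:ℤ) ≤ v := by
      have : lam * 3 < lam * v := by nlinarith
      have := lt_of_mul_lt_mul_left this hl.le
      have : 3 < v := by exact_mod_cast this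
      omega
    have hv4' : (4:ℝ) ≤ v := by exact_mod_cast hv4
    have hl4 : lam * 4 ≤ lam * v := by nlinarith
    rw [e2] at hlat ⊢
    push_cast at *
    have r1 : v ≤ a + lam * (2 * v - 1 + 1) := by nlinarith
    have r2 : a + lam * (2 * v - 1 + 1) < v + 1 := by nlinarith
    have r3 : v - lam * (v - 3) < b - lam * (2 * v + 1) := by nlinarith
    have r4 : b - lam * (2 * v + 1) < v := by nlinarith
    have r5 : v + 1 - lam * (v + 2) < a + lam * (2 * v - 1 + 1) := by nlinarith
    generalize a + lam * (2 * v - 1 + 1) = X at *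
    generalize b - lam * (2 * v + 1) = Y at *
    refine ⟨⟨hlat, ?_⟩, v + 1, v, ?_⟩
    · obtain ⟨c1, c2, c3, ⟨ja, ja'⟩, ⟨jb, jb'⟩, ⟨jc, jc'⟩, je⟩ := Fl4_steps lam X Y v (Int.floor_eq_iff.2 ⟨r1, r2⟩)
      rw [je]
      have q1 : c1 = -v := by apply int_pin ja ja' <;> push_cast <;> nlinarith
      subst q1
      push_cast at *
      have q2 : c2 ≤ -v - 1 := int_le jb (by push_cast; nlinarith)
      have q3 : -v - 2 ≤ c2 := int_ge jb' (by push_cast; nlinarith)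
      have q2' : (c2:ℝ) ≤ -v - 1 := by exact_mod_cast q2
      have q3' : -(v:ℝ) - 2 ≤ c2 := by exact_mod_cast q3
      have q4 : c3 = v - 1 := by apply int_pin jc jc' <;> push_cast <;> nlinarith
      subst q4
      intro hcon
      have hcon1 := congrArg Prod.fst hcon
      simp only [Rfl] at hcon1
      rw [Int.floor_eq_iff.2 ⟨r1, r2⟩] at hcon1
      have := Int.lt_floor_add_one (X + lam * (((v - 1 : ℤ):ℝ) - -v))
      rw [hcon1] at this
      push_cast at this
      nlinarith
    · have hm : |2 * ((v + 1 : ℤ):ℝ) + 1| = 2 * v + 3 := by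
        rw [abs_of_pos (by push_cast; linarith)]; push_cast; ring
      have : 2 * (v:ℝ) + 3 ≤ max |2 * ((v + 1 : ℤ):ℝ) + 1| |2 * (v:ℝ) + 1| := by rw [hm]; exact le_max_left _ _
      have : lam * (2 * v + 3 + 2) ≤ lam * (max |2 * ((v + 1 : ℤ):ℝ) + 1| |2 * (v:ℝ) + 1| + 2) := by
        apply mul_le_mul_of_nonneg_left _ hl.le; linarith
      refine le_trans (max_le ?_ ?_) this
      · rw [abs_le]; push_cast; constructor <;> nlinarith
      · rw [abs_le]; constructor <;> nlinarith

set_option maxHeartbeats 2000000 in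
theorem back_R {lam x y a b : ℝ} {v : ℤ} (hl : 0 < lam) (hl1 : lam ≤ 1 / 1000)
    (hlv : lam * v ≤ 1 / 1000) (hv : 0 ≤ v) (hq : Rfl (x, y) = (v, v)) (hL : (x, y) ∈ TransSet lam)
    (hab : Rfl (a, b) = (v, v)) (hE : ExitR lam v v a b) (hsum : x + y = a + b)
    (hlat : IsLatticePt lam ((Fl lam)^[4] (a, b)))
    (hS : (Fl lam)^[4] (a, b) ∉ SigmaSet lam) :
    ((Fl lam)^[4] (x, y)).1 = x + lam * (2 * v + 1) ∧ v + 1 ≤ x + lam * (2 * v + 1) := by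
  obtain ⟨h1, h2, h3, h4⟩ := box_Rfl hq
  obtain ⟨g1, g2, g3, g4⟩ := box_Rfl hab
  obtain ⟨e1, ⟨θ, e2, e3⟩, e4, e5⟩ := hE
  have hv' : (0:ℝ) ≤ v := by exact_mod_cast hv
  have hlv0 : 0 ≤ lam * v := by nlinarith
  have hfm : ⌊x⌋ = v := Int.floor_eq_iff.2 ⟨h1, h2⟩
  obtain ⟨a1, a2, a3, ⟨ha, ha'⟩, ⟨hb1, hb'⟩, ⟨hc, hc'⟩, he⟩ := Fl4_steps lam x y v hfm
  have hRn := hL.2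
  rw [he, hq] at hRn
  rw [he]
  by_cases hy : v + lam * (2 * v + 2) ≤ y
  · have q1 : a1 = -v - 1 := by apply int_pin ha ha' <;> push_cast <;> nlinarith
    subst q1
    push_cast at *
    have q2 : a2 ≤ -v - 1 := int_le hb1 (by push_cast; nlinarith)
    have q3 : -v - 2 ≤ a2 := int_ge hb' (by push_cast; nlinarith)
    have q2' : (a2:ℝ) ≤ -v - 1 := by exact_mod_cast q2
    have q3' : -(v:ℝ) - 2 ≤ a2 := by exact_mod_cast q3
    have q4 : a3 = v := by apply int_pin hc hc' <;> nlinarith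
    subst q4
    refine ⟨by ring, ?_⟩
    by_contra hcon
    push Not at hcon
    apply hRn
    apply Rfl_box <;> nlinarith
  · exfalso
    push Not at hy
    have hθ : (0:ℝ) ≤ θ ∧ (θ:ℝ) ≤ 1 := by rcases e3 with ⟨rfl, -⟩ | ⟨rfl, -⟩ <;> norm_num
    have hlθ : 0 ≤ lam * θ ∧ lam * θ ≤ lam := by constructor <;> nlinarith
    have hv2 : (2:ℤ) ≤ v := by
      have : lam * 1 < lam * v := by nlinarith
      have := lt_of_mul_lt_mul_left this hl.le
      have : 1 < v := by exact_mod_cast this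
      omega
    have hv2' : (2:ℝ) ≤ v := by exact_mod_cast hv2
    have hl4 : lam * 2 ≤ lam * v := by nlinarith
    apply hS
    rw [e2] at hlat ⊢
    have r1 : ((v + 1 : ℤ):ℝ) ≤ a + lam * (2 * v + 1) := by push_cast; nlinarith
    have r2 : a + lam * (2 * v + 1) < v + 1 + lam * (2 * v + 1) := by nlinarith
    have r3 : v < b - lam * (2 * v + 1 + θ) := by nlinarith
    have r4 : b - lam * (2 * v + 1 + θ) < v + lam * (2 * v + 2) := by nlinarith
    generalize a + lam * (2 * v + 1) = X at *
    generalize b - lam * (2 * v + 1 + θ) = Y at *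
    refine ⟨⟨hlat, ?_⟩, v + 1, v, ?_⟩
    · have fx : ⌊X⌋ = v + 1 := Int.floor_eq_iff.2 ⟨r1, by push_cast; nlinarith⟩
      have fy : ⌊Y⌋ = v := Int.floor_eq_iff.2 ⟨r3.le, by nlinarith⟩
      obtain ⟨c1, c2, c3, ⟨ja, ja'⟩, ⟨jb, jb'⟩, ⟨jc, jc'⟩, je⟩ := Fl4_steps lam X Y (v+1) fx
      rw [je]
      push_cast at *
      have q1 : c1 ≤ -v := int_le ja (by push_cast; nlinarith)
      have q1' : (c1:ℝ) ≤ -v := by exact_mod_cast q1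
      have q2 : c2 ≤ -v - 2 := int_le jb (by push_cast; nlinarith)
      have q2' : (c2:ℝ) ≤ -v - 2 := by exact_mod_cast q2
      intro hcon
      have hcon1 := congrArg Prod.snd hcon
      simp only [Rfl] at hcon1
      rw [fy] at hcon1
      have := Int.floor_le (Y + lam * ((c2:ℝ) - (v + 1)))
      rw [hcon1] at this
      nlinarith
    · have hm : |2 * ((v + 1 : ℤ):ℝ) + 1| = 2 * v + 3 := by
        rw [abs_of_pos (by push_cast; linarith)]; push_cast; ring
      have : 2 * (v:ℝ) + 3 ≤ max |2 * ((v + 1 : ℤ):ℝ) + 1| |2 * (v:ℝ) + 1| := by rw [hm]; exact le_max_left _ _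
      have : lam * (2 * v + 3 + 2) ≤ lam * (max |2 * ((v + 1 : ℤ):ℝ) + 1| |2 * (v:ℝ) + 1| + 2) := by
        apply mul_le_mul_of_nonneg_left _ hl.le; linarith
      refine le_trans (max_le ?_ ?_) this
      · rw [abs_le]; push_cast at *; constructor <;> nlinarith
      · rw [abs_le]; constructor <;> nlinarith

theorem psiInv_eq {lam : ℝ} {z : ℝ × ℝ} {t : ℕ} (hlat : IsLatticePt lam z)
    (h1 : ∀ t' < t, (Fl lam)^[4 * t'] z.swap ∉ TransSet lam)
    (h2 : (Fl lam)^[4 * t] z.swap ∈ TransSet lam) :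
    PsiInv lam z = ((Fl lam)^[4 * (t + 1)] z.swap).swap := by
  have key : ∀ i, (Flinv lam)^[4 * (i + 1)] z ∈ TransSet lam ↔ (Fl lam)^[4 * i] z.swap ∈ TransSet lam := by
    intro i
    have l1 : IsLatticePt lam ((Fl lam)^[4 * i] z.swap) := lat_iter (lat_swap hlat) _
    have l2 : IsLatticePt lam ((Flinv lam)^[4 * (i + 1)] z) := by
      rw [Flinv_iter]; exact lat_swap (lat_iter (lat_swap hlat) _)
    have e1 : (Fl lam)^[4] ((Flinv lam)^[4 * (i + 1)] z) = (Flinv lam)^[4 * i] z := by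
      have : (Flinv lam)^[4 * (i + 1)] z = (Flinv lam)^[4] ((Flinv lam)^[4 * i] z) := by
        rw [← Function.iterate_add_apply]; congr 1; ring
      rw [this]
      exact Function.LeftInverse.iterate (Fl_Flinv lam) 4 _
    unfold TransSet
    simp only [Set.mem_ofPred_eq, l1, l2, true_and]
    rw [e1, Flinv_iter, Flinv_iter, Fl4_succ]
    generalize (Fl lam)^[4 * i] z.swap = w
    generalize (Fl lam)^[4] w = w'
    simp only [Rfl, Prod.fst_swap, Prod.snd_swap, ne_eq, Prod.mk.injEq]
    constructor
    · intro h h'; exact h ⟨h'.2.symm, h'.1.symm⟩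
    · intro h h'; exact h ⟨h'.2.symm, h'.1.symm⟩
  have hs : sTrans lam z = t + 1 := by
    apply le_antisymm
    · exact Nat.sInf_le ⟨by omega, (key t).2 h2⟩
    · refine le_csInf ⟨t + 1, by omega, (key t).2 h2⟩ ?_
      rintro b ⟨hb1, hb2⟩
      by_contra hc
      obtain ⟨b', rfl⟩ : ∃ b', b = b' + 1 := ⟨b - 1, by omega⟩
      exact h1 b' (by omega) ((key b').1 hb2)
  rw [PsiInv, hs, Flinv_iter]

theorem psiInv_spec {e : ℕ} {lam : ℝ} {z : ℝ × ℝ} {v : ℕ → ℕ} {o : ℕ → Bool}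
    (hv : IsVertexList e v o) (he : 1 ≤ e) (hl : 0 < lam)
    (hlam : lam * ((e:ℝ) + 10) ^ 2 ≤ 1 / 1000)
    (hz : IsRegularPt lam e z) (hb : Rfl z = bseq e 0) :
    ∃ t : ℕ, (o 1 = true → (PsiInv lam z).1 = z.1 - lam * (2 * (v 1) + 1) * (t + 1) ∧
        |(PsiInv lam z).1 - (v 1)| ≤ lam * (2 * (v 1) + 1)) ∧
      (o 1 = false → (PsiInv lam z).2 = z.2 + lam * (2 * (v 1) + 1) * (t + 1) ∧
        |(PsiInv lam z).2 - ((v 1) + 1)| ≤ lam * (2 * (v 1) + 1)) := by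
  have hH : Ham z ∈ Icrit e := by
    have := hz.1.2 _ (orbit_mem (z := z) (k := 0) (by omega))
    simpa using this
  have hv1 : 1 ≤ Nat.sqrt e := by
    by_contra hc
    have : Nat.sqrt e = 0 := by omega
    have := Nat.sqrt_eq_zero.1 this
    omega
  obtain ⟨c1, c2, c3, -⟩ := X_close he hl hlam hz.1.1 hH
  obtain ⟨T, h, h'⟩ := trk_one he hl hlam hz (by omega) hb
  obtain ⟨t0, g1, -, -⟩ := trk_succ he hl hlam le_rfl (by omega) hz h
  obtain ⟨k1, k2, -⟩ := trk_exit hl hlam hz le_rfl (by omega) h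
  have hlatz := hz.1.1.1
  have hps : (Psi lam) z = (Fl lam)^[4 * T] z := h.2.2.2.2.2.1
  have hS : (Fl lam)^[4] (Psi lam z) ∉ SigmaSet lam := by
    intro hc
    rw [hps, ← Fl4_succ] at hc
    have := g1.2.2.2.2.2.2.1
    have hm := orbit_mem (lam := lam) (z := z) (k := 4 * (T + 1)) (by omega)
    have : (Fl lam)^[4 * (T + 1)] z ∈ returnOrbit lam z ∩ SigmaSet lam := ⟨hm, hc⟩
    rw [hz.2.2] at this
    exact this
  have hlatr : IsLatticePt lam ((Fl lam)^[4] (Psi lam z)) := by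
    rw [hps, ← Fl4_succ]; exact lat_iter hlatz _
  obtain ⟨b1, b2, b3⟩ := bnds hl hlam (show 0 ≤ 2 * Nat.sqrt e + 1 by omega)
  have hVL := VL hv 1 le_rfl (by omega)
  have hve : vext e v 1 = v 1 := by simp [vext]
  have hoe : oext e o 1 = o 1 := by simp [oext]
  rw [hve, hoe] at hVL
  have h0 : bseq e 0 = ((v 1 : ℤ), (v 1 : ℤ)) := by rw [v1_eq hv]; rfl
  have hv1' : o 1 = true → 1 ≤ (v 1 : ℤ) := by
    intro ho
    have hp := bseq_pos e 1 le_rfl (by omega)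
    unfold VLprop at hVL
    rw [ho] at hVL
    simp [h0] at hVL
    rw [hVL] at hp
    simpa using hp.1
  simp only [Function.iterate_one, Nat.sub_self, zero_add, add_zero] at k1 k2 hVL
  rw [h0] at hb h' b2 b3 k1 k2 hVL
  obtain ⟨x, y⟩ := z
  have hbs : Rfl (y, x) = ((v 1 : ℤ), (v 1 : ℤ)) := by
    simp only [Rfl, Prod.mk.injEq] at hb ⊢
    exact ⟨hb.2, hb.1⟩
  obtain ⟨t, t1, t2, t3⟩ := travel hl b1 b2 b3 (lat_swap hlatz) hbs (Or.inl ⟨by positivity, by positivity⟩)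
    (by simp only at c3; linarith)
  have hP := psiInv_eq hlatz t2 t3
  obtain ⟨s1, s2⟩ := t1 t le_rfl
  have hinv : PsiInv lam (x, y) = ((Fl lam)^[4] (y + t * (lam * (2 * ((v 1 : ℤ):ℝ) + 1)), x - t * (lam * (2 * ((v 1 : ℤ):ℝ) + 1)))).swap := by
    rw [hP, Fl4_succ]
    simp only [Prod.swap_prod_mk]
    rw [s1]
  rw [s1] at s2 t3
  refine ⟨t, ?_⟩
  generalize hq : Psi lam (x, y) = q at *
  obtain ⟨a, b⟩ := q
  have hsum : (y + t * (lam * (2 * ((v 1 : ℤ):ℝ) + 1))) + (x - t * (lam * (2 * ((v 1 : ℤ):ℝ) + 1))) = a + b := by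
    simp only [Prod.mk.injEq] at h'
    rw [h'.1, h'.2]; ring
  rw [abs_le] at b2
  unfold VLprop at hVL
  unfold ExitX at k1
  rw [hinv]
  simp only [Prod.fst_swap, Prod.snd_swap]
  obtain ⟨x1, x2, x3, x4⟩ := box_Rfl s2
  constructor
  · intro ho
    rw [ho] at hVL
    simp at hVL
    rcases k1 with ⟨k, -⟩ | ⟨-, -, k⟩ | ⟨-, -, k⟩
    · obtain ⟨p1, p2⟩ := back_B hl b1 b2.2 (hv1' ho) s2 t3 k2 k hsum hlatr hS
      rw [p1]
      push_cast at *
      refine ⟨by ring, ?_⟩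
      rw [abs_le]
      constructor <;> nlinarith
    · rw [hVL] at k; simp at k
    · rw [hVL] at k; simp at k
  · intro ho
    rw [ho] at hVL
    simp at hVL
    rcases k1 with ⟨-, k⟩ | ⟨-, k, -⟩ | ⟨k, -⟩
    · rcases hVL with hVL | hVL
      · rw [hVL] at k; simp at k
      · omega
    · obtain ⟨p1, p2⟩ := back_R hl b1 b2.2 (by positivity) s2 t3 k2 k hsum hlatr hS
      rw [p1]
      push_cast at *
      refine ⟨by ring, ?_⟩
      rw [abs_le]
      constructor <;> nlinarith
    · simp at k; omega

theorem qseq_succ (V : ℕ → ℕ) (j : ℕ) (hj : 1 ≤ j) : qseq V (j + 1) =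
    if V (j + 1) = V j then qseq V j
    else Nat.lcm ((2 * V (j + 1) + 1) * (2 * V j + 1)) (qseq V j) := by
  obtain ⟨i, rfl⟩ : ∃ i, j = i + 1 := ⟨j - 1, by omega⟩
  rfl

theorem qseq_facts (V : ℕ → ℕ) (j : ℕ) (hj : 1 ≤ j) :
    (2 * V 1 + 1) ^ 2 ∣ qseq V j ∧ (2 * V j + 1) ∣ qseq V j ∧ Odd (qseq V j) := by
  induction j, hj using Nat.le_induction with
  | base =>
    refine ⟨dvd_rfl, ?_, ?_⟩
    · exact dvd_pow_self _ (by norm_num)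
    · exact Odd.pow ⟨V 1, rfl⟩
  | succ j hj ih =>
    obtain ⟨i1, i2, i3⟩ := ih
    rw [qseq_succ V j hj]
    split_ifs with h
    · rw [h]; exact ⟨i1, i2, i3⟩
    · refine ⟨i1.trans (Nat.dvd_lcm_right _ _), (Dvd.intro _ rfl).trans (Nat.dvd_lcm_left _ _), ?_⟩
      have ho : Odd ((2 * V (j + 1) + 1) * (2 * V j + 1)) := Odd.mul ⟨_, rfl⟩ ⟨_, rfl⟩
      exact Odd.of_dvd_nat (ho.mul i3) (Nat.lcm_dvd_mul _ _)

theorem pseq_mul (V : ℕ → ℕ) (j : ℕ) (hj : 1 ≤ j) :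
    (qseq V j : ℤ) = (2 * (V j : ℤ) + 1) * (pseq V j : ℤ) := by
  have := (qseq_facts V j hj).2.1
  have h : (2 * V j + 1) * pseq V j = qseq V j := Nat.mul_div_cancel' this
  rw [← h]; push_cast; ring

theorem arith (V : ℕ → ℕ) (K : ℕ) (A B At Bt : ℕ → ℤ) (X Y Xt Yt Bz Bzt : ℤ)
    (hA : ∀ j, 1 ≤ j → j ≤ K → A j ≡ At j [ZMOD (2 * (V j : ℤ) + 1)] → A j = At j)
    (hS : A 1 + B 1 = X + Y) (hSt : At 1 + Bt 1 = Xt + Yt)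
    (hB : (Bz = X ∧ Bzt = Xt) ∨ (Bz = Y ∧ Bzt = Yt))
    (hB1 : B 1 ≡ Bz [ZMOD (2 * (V 1 : ℤ) + 1)]) (hB1t : Bt 1 ≡ Bzt [ZMOD (2 * (V 1 : ℤ) + 1)])
    (hsame : ∀ j, 1 ≤ j → j + 1 ≤ K → V (j + 1) = V j →
      (A (j + 1) = At (j + 1) → A j ≡ At j [ZMOD (2 * (V j : ℤ) + 1)]) ∧
      (A j = At j → A (j + 1) ≡ At (j + 1) [ZMOD (2 * (V (j + 1) : ℤ) + 1)] ∧
        (A (j + 1) = At (j + 1) → B (j + 1) - Bt (j + 1) = B j - Bt j)))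
    (hdiff : ∀ j, 1 ≤ j → j + 1 ≤ K → V (j + 1) ≠ V j →
      ((2 * (V j : ℤ) + 1) ∣ B (j + 1) - Bt (j + 1) → A j ≡ At j [ZMOD (2 * (V j : ℤ) + 1)]) ∧
      (A j = At j → (A (j + 1) ≡ At (j + 1) [ZMOD (2 * (V (j + 1) : ℤ) + 1)] ↔
          (2 * (V (j + 1) : ℤ) + 1) ∣ B j - Bt j) ∧
        (A (j + 1) = At (j + 1) → ∃ u, B (j + 1) - Bt (j + 1) = (2 * (V j : ℤ) + 1) * u ∧
          (B j - Bt j = (2 * (V (j + 1) : ℤ) + 1) * u ∨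
            B j - Bt j = -((2 * (V (j + 1) : ℤ) + 1) * u))))) :
    ∀ j, 1 ≤ j → j ≤ K →
      ((Bz ≡ Bzt [ZMOD (2 * (V 1 : ℤ) + 1)] ∧
          ∀ i, 1 ≤ i → i ≤ j → A i ≡ At i [ZMOD (2 * (V i : ℤ) + 1)]) ↔
        (A j = At j ∧ (pseq V j : ℤ) ∣ B j - Bt j)) ∧
      (((2 * (V 1 : ℤ) + 1) ∣ (Yt - Y) - (Xt - X) ∧
          (qseq V j : ℤ) ∣ (2 * (V 1 : ℤ) + 1) * ((Xt - X) + (Yt - Y))) ↔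
        (A j = At j ∧ (pseq V j : ℤ) ∣ B j - Bt j)) ∧
      ((A j = At j ∧ (pseq V j : ℤ) ∣ B j - Bt j) →
        ((2 * (V j : ℤ) + 1) * (B j - Bt j) = (2 * (V 1 : ℤ) + 1) * ((Xt - X) + (Yt - Y)) ∨
        (2 * (V j : ℤ) + 1) * (B j - Bt j) = -((2 * (V 1 : ℤ) + 1) * ((Xt - X) + (Yt - Y))))) := by
  -- congruence facts at the first vertex
  have hN1 : (0:ℤ) < 2 * (V 1 : ℤ) + 1 := by positivity
  have hXY : (Bz ≡ Bzt [ZMOD (2 * (V 1 : ℤ) + 1)]) → A 1 = At 1 →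
      (2 * (V 1 : ℤ) + 1) ∣ (Yt - Y) - (Xt - X) := by
    intro h1 h2
    have d1 := (hB1.trans h1).trans hB1t.symm
    have e1 := hB1.dvd
    have e2 := hB1t.dvd
    have e3 := d1.dvd
    rcases hB with ⟨rfl, rfl⟩ | ⟨rfl, rfl⟩
    · have : Yt - Y - (Bzt - Bz) = (Bt 1 - B 1) - 2 * ((Bzt - Bt 1) - (Bz - B 1) + (Bt 1 - B 1)) := by
        linarith
      rw [this]
      exact dvd_sub e3 (Dvd.dvd.mul_left (dvd_add (dvd_sub e2 e1) e3) 2)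
    · have : Bzt - Bz - (Xt - X) = - (Bt 1 - B 1) + 2 * ((Bzt - Bt 1) - (Bz - B 1) + (Bt 1 - B 1)) := by
        linarith
      rw [this]
      exact dvd_add ((dvd_neg).2 e3) (Dvd.dvd.mul_left (dvd_add (dvd_sub e2 e1) e3) 2)
  intro j hj
  induction j, hj using Nat.le_induction with
  | base =>
    intro hK
    have hp : (pseq V 1 : ℤ) = 2 * (V 1 : ℤ) + 1 := by
      have h := pseq_mul V 1 le_rfl
      have h' : (qseq V 1 : ℤ) = (2 * (V 1 : ℤ) + 1) ^ 2 := by simp [qseq]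
      rw [h'] at h
      have := mul_left_cancel₀ hN1.ne' (by linarith : (2 * (V 1 : ℤ) + 1) * (pseq V 1 : ℤ) = (2 * (V 1 : ℤ) + 1) * (2 * (V 1 : ℤ) + 1))
      exact this
    have hq : (qseq V 1 : ℤ) = (2 * (V 1 : ℤ) + 1) * (2 * (V 1 : ℤ) + 1) := by
      rw [pseq_mul V 1 le_rfl, hp]
    have c1 : (Bz ≡ Bzt [ZMOD (2 * (V 1 : ℤ) + 1)] ∧
          ∀ i, 1 ≤ i → i ≤ 1 → A i ≡ At i [ZMOD (2 * (V i : ℤ) + 1)]) ↔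
        (A 1 = At 1 ∧ (pseq V 1 : ℤ) ∣ B 1 - Bt 1) := by
      rw [hp]
      constructor
      · rintro ⟨h1, h2⟩
        refine ⟨hA 1 le_rfl hK (h2 1 le_rfl le_rfl), ?_⟩
        exact ((hB1.trans h1).trans hB1t.symm).symm.dvd
      · rintro ⟨h1, h2⟩
        refine ⟨(hB1.symm.trans ((Int.modEq_iff_dvd.2 h2).symm)).trans hB1t, ?_⟩
        intro i h h'
        obtain rfl : i = 1 := by omega
        rw [h1]
    refine ⟨c1, ⟨?_, ?_⟩, ?_⟩
    · rintro ⟨h1, h2⟩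
      rw [hq] at h2
      have h3 : (2 * (V 1 : ℤ) + 1) ∣ (Xt - X) + (Yt - Y) := Int.dvd_of_mul_dvd_mul_left hN1.ne' h2
      have hodd : IsCoprime (2 * (V 1 : ℤ) + 1) 2 := ⟨1, -(V 1 : ℤ), by ring⟩
      have hX : (2 * (V 1 : ℤ) + 1) ∣ Xt - X := by
        apply hodd.dvd_of_dvd_mul_left
        have := dvd_sub h3 h1
        ring_nf at this ⊢
        exact this
      have hY : (2 * (V 1 : ℤ) + 1) ∣ Yt - Y := by
        have := dvd_sub h3 hX
        simpa using this
      rw [← c1]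
      have hz : Bz ≡ Bzt [ZMOD (2 * (V 1 : ℤ) + 1)] := by
        rw [Int.modEq_iff_dvd]
        rcases hB with ⟨rfl, rfl⟩ | ⟨rfl, rfl⟩ <;> assumption
      refine ⟨hz, ?_⟩
      intro i h h'
      obtain rfl : i = 1 := by omega
      have e3 := ((hB1.trans hz).trans hB1t.symm).dvd
      rw [Int.modEq_iff_dvd]
      have : At 1 - A 1 = ((Xt - X) + (Yt - Y)) - (Bt 1 - B 1) := by linarith
      rw [this]
      exact dvd_sub h3 e3
    · intro h
      have h' := c1.2 h
      refine ⟨hXY h'.1 h.1, ?_⟩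
      rw [hq]
      apply mul_dvd_mul_left
      rw [hp] at h
      have : Xt - X + (Yt - Y) = -(B 1 - Bt 1) := by linarith [h.1]
      rw [this]
      exact dvd_neg.2 h.2
    · intro h
      right
      have : Xt - X + (Yt - Y) = -(B 1 - Bt 1) := by linarith [h.1]
      rw [this]; ring
  | succ j hj ih =>
    intro hK
    obtain ⟨i1, i2, i3⟩ := ih (by omega)
    have hN : (0:ℤ) < 2 * (V j : ℤ) + 1 := by positivity
    have hN' : (0:ℤ) < 2 * (V (j+1) : ℤ) + 1 := by positivity
    have hp := pseq_mul V j hj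
    have hp' := pseq_mul V (j+1) (by omega)
    have hqq := qseq_succ V j hj
    -- splitting of (i)
    have split : (Bz ≡ Bzt [ZMOD (2 * (V 1 : ℤ) + 1)] ∧
          ∀ i, 1 ≤ i → i ≤ j + 1 → A i ≡ At i [ZMOD (2 * (V i : ℤ) + 1)]) ↔
        ((A j = At j ∧ (pseq V j : ℤ) ∣ B j - Bt j) ∧ A (j+1) = At (j+1)) := by
      rw [← i1]
      constructor
      · rintro ⟨h1, h2⟩
        exact ⟨⟨h1, fun i a b => h2 i a (by omega)⟩, hA (j+1) (by omega) hK (h2 (j+1) (by omega) le_rfl)⟩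
      · rintro ⟨⟨h1, h2⟩, h3⟩
        refine ⟨h1, fun i a b => ?_⟩
        rcases Nat.lt_or_ge i (j+1) with c | c
        · exact h2 i a (by omega)
        · obtain rfl : i = j + 1 := by omega
          rw [h3]
    by_cases hV : V (j+1) = V j
    · obtain ⟨s1, s2⟩ := hsame j hj hK hV
      rw [if_pos hV] at hqq
      have hpp : (pseq V (j+1)) = pseq V j := by unfold pseq; rw [hqq, hV]
      have key : (A (j+1) = At (j+1) ∧ (pseq V (j+1) : ℤ) ∣ B (j+1) - Bt (j+1)) ↔
          ((A j = At j ∧ (pseq V j : ℤ) ∣ B j - Bt j)) := by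
        rw [hpp]
        constructor
        · rintro ⟨h1, h2⟩
          have h3 := hA j hj (by omega) (s1 h1)
          have := (s2 h3).2 h1
          rw [this] at h2
          exact ⟨h3, h2⟩
        · rintro ⟨h3, h2⟩
          have h1 := hA (j+1) (by omega) hK (s2 h3).1
          have := (s2 h3).2 h1
          rw [this]
          exact ⟨h1, h2⟩
      refine ⟨?_, ?_, ?_⟩
      · rw [split, key]
        constructor
        · exact fun h => h.1
        · exact fun h => ⟨h, (key.2 h).1⟩
      · rw [key, hqq, i2]
      · intro h
        have h3 := key.1 h
        have := (s2 h3.1).2 h.1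
        rw [this, hV]
        exact i3 h3
    · obtain ⟨s1, s2⟩ := hdiff j hj hK hV
      rw [if_neg hV] at hqq
      have d1 : (2 * (V (j+1) : ℤ) + 1) * (2 * (V j : ℤ) + 1) ∣ (qseq V (j+1) : ℤ) := by
        rw [hqq]
        have := Nat.dvd_lcm_left ((2 * V (j + 1) + 1) * (2 * V j + 1)) (qseq V j)
        exact_mod_cast this
      have d2 : (qseq V j : ℤ) ∣ (qseq V (j+1) : ℤ) := by
        rw [hqq]
        exact_mod_cast Nat.dvd_lcm_right ((2 * V (j + 1) + 1) * (2 * V j + 1)) (qseq V j)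
      have d3 : ∀ c : ℤ, (2 * (V (j+1) : ℤ) + 1) * (2 * (V j : ℤ) + 1) ∣ c → (qseq V j : ℤ) ∣ c →
          (qseq V (j+1) : ℤ) ∣ c := by
        intro c h1 h2
        rw [hqq]
        rw [Int.natCast_dvd]
        apply Nat.lcm_dvd
        · rw [← Int.natCast_dvd]; exact_mod_cast h1
        · rw [← Int.natCast_dvd]; exact h2
      have hpN : (2 * (V j : ℤ) + 1) ∣ (pseq V (j+1) : ℤ) := by
        rw [hp'] at d1
        exact Int.dvd_of_mul_dvd_mul_left hN'.ne' d1
      -- backwards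
      have back : (A (j+1) = At (j+1) ∧ (pseq V (j+1) : ℤ) ∣ B (j+1) - Bt (j+1)) →
          ((A j = At j ∧ (pseq V j : ℤ) ∣ B j - Bt j) ∧ A (j+1) = At (j+1)) := by
        rintro ⟨h1, h2⟩
        have h3 := hA j hj (by omega) (s1 (hpN.trans h2))
        refine ⟨⟨h3, ?_⟩, h1⟩
        obtain ⟨u, u1, u2⟩ := (s2 h3).2 h1
        have h5 : (pseq V j : ℤ) ∣ (2 * (V (j+1) : ℤ) + 1) * u := by
          rw [u1] at h2
          have h4 := d2
          rw [hp, hp'] at h4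
          have h6 := h4.trans (mul_dvd_mul_left _ h2)
          have : (2 * (V (j+1) : ℤ) + 1) * ((2 * (V j : ℤ) + 1) * u) = (2 * (V j : ℤ) + 1) * ((2 * (V (j+1) : ℤ) + 1) * u) := by ring
          rw [this] at h6
          exact Int.dvd_of_mul_dvd_mul_left hN.ne' h6
        rcases u2 with u2 | u2 <;> rw [u2]
        · exact h5
        · exact dvd_neg.2 h5
      have forw : ((A j = At j ∧ (pseq V j : ℤ) ∣ B j - Bt j) ∧ A (j+1) = At (j+1)) →
          (A (j+1) = At (j+1) ∧ (pseq V (j+1) : ℤ) ∣ B (j+1) - Bt (j+1)) := by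
        rintro ⟨⟨h3, h2⟩, h1⟩
        refine ⟨h1, ?_⟩
        obtain ⟨u, u1, u2⟩ := (s2 h3).2 h1
        have h5 : (pseq V j : ℤ) ∣ (2 * (V (j+1) : ℤ) + 1) * u := by
          rcases u2 with u2 | u2 <;> rw [u2] at h2
          · exact h2
          · exact dvd_neg.1 h2
        have h6 : (qseq V (j+1) : ℤ) ∣ (2 * (V (j+1) : ℤ) + 1) * (2 * (V j : ℤ) + 1) * u := by
          apply d3
          · exact Dvd.intro _ rfl
          · rw [hp]
            have : (2 * (V (j+1) : ℤ) + 1) * (2 * (V j : ℤ) + 1) * u = (2 * (V j : ℤ) + 1) * ((2 * (V (j+1) : ℤ) + 1) * u) := by ring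
            rw [this]
            exact mul_dvd_mul_left _ h5
        rw [hp', mul_assoc] at h6
        rw [u1]
        exact Int.dvd_of_mul_dvd_mul_left hN'.ne' h6
      have cons : (A (j+1) = At (j+1) ∧ (pseq V (j+1) : ℤ) ∣ B (j+1) - Bt (j+1)) →
        ((2 * (V (j+1) : ℤ) + 1) * (B (j+1) - Bt (j+1)) = (2 * (V 1 : ℤ) + 1) * ((Xt - X) + (Yt - Y)) ∨
        (2 * (V (j+1) : ℤ) + 1) * (B (j+1) - Bt (j+1)) = -((2 * (V 1 : ℤ) + 1) * ((Xt - X) + (Yt - Y)))) := by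
        intro h
        obtain ⟨h3, h1⟩ := back h
        obtain ⟨u, u1, u2⟩ := (s2 h3.1).2 h1
        rw [u1]
        rcases i3 h3 with c | c <;> rcases u2 with u2 | u2 <;> rw [u2] at c
        · left; linarith
        · right; linarith
        · right; linarith
        · left; linarith
      refine ⟨?_, ⟨?_, ?_⟩, cons⟩
      · rw [split]
        exact ⟨forw, back⟩
      · rintro ⟨h1, h2⟩
        have h3 := i2.1 ⟨h1, d2.trans h2⟩
        have h4 : (qseq V (j+1) : ℤ) ∣ (2 * (V j : ℤ) + 1) * (B j - Bt j) := by
          rcases i3 h3 with c | c <;> rw [c]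
          · exact h2
          · exact dvd_neg.2 h2
        have h5 : (2 * (V (j+1) : ℤ) + 1) ∣ B j - Bt j := by
          have := d1.trans h4
          rw [mul_comm] at this
          exact Int.dvd_of_mul_dvd_mul_left hN.ne' this
        have h6 := hA (j+1) (by omega) hK ((s2 h3.1).1.2 h5)
        exact forw ⟨h3, h6⟩
      · intro h
        have h3 := (back h).1
        refine ⟨(i2.2 h3).1, ?_⟩
        have h4 : (qseq V (j+1) : ℤ) ∣ (2 * (V (j+1) : ℤ) + 1) * (B (j+1) - Bt (j+1)) := by
          rw [hp']; exact mul_dvd_mul_left _ h.2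
        rcases cons h with c | c <;> rw [c] at h4
        · exact h4
        · exact dvd_neg.1 h4

theorem lattice_iff {lam : ℝ} (hl : 0 < lam) (V1 q : ℕ) (hq : (2 * V1 + 1) ^ 2 ∣ q) (ho : Odd q)
    (dX dY : ℤ) : ((lam * dX, lam * dY) : ℝ × ℝ) ∈ latticeL lam V1 q ↔
      ((2 * (V1:ℤ) + 1) ∣ dY - dX ∧ (q:ℤ) ∣ (2 * (V1:ℤ) + 1) * (dX + dY)) := by
  obtain ⟨r, rfl⟩ := hq
  have hN : (0:ℤ) < 2 * (V1:ℤ) + 1 := by positivity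
  have hNr : (0:ℝ) < 2 * (V1:ℝ) + 1 := by positivity
  have hLv : ((((2 * V1 + 1) ^ 2 * r : ℕ)) : ℝ) / (2 * (V1:ℝ) + 1) = (2 * V1 + 1) * r := by
    push_cast; field_simp
  have hro : Odd r := by
    rw [Nat.odd_mul] at ho; exact ho.2
  obtain ⟨s, hs⟩ := hro
  unfold latticeL
  rw [AddSubgroup.mem_closure_pair]
  simp only [Lvec, wmn, mul_div_assoc, hLv]
  constructor
  · rintro ⟨a, b, h⟩
    simp only [Prod.ext_iff, Prod.fst_add, Prod.snd_add, Prod.smul_fst, Prod.smul_snd, Prod.fst_sub, Prod.snd_sub] at h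
    simp only [zsmul_eq_mul, smul_eq_mul] at h
    obtain ⟨h1, h2⟩ := h
    have e1 : (dY:ℝ) - dX = b * (2 * V1 + 1) := by
      apply mul_left_cancel₀ hl.ne'
      push_cast at h1 h2
      linarith
    have e2 : (dX:ℝ) + dY = (2 * a + b) * ((2 * V1 + 1) * r) := by
      apply mul_left_cancel₀ hl.ne'
      push_cast at h1 h2
      linarith
    have e1' : dY - dX = b * (2 * V1 + 1) := by exact_mod_cast e1
    have e2' : dX + dY = (2 * a + b) * ((2 * V1 + 1) * r) := by exact_mod_cast e2
    refine ⟨⟨b, by linarith⟩, ⟨2 * a + b, ?_⟩⟩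
    rw [e2']; push_cast; ring
  · rintro ⟨⟨b, hb⟩, ⟨c, hc⟩⟩
    have hc' : dX + dY = (2 * V1 + 1) * r * c := by
      apply mul_left_cancel₀ hN.ne'
      rw [hc]; push_cast; ring
    -- parity
    have hpar : ∃ a, c = 2 * a + b := by
      have hcb : (c - b) % 2 = 0 := by
        have : 2 * dX = (2 * V1 + 1) * (2 * s + 1) * c - (2 * V1 + 1) * b := by
          rw [hs] at hc'; push_cast at hc'; linarith
        have h2 : c - b = 2 * (dX - (V1 * (2 * s + 1) + s) * c + V1 * b) := by linarith
        omega
      exact ⟨(c - b) / 2, by omega⟩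
    obtain ⟨a, rfl⟩ := hpar
    have e1 : (dY:ℝ) - dX = (2 * V1 + 1) * b := by exact_mod_cast hb
    have e2 : (dX:ℝ) + dY = (2 * V1 + 1) * r * (2 * a + b) := by exact_mod_cast hc'
    refine ⟨a, b, ?_⟩
    simp only [Prod.ext_iff, Prod.fst_add, Prod.snd_add, Prod.smul_fst, Prod.smul_snd, Prod.fst_sub, Prod.snd_sub]
    simp only [zsmul_eq_mul, smul_eq_mul]
    push_cast
    have e3 : (dX:ℝ) = ((2 * V1 + 1) * r * (2 * a + b) - (2 * V1 + 1) * b) / 2 := by linarith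
    have e4 : (dY:ℝ) = ((2 * V1 + 1) * r * (2 * a + b) + (2 * V1 + 1) * b) / 2 := by linarith
    rw [e3, e4]
    constructor <;> ring

theorem win_pair {lam : ℝ} (hl : 0 < lam) {b b' : ℤ × ℤ} {V : ℕ} {O : Bool} {w wt : ℝ × ℝ} {A At : ℤ}
    (hV : VLprop b b' V O) (hE : ExitX lam b b' w.1 w.2) (hEt : ExitX lam b b' wt.1 wt.2)
    (hb : Rfl w = b) (hbt : Rfl wt = b) (hA : crd O w = lam * A) (hAt : crd O wt = lam * At) :
    (A ≡ At [ZMOD (2 * (V : ℤ) + 1)] → A = At) ∧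
    ∃ c : ℤ, |crd O w - c| ≤ lam * (2 * V + 1) ∧ |crd O wt - c| ≤ lam * (2 * V + 1) := by
  have key : ∃ r : ℝ, (r ≤ crd O w ∧ crd O w < r + lam * (2 * V + 1) ∧ r ≤ crd O wt ∧ crd O wt < r + lam * (2 * V + 1)) ∧
      ∃ c : ℤ, (r = c ∨ r = c - lam * (2 * V + 1)) := by
    obtain ⟨m, n⟩ := b
    obtain ⟨m', n'⟩ := b'
    obtain ⟨x, y⟩ := w
    obtain ⟨xt, yt⟩ := wt
    obtain ⟨h1, h2, h3, h4⟩ := box_Rfl hb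
    obtain ⟨h1t, h2t, h3t, h4t⟩ := box_Rfl hbt
    unfold VLprop at hV
    unfold ExitX at hE hEt
    simp only [Prod.mk.injEq] at *
    rcases hV with ⟨rfl, hV, g1, g2⟩ | ⟨rfl, ⟨hn, hV, g1, g2⟩ | ⟨hn, hV, g1, g2⟩⟩
    · have hV' : (V:ℝ) = m := by exact_mod_cast hV
      rcases hE with ⟨⟨e1, -⟩, -⟩ | ⟨-, -, k⟩ | ⟨-, -, k⟩ <;> [skip; omega; omega]
      rcases hEt with ⟨⟨e1t, -⟩, -⟩ | ⟨-, -, k⟩ | ⟨-, -, k⟩ <;> [skip; omega; omega]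
      simp only [crd, if_true]
      rw [hV']
      exact ⟨n, ⟨h3, e1, h3t, e1t⟩, n, Or.inl rfl⟩
    · have hV' : (V:ℝ) = n := by exact_mod_cast hV
      rcases hE with ⟨-, k⟩ | ⟨-, ⟨e1, -⟩, -⟩ | ⟨-, -, k⟩ <;> [omega; skip; omega]
      rcases hEt with ⟨-, k⟩ | ⟨-, ⟨e1t, -⟩, -⟩ | ⟨-, -, k⟩ <;> [omega; skip; omega]
      simp only [crd, Bool.false_eq_true, if_false]
      rw [hV']
      refine ⟨m + 1 - lam * (2 * n + 1), ⟨e1, by linarith, e1t, by linarith⟩, m + 1, Or.inr (by push_cast; ring)⟩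
    · have hV' : (V:ℝ) = -n - 1 := by exact_mod_cast hV
      rcases hE with ⟨-, k⟩ | ⟨k, -⟩ | ⟨-, ⟨e1, -⟩, -⟩ <;> [omega; omega; skip]
      rcases hEt with ⟨-, k⟩ | ⟨k, -⟩ | ⟨-, ⟨e1t, -⟩, -⟩ <;> [omega; omega; skip]
      simp only [crd, Bool.false_eq_true, if_false]
      rw [hV']
      refine ⟨m, ⟨h1, by linarith, h1t, by linarith⟩, m, Or.inl rfl⟩
  obtain ⟨r, ⟨k1, k2, k3, k4⟩, c, hc⟩ := key
  have hN : (0:ℝ) < lam * (2 * V + 1) := by positivity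
  constructor
  · intro hm
    have hd : (2 * (V:ℤ) + 1) ∣ At - A := Int.modEq_iff_dvd.1 hm
    rw [hA] at k1 k2
    rw [hAt] at k3 k4
    have j1 : lam * ((At:ℝ) - A) < lam * (2 * V + 1) := by linarith
    have j2 : lam * ((A:ℝ) - At) < lam * (2 * V + 1) := by linarith
    have j1 := lt_of_mul_lt_mul_left j1 hl.le
    have j2 := lt_of_mul_lt_mul_left j2 hl.le
    have j1 : At - A < 2 * V + 1 := by exact_mod_cast j1
    have j2 : A - At < 2 * V + 1 := by exact_mod_cast j2
    have := Int.eq_zero_of_abs_lt_dvd hd (abs_lt.2 ⟨by omega, j1⟩)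
    omega
  · refine ⟨c, ?_, ?_⟩ <;> rw [abs_le] <;> rcases hc with rfl | rfl <;> constructor <;> linarith

theorem int_of_lam {lam : ℝ} (hl : 0 < lam) {A B : ℤ} (h : lam * A = lam * B) : A = B := by
  have := mul_left_cancel₀ hl.ne' h
  exact_mod_cast this

/-- one step of the vertex recursion, in integer coordinates, for two points at once -/
theorem step_pair {lam : ℝ} (hl : 0 < lam) {b b' b'' : ℤ × ℤ} {V V' : ℕ} {O O' : Bool}
    {X Y X' Y' Xt Yt Xt' Yt' : ℤ} {t tt : ℕ}
    (hV : VLprop b b' V O) (hV' : VLprop b' b'' V' O')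
    (hE : ExitX lam b b' (lam * X) (lam * Y)) (hEt : ExitX lam b b' (lam * Xt) (lam * Yt))
    (hn : ((lam * X', lam * Y') : ℝ × ℝ) = (((Fl lam)^[4] (lam * X, lam * Y)).1 + t * (lam * (2 * b'.2 + 1)),
      ((Fl lam)^[4] (lam * X, lam * Y)).2 - t * (lam * (2 * b'.1 + 1))))
    (hnt : ((lam * Xt', lam * Yt') : ℝ × ℝ) = (((Fl lam)^[4] (lam * Xt, lam * Yt)).1 + tt * (lam * (2 * b'.2 + 1)),
      ((Fl lam)^[4] (lam * Xt, lam * Yt)).2 - tt * (lam * (2 * b'.1 + 1)))) :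
    ∃ s s' d dt : ℤ, (s = 2 * V + 1 ∨ s = -(2 * V + 1)) ∧ (O' ≠ O → (s' = 2 * V' + 1 ∨ s' = -(2 * V' + 1))) ∧
      ((if O then Y' else X') = (if O then Y else X) + s * (1 + t)) ∧
      ((if O then Yt' else Xt') = (if O then Yt else Xt) + s * (1 + tt)) ∧
      ((if O then X' else Y') = (if O then X else Y) + d + s' * t) ∧
      ((if O then Xt' else Yt') = (if O then Xt else Yt) + dt + s' * tt) ∧
      ((if O then Y else X) = (if O then Yt else Xt) → d = dt) := by
  obtain ⟨m, n⟩ := b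
  obtain ⟨m', n'⟩ := b'
  obtain ⟨m'', n''⟩ := b''
  unfold VLprop at hV hV'
  unfold ExitX at hE hEt
  simp only [Prod.mk.injEq] at *
  rcases hV with ⟨rfl, hV, rfl, rfl⟩ | ⟨rfl, ⟨hn0, hV, rfl, rfl⟩ | ⟨hn0, hV, rfl, rfl⟩⟩
  · rcases hE with ⟨⟨-, ⟨θ, e2, e3⟩, -⟩, -⟩ | ⟨-, -, k⟩ | ⟨-, -, k⟩ <;> [skip; omega; omega]
    rcases hEt with ⟨⟨-, ⟨θt, e2t, e3t⟩, -⟩, -⟩ | ⟨-, -, k⟩ | ⟨-, -, k⟩ <;> [skip; omega; omega]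
    rw [e2] at hn
    rw [e2t] at hnt
    refine ⟨-(2 * m' + 1), 2 * (n - 1) + 1, 2 * n - 1 + θ, 2 * n - 1 + θt, by omega, ?_, ?_, ?_, ?_, ?_, ?_⟩
    · intro hO
      cases O' <;> simp at hV' hO
      omega
    · apply int_of_lam hl; push_cast at *; simp only [if_true]; rw [hn.2]; ring
    · apply int_of_lam hl; push_cast at *; simp only [if_true]; rw [hnt.2]; ring
    · apply int_of_lam hl; push_cast at *; simp only [if_true]; rw [hn.1]; ring
    · apply int_of_lam hl; push_cast at *; simp only [if_true]; rw [hnt.1]; ring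
    · simp only [if_true]
      rintro rfl
      rcases e3 with ⟨rfl, e3⟩ | ⟨rfl, e3⟩ <;> rcases e3t with ⟨rfl, e3t⟩ | ⟨rfl, e3t⟩ <;> first | rfl | (exfalso; linarith)
  · rcases hE with ⟨-, k⟩ | ⟨-, ⟨-, ⟨θ, e2, e3⟩, -⟩, -⟩ | ⟨-, -, k⟩ <;> [omega; skip; omega]
    rcases hEt with ⟨-, k⟩ | ⟨-, ⟨-, ⟨θt, e2t, e3t⟩, -⟩, -⟩ | ⟨-, -, k⟩ <;> [omega; skip; omega]
    rw [e2] at hn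
    rw [e2t] at hnt
    refine ⟨2 * n' + 1, -(2 * (m + 1) + 1), -(2 * m + 1 + θ), -(2 * m + 1 + θt), by omega, ?_, ?_, ?_, ?_, ?_, ?_⟩
    · intro hO
      cases O' <;> simp at hV' hO
      omega
    · apply int_of_lam hl; push_cast at *; try simp only [Bool.false_eq_true, if_false]
      rw [hn.1]; ring
    · apply int_of_lam hl; push_cast at *; try simp only [Bool.false_eq_true, if_false]
      rw [hnt.1]; ring
    · apply int_of_lam hl; push_cast at *; try simp only [Bool.false_eq_true, if_false]
      rw [hn.2]; ring
    · apply int_of_lam hl; push_cast at *; try simp only [Bool.false_eq_true, if_false]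
      rw [hnt.2]; ring
    · simp only [Bool.false_eq_true, if_false]
      rintro rfl
      rcases e3 with ⟨rfl, e3⟩ | ⟨rfl, e3⟩ <;> rcases e3t with ⟨rfl, e3t⟩ | ⟨rfl, e3t⟩ <;> first | rfl | (exfalso; linarith)
  · rcases hE with ⟨-, k⟩ | ⟨k, -⟩ | ⟨-, ⟨-, ⟨θ, e2, e3⟩, -⟩, -⟩ <;> [omega; omega; skip]
    rcases hEt with ⟨-, k⟩ | ⟨k, -⟩ | ⟨-, ⟨-, ⟨θt, e2t, e3t⟩, -⟩, -⟩ <;> [omega; omega; skip]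
    rw [e2] at hn
    rw [e2t] at hnt
    refine ⟨2 * n' + 1, -(2 * (m - 1) + 1), -(2 * m + θ), -(2 * m + θt), by omega, ?_, ?_, ?_, ?_, ?_, ?_⟩
    · intro hO
      cases O' <;> simp at hV' hO
      omega
    · apply int_of_lam hl; push_cast at *; try simp only [Bool.false_eq_true, if_false]
      rw [hn.1]; ring
    · apply int_of_lam hl; push_cast at *; try simp only [Bool.false_eq_true, if_false]
      rw [hnt.1]; ring
    · apply int_of_lam hl; push_cast at *; try simp only [Bool.false_eq_true, if_false]
      rw [hn.2]; ring
    · apply int_of_lam hl; push_cast at *; try simp only [Bool.false_eq_true, if_false]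
      rw [hnt.2]; ring
    · simp only [Bool.false_eq_true, if_false]
      rintro rfl
      rcases e3 with ⟨rfl, e3⟩ | ⟨rfl, e3⟩ <;> rcases e3t with ⟨rfl, e3t⟩ | ⟨rfl, e3t⟩ <;> first | rfl | (exfalso; linarith)

theorem same_arith {N N' s s' d dt t tt A At A' At' B Bt B' Bt' : ℤ} (hN : N' = N) (hpos : 0 < N)
    (hs : s = N ∨ s = -N)
    (h1 : A' = A + s * (1 + t)) (h2 : At' = At + s * (1 + tt))
    (h3 : B' = B + d + s' * t) (h4 : Bt' = Bt + dt + s' * tt) (h5 : A = At → d = dt) :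
    (A' = At' → A ≡ At [ZMOD N]) ∧
      (A = At → A' ≡ At' [ZMOD N'] ∧ (A' = At' → B' - Bt' = B - Bt)) := by
  subst hN
  have hsd : N' ∣ s := by rcases hs with rfl | rfl <;> simp
  constructor
  · intro h
    rw [Int.modEq_iff_dvd]
    have : At - A = s * (t - tt) := by linarith
    rw [this]; exact Dvd.dvd.mul_right hsd _
  · intro h
    constructor
    · rw [Int.modEq_iff_dvd]
      have : At' - A' = s * (tt - t) := by rw [h1, h2, h]; ring
      rw [this]; exact Dvd.dvd.mul_right hsd _
    · intro h'
      have hd := h5 h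
      have : s * (t - tt) = 0 := by linarith
      have hs0 : s ≠ 0 := by rcases hs with rfl | rfl <;> omega
      have : t = tt := by
        rcases mul_eq_zero.1 this with h | h
        · exact absurd h hs0
        · omega
      subst this
      rw [h3, h4, hd]; ring

theorem diff_arith {N N' s s' d dt t tt A At A' At' B Bt B' Bt' : ℤ}
    (hs : s = N ∨ s = -N) (hs' : s' = N' ∨ s' = -N')
    (h1 : B' = A + s * (1 + t)) (h2 : Bt' = At + s * (1 + tt))
    (h3 : A' = B + d + s' * t) (h4 : At' = Bt + dt + s' * tt) (h5 : A = At → d = dt) :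
    (N ∣ B' - Bt' → A ≡ At [ZMOD N]) ∧
      (A = At → (A' ≡ At' [ZMOD N'] ↔ N' ∣ B - Bt) ∧
        (A' = At' → ∃ u, B' - Bt' = N * u ∧ (B - Bt = N' * u ∨ B - Bt = -(N' * u)))) := by
  have hsd : N ∣ s := by rcases hs with rfl | rfl <;> simp
  have hsd' : N' ∣ s' := by rcases hs' with rfl | rfl <;> simp
  constructor
  · intro h
    rw [Int.modEq_iff_dvd]
    have : At - A = s * (t - tt) - (B' - Bt') := by rw [h1, h2]; ring
    rw [this]; exact dvd_sub (Dvd.dvd.mul_right hsd _) h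
  · intro h
    have hd := h5 h
    constructor
    · rw [Int.modEq_iff_dvd]
      have : At' - A' = s' * (tt - t) - (B - Bt) := by rw [h3, h4, hd]; ring
      rw [this]
      exact dvd_sub_right (Dvd.dvd.mul_right hsd' _)
    · intro h'
      have e1 : B' - Bt' = s * (t - tt) := by rw [h1, h2, h]; ring
      have e2 : B - Bt = -(s' * (t - tt)) := by
        have : B + d + s' * t = Bt + dt + s' * tt := by rw [← h3, ← h4, h']
        linarith
      rcases hs with rfl | rfl <;> rcases hs' with rfl | rfl
      · exact ⟨t - tt, e1, Or.inr e2⟩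
      · exact ⟨t - tt, e1, Or.inl (by rw [e2]; ring)⟩
      · exact ⟨-(t - tt), by rw [e1]; ring, Or.inl (by rw [e2]; ring)⟩
      · exact ⟨-(t - tt), by rw [e1]; ring, Or.inr (by rw [e2]; ring)⟩

/-- integer coordinates of the vertex points of a regular point -/
theorem pt_data {e : ℕ} {lam : ℝ} {z : ℝ × ℝ} {v : ℕ → ℕ} {o : ℕ → Bool}
    (hv : IsVertexList e v o) (he : 1 ≤ e) (hl : 0 < lam)
    (hlam : lam * ((e:ℝ) + 10) ^ 2 ≤ 1 / 1000) (hz : IsRegularPt lam e z) (hb : Rfl z = bseq e 0) :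
    ∃ X Y : ℕ → ℤ, z = (lam * X 0, lam * Y 0) ∧
      (∀ j, 1 ≤ j → j ≤ 2 * Nat.sqrt e + 1 → (Psi lam)^[j] z = (lam * X j, lam * Y j) ∧
        ExitX lam (bseq e (j - 1)) (bseq e j) (lam * X j) (lam * Y j) ∧
        Rfl (lam * X j, lam * Y j) = bseq e (j - 1)) ∧
      (∀ j, 1 ≤ j → j + 1 ≤ 2 * Nat.sqrt e + 1 → ∃ t : ℕ,
        ((lam * X (j + 1), lam * Y (j + 1)) : ℝ × ℝ) =
          (((Fl lam)^[4] (lam * X j, lam * Y j)).1 + t * (lam * (2 * (bseq e j).2 + 1)),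
           ((Fl lam)^[4] (lam * X j, lam * Y j)).2 - t * (lam * (2 * (bseq e j).1 + 1)))) ∧
      ∃ T : ℕ, X 1 = X 0 + T * (2 * (v 1 : ℤ) + 1) ∧ Y 1 = Y 0 - T * (2 * (v 1 : ℤ) + 1) := by
  have hlatj : ∀ j, ∃ a b : ℤ, j ≤ 2 * Nat.sqrt e + 1 → (Psi lam)^[j] z = (lam * a, lam * b) := by
    intro j
    rcases Nat.eq_zero_or_pos j with rfl | hj
    · obtain ⟨a, b, h⟩ := hz.1.1.1
      exact ⟨a, b, fun _ => h⟩
    · by_cases hj2 : j ≤ 2 * Nat.sqrt e + 1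
      · obtain ⟨T, hT⟩ := trk_all he hl hlam hz (by omega) hb j hj (by omega)
        obtain ⟨a, b, h⟩ := (trk_reg hz hT).1.1
        exact ⟨a, b, fun _ => h⟩
      · exact ⟨0, 0, fun h => absurd h hj2⟩
  choose X Y hXY using hlatj
  have h0 := hXY 0 (by omega)
  refine ⟨X, Y, h0, ?_, ?_, ?_⟩
  · intro j h1 h2
    obtain ⟨T, hT⟩ := trk_all he hl hlam hz (by omega) hb j h1 (by omega)
    obtain ⟨a1, a2, a3⟩ := trk_exit hl hlam hz h1 (by omega) hT
    rw [hXY j h2] at a1 a2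
    exact ⟨hXY j h2, a1, a2⟩
  · intro j h1 h2
    obtain ⟨T, hT⟩ := trk_all he hl hlam hz (by omega) hb j h1 (by omega)
    obtain ⟨t, -, -, h⟩ := trk_succ he hl hlam h1 (by omega) hz hT
    rw [hXY j (by omega), hXY (j + 1) h2] at h
    exact ⟨t, h⟩
  · obtain ⟨T, -, h⟩ := trk_one he hl hlam hz (by omega) hb
    have h1 := hXY 1 (by omega)
    simp only [Function.iterate_one] at h1
    simp only [Function.iterate_zero, id] at h0
    have hb0 : bseq e 0 = ((v 1 : ℤ), (v 1 : ℤ)) := by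
      rw [v1_eq hv]; rfl
    rw [h1, hb0] at h
    simp only [Prod.mk.injEq] at h
    rw [h0] at h
    refine ⟨T, ?_, ?_⟩
    · apply int_of_lam hl; rw [h.1]; push_cast; ring
    · apply int_of_lam hl; rw [h.2]; push_cast; ring

set_option maxHeartbeats 2000000 in
theorem main_pos {e : ℕ} {lam : ℝ} {z zt : ℝ × ℝ} {v : ℕ → ℕ} {o : ℕ → Bool}
    (hv : IsVertexList e v o) (he : 1 ≤ e) (hl : 0 < lam)
    (hlam : lam * ((e:ℝ) + 10) ^ 2 ≤ 1 / 1000) (hz : IsRegularPt lam e z) (hzt : IsRegularPt lam e zt)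
    {j : ℕ} (h1 : 1 ≤ j) (h2 : j ≤ 2 * Nat.sqrt e + 1) {σ σt : ℤ → ℤ}
    (hs : IsOrbitCode lam e v o z σ) (hst : IsOrbitCode lam e v o zt σt) :
    ((σ (-1) = σt (-1) ∧ ∀ i : ℕ, 1 ≤ i → i ≤ j → σ (i : ℤ) = σt (i : ℤ)) ↔
                zt - z ∈ latticeL lam (v 1) (qseq (vext e v) j)) ∧
              (zt - z ∈ latticeL lam (v 1) (qseq (vext e v) j) ↔
                ∃ c : ℤ, (Psi lam)^[j] zt - (Psi lam)^[j] z =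
                  c • ((lam * (pseq (vext e v) j : ℝ)) • evec (oext e o j))) := by
  have start : ∀ z σ, IsRegularPt lam e z → IsOrbitCode lam e v o z σ → Rfl z = bseq e 0 := by
    intro z σ hz hs
    have hH : Ham z ∈ Icrit e := by
      have := hz.1.2 _ (orbit_mem (z := z) (k := 0) (by omega))
      simpa using this
    rcases start_box he hl hlam hz.1.1 hH hz.2.1 with h | ⟨h, h'⟩
    · exact h
    · exact (not_odd hv he hl hlam hz h h' hs).elim
  have hb := start z σ hz hs
  have hbt := start zt σt hzt hst
  obtain ⟨X, Y, z0, zj, zn, T, hX1, hY1⟩ := pt_data hv he hl hlam hz hb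
  obtain ⟨Xt, Yt, z0t, zjt, znt, Tt, hX1t, hY1t⟩ := pt_data hv he hl hlam hzt hbt
  have hv1 : vext e v 1 = v 1 := by simp [vext]
  have ho1 : oext e o 1 = o 1 := by simp [oext]
  -- smallness of types
  have hVs : ∀ i, 1 ≤ i → i ≤ 2 * Nat.sqrt e + 1 → lam * (4 * (vext e v i : ℝ) + 2) ≤ 1 := by
    intro i i1 i2
    have hVL := VL hv i i1 i2
    obtain ⟨b1, b2, b3⟩ := bseq_bd e (i - 1) (by omega)
    rw [abs_le] at b3
    have hle : (vext e v i : ℤ) ≤ e + 1 := by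
      unfold VLprop at hVL
      rcases hVL with ⟨-, h, -⟩ | ⟨-, ⟨-, h, -⟩ | ⟨-, h, -⟩⟩ <;> omega
    have hle : (vext e v i : ℝ) ≤ e + 1 := by exact_mod_cast hle
    have e0 : (0:ℝ) ≤ e := by positivity
    have : 4 * (vext e v i : ℝ) + 2 ≤ (e + 10) ^ 2 := by nlinarith
    have := mul_le_mul_of_nonneg_left this hl.le
    linarith
  -- the integer data
  let A : ℕ → ℤ := fun i => if oext e o i then Y i else X i
  let B : ℕ → ℤ := fun i => if oext e o i then X i else Y i
  let At : ℕ → ℤ := fun i => if oext e o i then Yt i else Xt i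
  let Bt : ℕ → ℤ := fun i => if oext e o i then Xt i else Yt i
  have hcrd : ∀ i, 1 ≤ i → i ≤ 2 * Nat.sqrt e + 1 → crd (oext e o i) ((Psi lam)^[i] z) = lam * A i := by
    intro i i1 i2
    rw [(zj i i1 i2).1]
    simp only [crd, A]; split_ifs <;> rfl
  have hcrdt : ∀ i, 1 ≤ i → i ≤ 2 * Nat.sqrt e + 1 → crd (oext e o i) ((Psi lam)^[i] zt) = lam * At i := by
    intro i i1 i2
    rw [(zjt i i1 i2).1]
    simp only [crd, At]; split_ifs <;> rfl
  have hwin : ∀ i, 1 ≤ i → i ≤ 2 * Nat.sqrt e + 1 → _ := fun i i1 i2 =>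
    win_pair (w := (Psi lam)^[i] z) (wt := (Psi lam)^[i] zt) hl (VL hv i i1 i2)
      (by rw [(zj i i1 i2).1]; exact (zj i i1 i2).2.1) (by rw [(zjt i i1 i2).1]; exact (zjt i i1 i2).2.1)
      (by rw [(zj i i1 i2).1]; exact (zj i i1 i2).2.2) (by rw [(zjt i i1 i2).1]; exact (zjt i i1 i2).2.2)
      (hcrd i i1 i2) (hcrdt i i1 i2)
  have hcode : ∀ i : ℕ, 1 ≤ i → i ≤ 2 * Nat.sqrt e + 1 →
      (σ (i : ℤ) = σt (i : ℤ) ↔ A i ≡ At i [ZMOD (2 * (vext e v i : ℤ) + 1)]) := by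
    intro i i1 i2
    obtain ⟨-, c, c1, c2⟩ := hwin i i1 i2
    exact code_iff hl (hs.2 i i1 (by omega)) (hst.2 i i1 (by omega)) (hcrd i i1 i2) (hcrdt i i1 i2)
      (hVs i i1 i2) c1 c2
  let Bz : ℤ := if o 1 then X 0 else Y 0
  let Bzt : ℤ := if o 1 then Xt 0 else Yt 0
  have hV1s := hVs 1 le_rfl (by omega)
  rw [hv1] at hV1s
  have hcode0 : σ (-1) = σt (-1) ↔ Bz ≡ Bzt [ZMOD (2 * (vext e v 1 : ℤ) + 1)] := by
    rw [hv1]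
    obtain ⟨t, p1, p2⟩ := psiInv_spec hv he hl hlam hz hb
    obtain ⟨tt, p1t, p2t⟩ := psiInv_spec hv he hl hlam hzt hbt
    have g1 := hs.1
    have g2 := hst.1
    rw [z0] at p1 p2
    rw [z0t] at p1t p2t
    rw [← z0] at p1 p2
    rw [← z0t] at p1t p2t
    simp only [Bz, Bzt]
    cases ho : o 1
    · obtain ⟨a1, a2⟩ := p2 ho
      obtain ⟨a1t, a2t⟩ := p2t ho
      rw [ho] at g1 g2
      have := code_iff hl (O := true) (c := (v 1 : ℤ) + 1) (A := Y 0 + (2 * (v 1 : ℤ) + 1) * (t + 1))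
        (At := Yt 0 + (2 * (v 1 : ℤ) + 1) * (tt + 1)) g1 g2
        (by simp only [crd, if_true]; rw [a1, z0]; push_cast; ring)
        (by simp only [crd, if_true]; rw [a1t, z0t]; push_cast; ring)
        hV1s (by simp only [crd, if_true]; push_cast; exact a2)
        (by simp only [crd, if_true]; push_cast; exact a2t)
      rw [this]
      simp [Int.ModEq, Int.add_mul_emod_self_left]
    · obtain ⟨a1, a2⟩ := p1 ho
      obtain ⟨a1t, a2t⟩ := p1t ho
      rw [ho] at g1 g2
      have := code_iff hl (O := false) (c := (v 1 : ℤ)) (A := X 0 + (2 * (v 1 : ℤ) + 1) * (-(t + 1)))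
        (At := Xt 0 + (2 * (v 1 : ℤ) + 1) * (-(tt + 1))) g1 g2
        (by simp only [crd, Bool.false_eq_true, if_false]; rw [a1, z0]; push_cast; ring)
        (by simp only [crd, Bool.false_eq_true, if_false]; rw [a1t, z0t]; push_cast; ring)
        hV1s (by simp only [crd, Bool.false_eq_true, if_false]; push_cast; exact a2)
        (by simp only [crd, Bool.false_eq_true, if_false]; push_cast; exact a2t)
      rw [this]
      simp only [Int.ModEq, Int.add_mul_emod_self_left, if_true]
  have hstep : ∀ i, 1 ≤ i → i + 1 ≤ 2 * Nat.sqrt e + 1 → ∃ (t tt : ℕ) (s s' d dt : ℤ), _ := fun i i1 i2 => by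
    obtain ⟨t, ht⟩ := zn i i1 i2
    obtain ⟨tt, htt⟩ := znt i i1 i2
    obtain ⟨s, s', d, dt, h⟩ := step_pair hl (VL hv i i1 (by omega)) (VL hv (i + 1) (by omega) i2)
      (zj i i1 (by omega)).2.1 (zjt i i1 (by omega)).2.1 ht htt
    exact ⟨t, tt, s, s', d, dt, h⟩
  have main := arith (vext e v) (2 * Nat.sqrt e + 1) A B At Bt (X 0) (Y 0) (Xt 0) (Yt 0) Bz Bzt
    (fun i i1 i2 => (hwin i i1 i2).1)
    (by simp only [A, B]; split_ifs <;> omega)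
    (by simp only [At, Bt]; split_ifs <;> omega)
    (by simp only [Bz, Bzt]; split_ifs <;> simp)
    (by
      rw [hv1]; simp only [B, Bz, ho1]
      split_ifs
      · rw [hX1]; simp [Int.ModEq]
      · rw [hY1]; simp [Int.ModEq])
    (by
      rw [hv1]; simp only [Bt, Bzt, ho1]
      split_ifs
      · rw [hX1t]; simp [Int.ModEq]
      · rw [hY1t]; simp [Int.ModEq])
    (by
      intro i i1 i2 hVV
      obtain ⟨t, tt, s, s', d, dt, k1, k2, k3, k4, k5, k6, k7⟩ := hstep i i1 i2
      have hO := (VO_iff hv i i1 i2).1 hVV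
      refine same_arith (s := s) (s' := s') (d := d) (dt := dt) (t := t) (tt := tt) (by rw [hVV]) (by positivity) k1 ?_ ?_ ?_ ?_ k7
      · simp only [A, hO]; exact k3
      · simp only [At, hO]; exact k4
      · simp only [B, hO]; exact k5
      · simp only [Bt, hO]; exact k6)
    (by
      intro i i1 i2 hVV
      obtain ⟨t, tt, s, s', d, dt, k1, k2, k3, k4, k5, k6, k7⟩ := hstep i i1 i2
      have hO : oext e o (i + 1) ≠ oext e o i := fun h => hVV ((VO_iff hv i i1 i2).2 h)
      have hO' : oext e o (i + 1) = !(oext e o i) := by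
        revert hO; cases oext e o (i + 1) <;> cases oext e o i <;> simp
      refine diff_arith (s := s) (s' := s') (d := d) (dt := dt) (t := t) (tt := tt) k1 (k2 hO) ?_ ?_ ?_ ?_ k7
      · rw [← k3]; simp only [B, A, hO']; cases oext e o i <;> simp
      · rw [← k4]; simp only [Bt, At, hO']; cases oext e o i <;> simp
      · rw [← k5]; simp only [B, A, hO']; cases oext e o i <;> simp
      · rw [← k6]; simp only [Bt, At, hO']; cases oext e o i <;> simp)
    j h1 h2
  obtain ⟨m1, m2, -⟩ := main
  have hii : zt - z ∈ latticeL lam (v 1) (qseq (vext e v) j) ↔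
      (A j = At j ∧ (pseq (vext e v) j : ℤ) ∣ B j - Bt j) := by
    rw [← m2]
    have hd : zt - z = ((lam * ((Xt 0 - X 0 : ℤ) : ℝ), lam * ((Yt 0 - Y 0 : ℤ) : ℝ)) : ℝ × ℝ) := by
      conv_lhs => rw [z0, z0t]
      (refine Prod.ext ?_ ?_ <;> dsimp only [Prod.fst_sub, Prod.snd_sub] <;> push_cast <;> ring)
    obtain ⟨q1, -, q3⟩ := qseq_facts (vext e v) j h1
    rw [hv1] at q1
    rw [hd, lattice_iff hl (v 1) _ q1 q3, hv1]
  have hi : (σ (-1) = σt (-1) ∧ ∀ i : ℕ, 1 ≤ i → i ≤ j → σ (i : ℤ) = σt (i : ℤ)) ↔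
      (A j = At j ∧ (pseq (vext e v) j : ℤ) ∣ B j - Bt j) := by
    rw [← m1, hcode0]
    refine and_congr Iff.rfl ⟨fun h i i1 i2 => ?_, fun h i i1 i2 => ?_⟩
    · exact (hcode i i1 (by omega)).1 (h i i1 i2)
    · exact (hcode i i1 (by omega)).2 (h i i1 i2)
  have hiii : (∃ c : ℤ, (Psi lam)^[j] zt - (Psi lam)^[j] z =
                  c • ((lam * (pseq (vext e v) j : ℝ)) • evec (oext e o j))) ↔
      (A j = At j ∧ (pseq (vext e v) j : ℤ) ∣ B j - Bt j) := by
    rw [(zj j h1 h2).1, (zjt j h1 h2).1]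
    simp only [A, At, B, Bt]
    cases oext e o j
    · simp only [evec, Bool.false_eq_true, if_false]
      constructor
      · rintro ⟨c, hc⟩
        have c1 := congrArg Prod.fst hc
        have c2 := congrArg Prod.snd hc
        simp at c1 c2
        refine ⟨(int_of_lam hl (by linarith)), -c, ?_⟩
        apply int_of_lam hl
        push_cast; linarith
      · rintro ⟨a, c, hc⟩
        refine ⟨-c, ?_⟩
        have hc' : (Y j : ℝ) - Yt j = pseq (vext e v) j * c := by exact_mod_cast hc
        refine Prod.ext ?_ ?_
        · simp [a]
        · simp
          linear_combination (-lam) * hc'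
    · simp only [evec, if_true]
      constructor
      · rintro ⟨c, hc⟩
        have c1 := congrArg Prod.fst hc
        have c2 := congrArg Prod.snd hc
        simp at c1 c2
        refine ⟨(int_of_lam hl (by linarith)), -c, ?_⟩
        apply int_of_lam hl
        push_cast; linarith
      · rintro ⟨a, c, hc⟩
        refine ⟨-c, ?_⟩
        have hc' : (X j : ℝ) - Xt j = pseq (vext e v) j * c := by exact_mod_cast hc
        refine Prod.ext ?_ ?_
        · simp
          linear_combination (-lam) * hc'
        · simp [a]
  exact ⟨hi.trans hii.symm, hii.trans hiii.symm⟩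

theorem zero_step {lam x y : ℝ} (hl : 0 < lam) (hx : 0 ≤ x) (hy : lam ≤ y) (hs : x + y < 1) :
    (Fl lam)^[4] (x, y) = (x + lam, y - lam) := by
  have hfx : ⌊x⌋ = 0 := Int.floor_eq_iff.2 ⟨by simpa using hx, by push_cast; linarith⟩
  have e1 : ⌊-y⌋ = -1 := Int.floor_eq_iff.2 ⟨by push_cast; linarith, by push_cast; linarith⟩
  have e2 : ⌊-lam - x⌋ = -1 := Int.floor_eq_iff.2 ⟨by push_cast; linarith, by push_cast; linarith⟩
  have e3 : ⌊-lam + y⌋ = 0 := Int.floor_eq_iff.2 ⟨by push_cast; linarith, by push_cast; linarith⟩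
  simp [Function.iterate_succ, Fl, hfx, e1, e2, e3]
  ring

theorem zero_trans {lam x : ℝ} (hl : 0 < lam) (h1 : lam < 1) (hx : 0 < x) (hs : x < 1) :
    Rfl ((Fl lam)^[4] (x, 0)) ≠ Rfl (x, 0) := by
  have hfx : ⌊x⌋ = 0 := Int.floor_eq_iff.2 ⟨by push_cast; linarith, by push_cast; linarith⟩
  have e2 : ⌊-x⌋ = -1 := Int.floor_eq_iff.2 ⟨by push_cast; linarith, by push_cast; linarith⟩
  have e3 : ⌊-lam⌋ = -1 := Int.floor_eq_iff.2 ⟨by push_cast; linarith, by push_cast; linarith⟩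
  simp [Function.iterate_succ, Fl, Rfl, hfx, e2, e3]

theorem zero_iter {lam x y : ℝ} (hl : 0 < lam) (hx : 0 ≤ x) (hs : x + y < 1) (i : ℕ) (h : lam * i ≤ y) :
    (Fl lam)^[4 * i] (x, y) = (x + lam * i, y - lam * i) := by
  induction i with
  | zero => simp
  | succ i ih =>
    push_cast at h
    have : 4 * (i + 1) = 4 + 4 * i := by ring
    rw [this, Function.iterate_add_apply, ih (by linarith), zero_step hl (by positivity) (by linarith) (by linarith)]
    push_cast
    (refine Prod.ext ?_ ?_ <;> dsimp only <;> ring)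

theorem zero_Psi {lam : ℝ} {z : ℝ × ℝ} (hl : 0 < lam) (h1 : lam < 1) (hz : IsRegularPt lam 0 z) :
    Psi lam z = (z.1 + z.2, 0) := by
  have hH : Ham z ∈ Icrit 0 := by
    have := hz.1.2 _ (orbit_mem (z := z) (k := 0) (by omega))
    simpa using this
  obtain ⟨⟨⟨⟨a, b, rfl⟩, hx, hy, -⟩, -⟩, hL, -⟩ := hz
  simp only at hx hy ⊢
  have hb0 : Rfl (lam * a, lam * b) = (0, 0) := by
    have hn : nextE 0 ≤ 1 := Nat.sInf_le ⟨⟨1, 0, by norm_num⟩, by norm_num⟩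
    have hlt : Ham (lam * a, lam * b) < 1 := lt_of_lt_of_le hH.2 (by exact_mod_cast hn)
    have hnn : ∀ x : ℝ, 0 ≤ x → 0 ≤ Pfun x ∧ (Pfun x < 1 → ⌊x⌋ = 0) := by
      intro x hx
      have f0 : (0:ℤ) ≤ ⌊x⌋ := Int.floor_nonneg.2 hx
      have f0' : (0:ℝ) ≤ ⌊x⌋ := by exact_mod_cast f0
      have f1 := Int.floor_le x
      unfold Pfun
      refine ⟨by have := sub_nonneg.2 f1; positivity, fun h => ?_⟩
      by_contra hc
      have : (1:ℝ) ≤ ⌊x⌋ := by exact_mod_cast (show (1:ℤ) ≤ ⌊x⌋ by omega)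
      nlinarith [sub_nonneg.2 f1]
    obtain ⟨p1, p2⟩ := hnn _ hx
    obtain ⟨q1, q2⟩ := hnn _ hy
    simp only [Ham] at hlt
    simp only [Rfl, Prod.mk.injEq]
    exact ⟨p2 (by linarith), q2 (by linarith)⟩
  have hHe := Ham_eq hb0
  push_cast at hHe
  have hn : nextE 0 ≤ 1 := Nat.sInf_le ⟨⟨1, 0, by norm_num⟩, by norm_num⟩
  have hlt : Ham (lam * a, lam * b) < 1 := lt_of_lt_of_le hH.2 (by exact_mod_cast hn)
  have hgt : (0:ℝ) < Ham (lam * a, lam * b) := by simpa using hH.1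
  rw [hHe] at hlt hgt
  have hsum : lam * a + lam * b < 1 := by linarith
  have hpos : 0 < lam * a + lam * b := by linarith
  have hb : 0 ≤ b := by
    have := (mul_nonneg_iff_of_pos_left hl).1 hy
    exact_mod_cast this
  obtain ⟨n, rfl⟩ := Int.eq_ofNat_of_zero_le hb
  push_cast at *
  have hn1 : 1 ≤ n := by
    by_contra hc
    have : n = 0 := by omega
    subst this
    apply hL
    refine ⟨⟨a, 0, by simp⟩, ?_⟩
    simp only [Nat.cast_zero, mul_zero, add_zero] at *
    exact zero_trans hl h1 hpos hsum
  have key : ∀ i : ℕ, i ≤ n → lam * (i:ℝ) ≤ lam * n := fun i hi =>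
    mul_le_mul_of_nonneg_left (by exact_mod_cast hi) hl.le
  rw [Psi_eq hn1, zero_iter hl hx hsum n le_rfl]
  · (refine Prod.ext ?_ ?_ <;> dsimp only <;> ring)
  · rw [zero_iter hl hx hsum n le_rfl, sub_self]
    refine ⟨⟨a + n, 0, by refine Prod.ext ?_ ?_ <;> push_cast <;> ring⟩, ?_⟩
    exact zero_trans hl h1 hpos hsum
  · rintro s hs1 hs2 ⟨-, hc⟩
    apply hc
    have k1 := key s hs2.le
    have k2 := key (s + 1) hs2
    push_cast at k2
    have := (show (0:ℝ) ≤ lam * s by positivity)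
    rw [zero_iter hl hx hsum s k1, zero_step hl (by linarith) (by linarith) (by linarith)]
    rw [Rfl_box (m := 0) (n := 0), Rfl_box (m := 0) (n := 0)] <;> push_cast <;> linarith

theorem main_zero {lam : ℝ} {z zt : ℝ × ℝ} {v : ℕ → ℕ} {o : ℕ → Bool}
    (hv : IsVertexList 0 v o) (hl : 0 < lam) (hl1 : lam < 1)
    (hz : IsRegularPt lam 0 z) (hzt : IsRegularPt lam 0 zt)
    {σ σt : ℤ → ℤ}
    (hs : IsOrbitCode lam 0 v o z σ) (hst : IsOrbitCode lam 0 v o zt σt) :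
    ((σ (-1) = σt (-1) ∧ ∀ i : ℕ, 1 ≤ i → i ≤ 1 → σ (i : ℤ) = σt (i : ℤ)) ↔
                zt - z ∈ latticeL lam (v 1) (qseq (vext 0 v) 1)) ∧
              (zt - z ∈ latticeL lam (v 1) (qseq (vext 0 v) 1) ↔
                ∃ c : ℤ, (Psi lam)^[1] zt - (Psi lam)^[1] z =
                  c • ((lam * (pseq (vext 0 v) 1 : ℝ)) • evec (oext 0 o 1))) := by
  have hv1 : v 1 = 0 := by have := v1_eq hv; simpa using this
  have hve : vext 0 v 1 = 0 := by simp [vext, hv1]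
  have ho : o 1 = true := by
    rcases VL1 hv 1 le_rfl (by omega) with ⟨h, -⟩ | ⟨-, -, h⟩
    · exact h
    · exfalso
      revert h
      simp [bseq, nextB]
  have hoe : oext 0 o 1 = true := by simp [oext, ho]
  have hq : qseq (vext 0 v) 1 = 1 := by simp [qseq, hve]
  have hp : pseq (vext 0 v) 1 = 1 := by simp [pseq, hq, hve]
  have P1 := zero_Psi hl hl1 hz
  have P2 := zero_Psi hl hl1 hzt
  obtain ⟨a, b, hab⟩ := hz.1.1.1
  obtain ⟨at', bt, habt⟩ := hzt.1.1.1
  have i0 : σ (-1) = σt (-1) ∧ ∀ i : ℕ, 1 ≤ i → i ≤ 1 → σ (i : ℤ) = σt (i : ℤ) := by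
    constructor
    · have g1 := hs.1.1
      have g2 := hs.1.2.1
      have g3 := hst.1.1
      have g4 := hst.1.2.1
      rw [hv1] at g2 g4
      push_cast at g2 g4
      omega
    · intro i i1 i2
      have : i = 1 := by omega
      subst this
      obtain ⟨g1, g2, -⟩ := hs.2 1 le_rfl (by simp)
      obtain ⟨g3, g4, -⟩ := hst.2 1 le_rfl (by simp)
      rw [hve] at g2 g4
      push_cast at *
      omega
  have ii : zt - z ∈ latticeL lam (v 1) (qseq (vext 0 v) 1) := by
    rw [hq, hv1]
    have hd : zt - z = ((lam * ((at' - a : ℤ) : ℝ), lam * ((bt - b : ℤ) : ℝ)) : ℝ × ℝ) := by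
      rw [hab, habt]
      (refine Prod.ext ?_ ?_ <;> dsimp only [Prod.fst_sub, Prod.snd_sub] <;> push_cast <;> ring)
    rw [hd, lattice_iff hl 0 1 (by simp) (by simp)]
    simp
  have iii : ∃ c : ℤ, (Psi lam)^[1] zt - (Psi lam)^[1] z =
                  c • ((lam * (pseq (vext 0 v) 1 : ℝ)) • evec (oext 0 o 1)) := by
    refine ⟨at' + bt - a - b, ?_⟩
    rw [Function.iterate_one, P1, P2, hab, habt, hp, hoe]
    simp only [evec, if_true]
    refine Prod.ext ?_ ?_
    · simp; ring
    · simp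
  exact ⟨iff_of_true i0 ii, iff_of_true ii iii⟩

theorem orbit_code_cylinder_sets
    (e : ℕ) (he : e ∈ Eset) (v : ℕ → ℕ) (o : ℕ → Bool) (hv : IsVertexList e v o) :
    ∃ lam0 > (0 : ℝ), ∀ lam : ℝ, 0 < lam → lam < lam0 →
      ∀ J : Set ℝ, IsMaxRegInterval lam e J →
        ∀ j : ℕ, 1 ≤ j → j ≤ 2 * (Nat.sqrt e + 1) - 1 →
          ∀ z zt : ℝ × ℝ, z ∈ Xtilde lam e J → zt ∈ Xtilde lam e J →
            ∀ σ σt : ℤ → ℤ, IsOrbitCode lam e v o z σ →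
              IsOrbitCode lam e v o zt σt →
              ((σ (-1) = σt (-1) ∧ ∀ i : ℕ, 1 ≤ i → i ≤ j → σ (i : ℤ) = σt (i : ℤ)) ↔
                zt - z ∈ latticeL lam (v 1) (qseq (vext e v) j)) ∧
              (zt - z ∈ latticeL lam (v 1) (qseq (vext e v) j) ↔
                ∃ c : ℤ, (Psi lam)^[j] zt - (Psi lam)^[j] z =
                  c • ((lam * (pseq (vext e v) j : ℝ)) • evec (oext e o j))) := by
  refine ⟨1 / (1000 * ((e:ℝ) + 10) ^ 2), by positivity, ?_⟩
  intro lam hl hlt J hJ j hj1 hj2 z zt hz hzt σ σt hs hst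
  have e0 : (0:ℝ) ≤ e := by positivity
  have hlam : lam * ((e:ℝ) + 10) ^ 2 ≤ 1 / 1000 := by
    rw [lt_div_iff₀ (by positivity)] at hlt
    linarith
  have hz' := hJ.2.2.1 z hz.1 hz.2
  have hzt' := hJ.2.2.1 zt hzt.1 hzt.2
  rcases Nat.eq_zero_or_pos e with h0 | hpos
  · subst h0
    have : j = 1 := by simp at hj2; omega
    subst this
    refine main_zero hv hl ?_ hz' hzt' hs hst
    push_cast at hlam
    linarith
  · exact main_pos hv hpos hl hlam hz' hzt' hj1 (by omega) hs hst
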